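/- Let n ≥ 1 and 1 < p < ∞. The symbol K̂(ξ,τ) := (1 + 4π²|ξ|² + iτ)^{1/2} / (1 + |ξ| + |τ|^{1/2}) is an Lᵖ(ℝ^{n+1})-multiplier; that is, there exists M > 0 (depending only on n, p) such that ‖𝓕⁻¹(K̂·𝓕f)‖_{Lᵖ} ≤ M·‖f‖_{Lᵖ} for every Schwartz function f on ℝ^{n+1}. -/

import Mathlib

noncomputable section

open MeasureTheory Real Complex
open scoped ENNReal NNReal Real BigOperators

/-- Euclidean space `ℝⁿ`. -/
abbrev Rn (n : ℕ) : Type := EuclideanSpace ℝ (Fin n)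

/-- The space `ℝ^{n+1} = ℝⁿ × ℝ`, points written `(X, t)`. -/
abbrev Rn1 (n : ℕ) : Type := EuclideanSpace ℝ (Fin n) × ℝ

/-- Fourier transform on `ℝ^{n+1}`:
`𝓕f(ξ,τ) = ∫ e^{−2πi(X·ξ + tτ)} f(X,t) dX dt`. -/
def FT1 {n : ℕ} (f : Rn1 n → ℂ) (q : Rn1 n) : ℂ :=
  ∫ p : Rn1 n,
    Complex.exp (-(2 * (π : ℂ) * Complex.I) *
      (((∑ k, p.1 k * q.1 k) + p.2 * q.2 : ℝ) : ℂ)) * f p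

/-- Inverse Fourier transform on `ℝ^{n+1}`. -/
def IFT1 {n : ℕ} (f : Rn1 n → ℂ) (x : Rn1 n) : ℂ :=
  ∫ q : Rn1 n,
    Complex.exp ((2 * (π : ℂ) * Complex.I) *
      (((∑ k, q.1 k * x.1 k) + q.2 * x.2 : ℝ) : ℂ)) * f q

/-- The Fourier multiplier operator `f ↦ 𝓕⁻¹(m · 𝓕 f)` on `ℝ^{n+1}`. -/
def MOp {n : ℕ} (m : Rn1 n → ℂ) (f : Rn1 n → ℂ) : Rn1 n → ℂ :=
  IFT1 (fun q => m q * FT1 f q)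

/-- The symbol `m_α(ξ,τ) = (1 + 4π²|ξ|² + iτ)^{α/2}` (principal branch). -/
def mSym {n : ℕ} (α : ℝ) (q : Rn1 n) : ℂ :=
  (1 + 4 * (π : ℂ) ^ 2 * (‖q.1‖ : ℂ) ^ 2 + Complex.I * (q.2 : ℂ)) ^ ((α : ℂ) / 2)

/-- Partial derivative `∂_{X_k}`. -/
def dX {n : ℕ} (k : Fin n) (f : Rn1 n → ℂ) : Rn1 n → ℂ :=
  fun x => fderiv ℝ f x (EuclideanSpace.single k 1, 0)

/-- Partial derivative `∂_t`. -/
def dT {n : ℕ} (f : Rn1 n → ℂ) : Rn1 n → ℂ :=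
  fun x => fderiv ℝ f x (0, 1)

/-- Iterated spatial derivative `D_X^β` for a multi-index `β`. -/
def dXmulti {n : ℕ} (β : Fin n → ℕ) (f : Rn1 n → ℂ) : Rn1 n → ℂ :=
  (List.finRange n).foldr (fun k g => (dX k)^[β k] g) f

/-- The half time-derivative `D_t^{1/2} f = 𝓕⁻¹(|τ|^{1/2}·𝓕f)`. -/
def halfDt {n : ℕ} (f : Rn1 n → ℂ) : Rn1 n → ℂ :=
  MOp (fun q => ((|q.2| ^ ((1 : ℝ) / 2) : ℝ) : ℂ)) f

/-- The `Lᵖ(ℝ^{n+1})` norm (as a value in `ℝ≥0∞`), `p` a real exponent. -/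
def pNorm {n : ℕ} (p : ℝ) (f : Rn1 n → ℂ) : ℝ≥0∞ :=
  eLpNorm f (ENNReal.ofReal p) volume

/-- Multi-indices `β ∈ ℕⁿ` with `|β| = N`. -/
def multiIdx (n N : ℕ) : Finset (Fin n → ℕ) :=
  (Fintype.piFinset fun _ : Fin n => Finset.range (N + 1)).filter fun β => (∑ k, β k) = N

/-- Convolution on `ℝ^{n+1}`. -/
def conv1 {n : ℕ} (g f : Rn1 n → ℂ) : Rn1 n → ℂ :=
  fun x => ∫ y : Rn1 n, g (x - y) * f y

/-- A parabolic Littlewood–Paley family on `ℝ^{n+1}`. -/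
structure ParabolicLP (n : ℕ) where
  φ : SchwartzMap (Rn1 n) ℂ
  ψ : SchwartzMap (Rn1 n) ℂ
  ft_pos : ∀ q : Rn1 n,
    1 / 2 < ‖q.1‖ + |q.2| ^ ((1 : ℝ) / 2) → ‖q.1‖ + |q.2| ^ ((1 : ℝ) / 2) < 2 →
      0 < (FT1 (⇑φ) q).re ∧ (FT1 (⇑φ) q).im = 0
  ft_supp : ∀ q : Rn1 n,
    ¬(1 / 2 < ‖q.1‖ + |q.2| ^ ((1 : ℝ) / 2) ∧ ‖q.1‖ + |q.2| ^ ((1 : ℝ) / 2) < 2) →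
      FT1 (⇑φ) q = 0
  ft_sum : ∀ q : Rn1 n, q ≠ 0 →
    ∑' i : ℤ, FT1 (⇑φ) (((2 : ℝ) ^ (-i)) • q.1, ((2 : ℝ) ^ (-(2 * i))) * q.2) = 1
  ft_psi : ∀ q : Rn1 n,
    FT1 (⇑ψ) q =
      1 - ∑' i : ℕ,
        FT1 (⇑φ) (((2 : ℝ) ^ (-((i : ℤ) + 1))) • q.1, ((2 : ℝ) ^ (-(2 * ((i : ℤ) + 1)))) * q.2)

/-- The dilate `φ_i`, whose Fourier transform is `𝓕φ(2^{−i}ξ, 2^{−2i}τ)`. -/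
def lpPhi {n : ℕ} (P : ParabolicLP n) (i : ℕ) : Rn1 n → ℂ :=
  fun x => (((2 : ℝ) ^ (i * (n + 2)) : ℝ) : ℂ) *
    P.φ (((2 : ℝ) ^ i) • x.1, ((2 : ℝ) ^ (2 * i)) * x.2)

/-- Parabolic Besov norm `N_{s,p}(f)` on `ℝ^{n+1}`, `1 ≤ p < ∞`. -/
def pBesov {n : ℕ} (P : ParabolicLP n) (s p : ℝ) (f : Rn1 n → ℂ) : ℝ≥0∞ :=
  eLpNorm (conv1 (⇑P.ψ) f) (ENNReal.ofReal p) volume +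
  (∑' i : ℕ,
    (ENNReal.ofReal ((2 : ℝ) ^ (s * ((i : ℝ) + 1))) *
      eLpNorm (conv1 (lpPhi P (i + 1)) f) (ENNReal.ofReal p) volume) ^ p) ^ (1 / p)

/-- Parabolic Besov norm `N_{s,∞}(f)` on `ℝ^{n+1}`. -/
def pBesovInf {n : ℕ} (P : ParabolicLP n) (s : ℝ) (f : Rn1 n → ℂ) : ℝ≥0∞ :=
  max (eLpNorm (conv1 (⇑P.ψ) f) ⊤ volume)
    (⨆ i : ℕ, ENNReal.ofReal ((2 : ℝ) ^ (s * ((i : ℝ) + 1))) *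
      eLpNorm (conv1 (lpPhi P (i + 1)) f) ⊤ volume)

/-- The time interval `(0, T)` for `0 < T ≤ ∞`. -/
def tSet (T : ℝ≥0∞) : Set ℝ := {t : ℝ | 0 < t ∧ ENNReal.ofReal t < T}

/-- Lebesgue measure restricted to the strip `ℝⁿ × (0,T)`. -/
def stripMeasure (n : ℕ) (T : ℝ≥0∞) : Measure (Rn1 n) :=
  volume.restrict {x : Rn1 n | x.2 ∈ tSet T}

/-- The parabolic Sobolev norm `‖g‖_{W^{2i,i}_p(ℝⁿ_T)}`. -/
def wNorm {n : ℕ} (i : ℕ) (p : ℝ) (T : ℝ≥0∞) (g : Rn1 n → ℂ) : ℝ≥0∞ :=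
  ∑ l ∈ Finset.range (i + 1),
    ∑ β ∈ (Fintype.piFinset fun _ : Fin n => Finset.range (2 * i + 1)).filter
        (fun β => (∑ k, β k) + 2 * l ≤ 2 * i),
      eLpNorm (dXmulti β (dT^[l] g)) (ENNReal.ofReal p) (stripMeasure n T)

/-- Time-regularity seminorm `[g]_{t,β,p,T}`. -/
def semT {n : ℕ} (b p : ℝ) (T : ℝ≥0∞) (g : Rn1 n → ℂ) : ℝ≥0∞ :=
  (∫⁻ X : Rn n, ∫⁻ t in tSet T, ∫⁻ s in tSet T,
      ENNReal.ofReal (‖g (X, t) - g (X, s)‖ ^ p / |t - s| ^ (1 + p * b / 2))) ^ (1 / p)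

/-- Space-regularity seminorm `[g]_{x,β,p,T}`. -/
def semX {n : ℕ} (b p : ℝ) (T : ℝ≥0∞) (g : Rn1 n → ℂ) : ℝ≥0∞ :=
  (∫⁻ t in tSet T, ∫⁻ X : Rn n, ∫⁻ Y : Rn n,
      ENNReal.ofReal (‖g (X + Y, t) - 2 * g (X, t) + g (X - Y, t)‖ ^ p /
        ‖Y‖ ^ ((n : ℝ) + p * b))) ^ (1 / p)

/-- The parabolic Besov norm `‖g‖_{B^{α,α/2}_p(ℝⁿ_T)}`, formed with index `i` where
`2i < α < 2i+2`. -/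
def pbNorm {n : ℕ} (i : ℕ) (α p : ℝ) (T : ℝ≥0∞) (g : Rn1 n → ℂ) : ℝ≥0∞ :=
  wNorm i p T g +
  ∑ l ∈ Finset.range (i + 1),
    ∑ β ∈ (Fintype.piFinset fun _ : Fin n => Finset.range (2 * i + 1)).filter
        (fun β => (∑ k, β k) + 2 * l = 2 * i),
      (semT (α - 2 * i) p T (dXmulti β (dT^[l] g)) +
        semX (α - 2 * i) p T (dXmulti β (dT^[l] g)))

/-- Fourier transform on `ℝⁿ`. -/
def FTn {n : ℕ} (f : Rn n → ℂ) (ξ : Rn n) : ℂ :=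
  ∫ x : Rn n, Complex.exp (-(2 * (π : ℂ) * Complex.I) * (((∑ k, x k * ξ k : ℝ)) : ℂ)) * f x

/-- Inverse Fourier transform on `ℝⁿ`. -/
def IFTn {n : ℕ} (f : Rn n → ℂ) (x : Rn n) : ℂ :=
  ∫ ξ : Rn n, Complex.exp ((2 * (π : ℂ) * Complex.I) * (((∑ k, ξ k * x k : ℝ)) : ℂ)) * f ξ

/-- Convolution on `ℝⁿ`. -/
def convn {n : ℕ} (g f : Rn n → ℂ) : Rn n → ℂ := fun x => ∫ y : Rn n, g (x - y) * f y

/-- A Littlewood–Paley family on `ℝⁿ`. -/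
structure LPFamily (n : ℕ) where
  φ : SchwartzMap (Rn n) ℂ
  ψ : SchwartzMap (Rn n) ℂ
  ft_pos : ∀ ξ : Rn n, 1 / 2 < ‖ξ‖ → ‖ξ‖ < 2 →
    0 < (FTn (⇑φ) ξ).re ∧ (FTn (⇑φ) ξ).im = 0
  ft_supp : ∀ ξ : Rn n, ¬(1 / 2 < ‖ξ‖ ∧ ‖ξ‖ < 2) → FTn (⇑φ) ξ = 0
  ft_sum : ∀ ξ : Rn n, ξ ≠ 0 → ∑' i : ℤ, FTn (⇑φ) (((2 : ℝ) ^ (-i)) • ξ) = 1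
  ft_psi : ∀ ξ : Rn n,
    FTn (⇑ψ) ξ = 1 - ∑' i : ℕ, FTn (⇑φ) (((2 : ℝ) ^ (-((i : ℤ) + 1))) • ξ)

/-- The dilate `φ′_i(x) = 2^{in} φ′(2^i x)`. -/
def lpPhin {n : ℕ} (P : LPFamily n) (i : ℕ) : Rn n → ℂ :=
  fun x => (((2 : ℝ) ^ (i * n) : ℝ) : ℂ) * P.φ (((2 : ℝ) ^ i) • x)

/-- Besov norm `B_{s,p}(f)` on `ℝⁿ`, `1 ≤ p < ∞`. -/
def besovN {n : ℕ} (P : LPFamily n) (s p : ℝ) (f : Rn n → ℂ) : ℝ≥0∞ :=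
  eLpNorm (convn (⇑P.ψ) f) (ENNReal.ofReal p) volume +
  (∑' i : ℕ,
    (ENNReal.ofReal ((2 : ℝ) ^ (s * ((i : ℝ) + 1))) *
      eLpNorm (convn (lpPhin P (i + 1)) f) (ENNReal.ofReal p) volume) ^ p) ^ (1 / p)

/-- The heat kernel `Γ(X,t)` on `ℝⁿ` (zero for `t ≤ 0`). -/
def heatKer (n : ℕ) (X : Rn n) (t : ℝ) : ℝ :=
  if 0 < t then (4 * π * t) ^ (-(n : ℝ) / 2) * Real.exp (-‖X‖ ^ 2 / (4 * t)) else 0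

/-- The heat extension `u(X,t) = ∫ Γ(X−Y,t) f(Y) dY`. -/
def heatExt {n : ℕ} (f : Rn n → ℂ) : Rn1 n → ℂ :=
  fun x => ∫ Y : Rn n, (heatKer n (x.1 - Y) x.2 : ℂ) * f Y

section Fourier

open FourierTransform SchwartzMap
open scoped ContDiff

theorem eLpNorm_fourier_eq_of_integrable {V : Type*} [NormedAddCommGroup V] [InnerProductSpace ℝ V]
    [FiniteDimensional ℝ V] [MeasurableSpace V] [BorelSpace V] {f : V → ℂ}
    (hf : Integrable f) (hf2 : MemLp f 2) :
    eLpNorm (𝓕 f) 2 volume = eLpNorm f 2 volume := by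
  have hcont : Continuous (𝓕 f) :=
    VectorFourier.fourierIntegral_continuous Real.continuous_fourierChar continuous_inner hf
  have key : (𝓕 (hf2.toLp f) : Lp ℂ 2 (volume : Measure V)) =ᵐ[volume] 𝓕 f := by
    apply ae_eq_of_integral_contDiff_smul_eq
    · exact (Lp.memLp _).locallyIntegrable (by norm_num)
    · exact hcont.locallyIntegrable
    · intro g g_smooth g_cpt
      have hg₁ : HasCompactSupport (Complex.ofRealCLM ∘ g) := g_cpt.comp_left rfl
      have hg₂ : ContDiff ℝ ∞ (Complex.ofRealCLM ∘ g) := by fun_prop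
      set G : 𝓢(V, ℂ) := hg₁.toSchwartzMap hg₂ with hG
      have h1 : Lp.toTemperedDistribution (𝓕 (hf2.toLp f) : Lp ℂ 2 (volume : Measure V)) G
          = Lp.toTemperedDistribution (hf2.toLp f) (𝓕 G) := by
        rw [← Lp.fourier_toTemperedDistribution_eq]
        rfl
      rw [Lp.toTemperedDistribution_apply, Lp.toTemperedDistribution_apply] at h1
      have h2 : ∫ x, (𝓕 G) x • (hf2.toLp f : V → ℂ) x = ∫ x, (𝓕 (G : V → ℂ)) x • f x := by
        apply integral_congr_ae
        filter_upwards [hf2.coeFn_toLp] with x hx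
        rw [hx, SchwartzMap.fourier_coe]
      have h3 : ∫ x, (𝓕 (G : V → ℂ)) x • f x = ∫ x, G x • 𝓕 f x := by
        simpa using! VectorFourier.integral_bilin_fourierIntegral_eq_flip (.mul ℂ ℂ) (L := innerₗ V)
          continuous_fourierChar continuous_inner G.integrable hf
      rw [h2, h3] at h1
      simpa [hG] using h1
  rw [← eLpNorm_congr_ae key, ← eLpNorm_congr_ae hf2.coeFn_toLp]
  have := Lp.norm_fourier_eq (hf2.toLp f)
  rw [Lp.norm_def, Lp.norm_def] at this
  exact (ENNReal.toReal_eq_toReal_iff' (Lp.eLpNorm_ne_top _) (Lp.eLpNorm_ne_top _)).1 this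

variable {n : ℕ}

/-- The Euclidean (inner product) model of `ℝⁿ × ℝ`. -/
abbrev HRn1 (n : ℕ) : Type := WithLp 2 (Rn n × ℝ)

theorem FT1_eq_fourier (f : Rn1 n → ℂ) (q : Rn1 n) :
    FT1 f q = 𝓕 (fun v : HRn1 n => f v.ofLp) (WithLp.toLp 2 q) := by
  rw [Real.fourier_eq]
  have := (WithLp.volume_preserving_ofLp (Rn n) ℝ).integral_comp
    (MeasurableEquiv.toLp 2 (Rn n × ℝ)).symm.measurableEmbedding
    (fun p : Rn1 n => Complex.exp (-(2 * (π : ℂ) * Complex.I) *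
      (((∑ k, p.1 k * q.1 k) + p.2 * q.2 : ℝ) : ℂ)) * f p)
  rw [FT1, ← this]
  congr 1
  ext v
  rw [Circle.smul_def, Real.fourierChar_apply, smul_eq_mul]
  congr 2
  have hin : inner ℝ v (WithLp.toLp 2 q) = (∑ k, v.ofLp.1 k * q.1 k) + v.ofLp.2 * q.2 := by
    have h := WithLp.prod_inner_apply (𝕜 := ℝ) v (WithLp.toLp 2 q)
    rw [h, PiLp.inner_apply]
    simp [mul_comm]
  rw [hin]
  push_cast
  ring

theorem IFT1_eq_FT1_neg (f : Rn1 n → ℂ) (x : Rn1 n) : IFT1 f x = FT1 f (-x) := by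
  simp only [IFT1, FT1]
  congr 1
  ext q
  congr 2
  simp only [Prod.fst_neg, Prod.snd_neg, PiLp.neg_apply, mul_neg, Finset.sum_neg_distrib]
  push_cast
  ring

theorem eLpNorm_comp_ofLp {G : Type*} [NormedAddCommGroup G] {f : Rn1 n → G} {p : ℝ≥0∞} :
    eLpNorm (fun v : HRn1 n => f v.ofLp) p volume = eLpNorm f p volume := by
  have h := WithLp.volume_preserving_ofLp (Rn n) ℝ
  have := (MeasurableEquiv.toLp 2 (Rn n × ℝ)).symm.measurableEmbedding.eLpNorm_map_measure (g := f)
    (p := p) (μ := (volume : Measure (HRn1 n)))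
  rw [show (volume : Measure (HRn1 n)).map (MeasurableEquiv.toLp 2 (Rn n × ℝ)).symm
    = (volume : Measure (Rn1 n)) from h.map_eq] at this
  exact this.symm

theorem eLpNorm_comp_toLp {G : Type*} [NormedAddCommGroup G] {f : HRn1 n → G} {p : ℝ≥0∞} :
    eLpNorm (fun q : Rn1 n => f (WithLp.toLp 2 q)) p volume = eLpNorm f p volume := by
  rw [← eLpNorm_comp_ofLp]

theorem integrable_comp_ofLp {f : Rn1 n → ℂ} :
    Integrable (fun v : HRn1 n => f v.ofLp) ↔ Integrable f :=
  (WithLp.volume_preserving_ofLp (Rn n) ℝ).integrable_comp_emb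
    (MeasurableEquiv.toLp 2 (Rn n × ℝ)).symm.measurableEmbedding

theorem integrable_comp_toLp {f : HRn1 n → ℂ} :
    Integrable (fun q : Rn1 n => f (WithLp.toLp 2 q)) ↔ Integrable f := by
  rw [← integrable_comp_ofLp]

theorem memLp_comp_ofLp {f : Rn1 n → ℂ} {p : ℝ≥0∞} (hf : MemLp f p) :
    MemLp (fun v : HRn1 n => f v.ofLp) p :=
  hf.comp_measurePreserving (WithLp.volume_preserving_ofLp (Rn n) ℝ)

theorem eLpNorm_FT1_eq {f : Rn1 n → ℂ} (hf : Integrable f) (hf2 : MemLp f 2) :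
    eLpNorm (FT1 f) 2 volume = eLpNorm f 2 volume := by
  rw [funext (FT1_eq_fourier f), eLpNorm_comp_toLp (f := 𝓕 (fun v : HRn1 n => f v.ofLp)),
    eLpNorm_fourier_eq_of_integrable (integrable_comp_ofLp.2 hf) (memLp_comp_ofLp hf2),
    eLpNorm_comp_ofLp]

theorem continuous_FT1 {f : Rn1 n → ℂ} (hf : Integrable f) : Continuous (FT1 f) := by
  rw [funext (FT1_eq_fourier f)]
  have : Continuous (𝓕 (fun v : HRn1 n => f v.ofLp)) :=
    VectorFourier.fourierIntegral_continuous Real.continuous_fourierChar continuous_inner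
      (integrable_comp_ofLp.2 hf)
  exact this.comp (WithLp.prod_continuous_toLp 2 _ _)

theorem FT1_conv1 {f g : Rn1 n → ℂ} (hf : Integrable f) (hg : Integrable g) (q : Rn1 n) :
    FT1 (conv1 f g) q = FT1 f q * FT1 g q := by
  rw [FT1_eq_fourier, FT1_eq_fourier, FT1_eq_fourier,
    ← Real.fourier_mul_convolution_eq (integrable_comp_ofLp.2 hf) (integrable_comp_ofLp.2 hg)]
  refine congrArg (fun F : HRn1 n → ℂ => 𝓕 F (WithLp.toLp 2 q)) (funext fun v => ?_)
  rw [conv1, convolution_mul_swap]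
  exact ((WithLp.volume_preserving_ofLp (Rn n) ℝ).integral_comp
    (MeasurableEquiv.toLp 2 (Rn n × ℝ)).symm.measurableEmbedding
    (fun y : Rn1 n => f (v.ofLp - y) * g y)).symm

/-- A Schwartz function, read on the inner product model of `ℝⁿ × ℝ`. -/
def toHRn1 (f : 𝓢(Rn1 n, ℂ)) : 𝓢(HRn1 n, ℂ) :=
  SchwartzMap.compCLMOfContinuousLinearEquiv ℂ (WithLp.prodContinuousLinearEquiv 2 ℝ (Rn n) ℝ) f

theorem toHRn1_apply (f : 𝓢(Rn1 n, ℂ)) : (toHRn1 f : HRn1 n → ℂ) = fun v => f v.ofLp := rfl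

theorem integrable_FT1_schwartz (f : 𝓢(Rn1 n, ℂ)) : Integrable (FT1 (⇑f)) := by
  rw [funext (FT1_eq_fourier _), integrable_comp_toLp (f := 𝓕 (fun v : HRn1 n => f v.ofLp)),
    ← toHRn1_apply, ← SchwartzMap.fourier_coe]
  exact (𝓕 (toHRn1 f)).integrable

theorem IFT1_FT1 {f : Rn1 n → ℂ} (hc : Continuous f) (hf : Integrable f)
    (hF : Integrable (FT1 f)) (x : Rn1 n) : IFT1 (FT1 f) x = f x := by
  rw [IFT1_eq_FT1_neg, FT1_eq_fourier]
  have h1 : (fun v : HRn1 n => FT1 f v.ofLp) = 𝓕 (fun v : HRn1 n => f v.ofLp) := by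
    ext v
    rw [FT1_eq_fourier]
  have h2 := (hc.comp (WithLp.prod_continuous_ofLp 2 _ _)).fourierInv_fourier_eq
    (integrable_comp_ofLp.2 hf) (by
      rw [funext (FT1_eq_fourier f)] at hF
      exact integrable_comp_toLp (f := 𝓕 (fun v : HRn1 n => f v.ofLp)) |>.1 hF)
  rw [h1, WithLp.toLp_neg, ← Real.fourierInv_eq_fourier_neg]
  exact congrFun h2 _

end Fourier

section DyadicCubes

variable {n : ℕ}

/-- Index of the parabolic dyadic cube of scale `2 ^ j` containing a point. -/
def cubeIdx (j : ℤ) (x : Rn1 n) : (Fin n → ℤ) × ℤ :=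
  (fun k => ⌊x.1 k / (2 : ℝ) ^ j⌋, ⌊x.2 / (4 : ℝ) ^ j⌋)

/-- The parabolic dyadic cube of scale `2 ^ j` with index `m`. -/
def dyadicCube (i : ℤ × (Fin n → ℤ) × ℤ) : Set (Rn1 n) := {x | cubeIdx i.1 x = i.2}

/-- The corner of a parabolic dyadic cube. -/
def cubeCorner (i : ℤ × (Fin n → ℤ) × ℤ) : Rn1 n :=
  (WithLp.toLp 2 fun k => (i.2.1 k : ℝ) * (2 : ℝ) ^ i.1, (i.2.2 : ℝ) * (4 : ℝ) ^ i.1)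

/-- A half-open box, given by its corner and its spatial and temporal side lengths. -/
def hoBox (c : Rn1 n) (h h' : ℝ) : Set (Rn1 n) :=
  {x | (∀ k, x.1 k ∈ Set.Ico (c.1 k) (c.1 k + h)) ∧ x.2 ∈ Set.Ico c.2 (c.2 + h')}

theorem measurableSet_hoBox (c : Rn1 n) (h h' : ℝ) : MeasurableSet (hoBox c h h') := by
  refine MeasurableSet.inter ?_ (measurableSet_Ico.preimage measurable_snd)
  have : {x : Rn1 n | ∀ k, x.1 k ∈ Set.Ico (c.1 k) (c.1 k + h)}
      = ⋂ k, {x : Rn1 n | x.1 k ∈ Set.Ico (c.1 k) (c.1 k + h)} := by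
    ext x; simp
  change MeasurableSet {x : Rn1 n | ∀ k, x.1 k ∈ Set.Ico (c.1 k) (c.1 k + h)}
  rw [this]
  exact MeasurableSet.iInter fun k => measurableSet_Ico.preimage (by fun_prop)

theorem volume_hoBox (c : Rn1 n) (h h' : ℝ) :
    volume (hoBox c h h') = ENNReal.ofReal h ^ n * ENNReal.ofReal h' := by
  have h1 : hoBox c h h' = {X : Rn n | ∀ k, X k ∈ Set.Ico (c.1 k) (c.1 k + h)} ×ˢ
      Set.Ico c.2 (c.2 + h') := rfl
  have h2 : {X : Rn n | ∀ k, X k ∈ Set.Ico (c.1 k) (c.1 k + h)}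
      = (WithLp.ofLp : Rn n → Fin n → ℝ) ⁻¹'
        (Set.univ.pi fun k => Set.Ico (c.1 k) (c.1 k + h)) := by
    ext X; simp
  rw [h1, Measure.volume_eq_prod, Measure.prod_prod, h2,
    (PiLp.volume_preserving_ofLp (Fin n)).measure_preimage
      (MeasurableSet.univ_pi fun k => measurableSet_Ico).nullMeasurableSet, volume_pi,
    Measure.pi_pi]
  simp

theorem dyadicCube_eq_hoBox (i : ℤ × (Fin n → ℤ) × ℤ) :
    dyadicCube i = hoBox (cubeCorner i) ((2 : ℝ) ^ i.1) ((4 : ℝ) ^ i.1) := by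
  ext x
  obtain ⟨j, m, l⟩ := i
  have h2 : (0 : ℝ) < 2 ^ j := by positivity
  have h4 : (0 : ℝ) < 4 ^ j := by positivity
  simp only [dyadicCube, cubeIdx, Set.mem_ofPred_eq, Prod.mk.injEq, funext_iff, Int.floor_eq_iff,
    le_div_iff₀ h2, div_lt_iff₀ h2, le_div_iff₀ h4, div_lt_iff₀ h4, hoBox, cubeCorner, Set.mem_Ico,
    add_mul, one_mul]

theorem measurableSet_dyadicCube (i : ℤ × (Fin n → ℤ) × ℤ) : MeasurableSet (dyadicCube i) := by
  rw [dyadicCube_eq_hoBox]; exact measurableSet_hoBox _ _ _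

/-- The volume of a parabolic dyadic cube of scale `2 ^ j`. -/
def cubeVol (n : ℕ) (j : ℤ) : ℝ≥0∞ := ENNReal.ofReal ((2 : ℝ) ^ j) ^ n * ENNReal.ofReal ((4 : ℝ) ^ j)

theorem volume_dyadicCube (i : ℤ × (Fin n → ℤ) × ℤ) :
    volume (dyadicCube i) = cubeVol n i.1 := by
  rw [dyadicCube_eq_hoBox, volume_hoBox, cubeVol]

theorem cubeVol_ne_zero (j : ℤ) : cubeVol n j ≠ 0 := by
  rw [cubeVol]
  have h2 : (0 : ℝ) < 2 ^ j := by positivity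
  have h4 : (0 : ℝ) < 4 ^ j := by positivity
  simp [h2, h4]

theorem cubeVol_ne_top (j : ℤ) : cubeVol n j ≠ ∞ := by
  rw [cubeVol]
  exact ENNReal.mul_ne_top (ENNReal.pow_ne_top ENNReal.ofReal_ne_top) ENNReal.ofReal_ne_top

theorem cubeVol_succ (j : ℤ) : cubeVol n (j + 1) = 2 ^ (n + 2) * cubeVol n j := by
  rw [cubeVol, cubeVol, zpow_add_one₀ (by norm_num), zpow_add_one₀ (by norm_num),
    ENNReal.ofReal_mul (by positivity), ENNReal.ofReal_mul (by positivity), mul_pow]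
  simp only [ENNReal.ofReal_ofNat]
  rw [show (4 : ℝ≥0∞) = 2 ^ 2 by norm_num]
  ring

theorem floor_div_two_zpow_succ {a b : ℝ} {j : ℤ} (h : ⌊a / (2 : ℝ) ^ j⌋ = ⌊b / (2 : ℝ) ^ j⌋) :
    ⌊a / (2 : ℝ) ^ (j + 1)⌋ = ⌊b / (2 : ℝ) ^ (j + 1)⌋ := by
  have : ∀ c : ℝ, c / (2 : ℝ) ^ (j + 1) = c / 2 ^ j / (2 : ℕ) := fun c => by
    rw [zpow_add_one₀ (by norm_num), div_div]; norm_num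
  rw [this, this, Int.floor_div_natCast, Int.floor_div_natCast, h]

theorem floor_div_four_zpow_succ {a b : ℝ} {j : ℤ} (h : ⌊a / (4 : ℝ) ^ j⌋ = ⌊b / (4 : ℝ) ^ j⌋) :
    ⌊a / (4 : ℝ) ^ (j + 1)⌋ = ⌊b / (4 : ℝ) ^ (j + 1)⌋ := by
  have : ∀ c : ℝ, c / (4 : ℝ) ^ (j + 1) = c / 4 ^ j / (4 : ℕ) := fun c => by
    rw [zpow_add_one₀ (by norm_num), div_div]; norm_num
  rw [this, this, Int.floor_div_natCast, Int.floor_div_natCast, h]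

theorem cubeIdx_mono {x z : Rn1 n} {j i : ℤ} (hji : j ≤ i) (h : cubeIdx j z = cubeIdx j x) :
    cubeIdx i z = cubeIdx i x := by
  induction i, hji using Int.leInduction with
  | base => exact h
  | succ i _ ih =>
    simp only [cubeIdx, Prod.mk.injEq, funext_iff] at ih ⊢
    exact ⟨fun k => floor_div_two_zpow_succ (ih.1 k), floor_div_four_zpow_succ ih.2⟩

theorem dyadicCube_subset_succ (x : Rn1 n) (j : ℤ) :
    dyadicCube (j, cubeIdx j x) ⊆ dyadicCube (j + 1, cubeIdx (j + 1) x) := fun _ hz =>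
  cubeIdx_mono (by omega) hz

theorem mem_dyadicCube_self (x : Rn1 n) (j : ℤ) : x ∈ dyadicCube (j, cubeIdx j x) := rfl

theorem norm_le_of_forall_abs_le {X : Rn n} {h : ℝ} (hX : ∀ k, |X k| ≤ h) :
    ‖X‖ ≤ n * h := by
  have h1 : X = ∑ k, EuclideanSpace.single k (X k) := by
    ext l; simp [Finset.sum_apply, Pi.single_apply]
  calc ‖X‖ = ‖∑ k, EuclideanSpace.single k (X k)‖ := by rw [← h1]
    _ ≤ ∑ k, ‖EuclideanSpace.single k (X k)‖ := norm_sum_le _ _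
    _ ≤ ∑ _k : Fin n, h := Finset.sum_le_sum fun k _ => by simpa using hX k
    _ = n * h := by simp

theorem exists_scale_subset (x : Rn1 n) {U : Set (Rn1 n)} (hU : U ∈ nhds x) :
    ∃ j : ℤ, dyadicCube (j, cubeIdx j x) ⊆ U := by
  obtain ⟨ε, hε, hball⟩ := Metric.mem_nhds_iff.1 hU
  obtain ⟨N, hN⟩ := exists_pow_lt_of_lt_one (show 0 < ε / (n + 1) by positivity)
    (show (1 / 2 : ℝ) < 1 by norm_num)
  refine ⟨-(N : ℤ), fun z hz => hball ?_⟩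
  have h2 : (2 : ℝ) ^ (-(N : ℤ)) = (1 / 2) ^ N := by simp
  have h4 : (4 : ℝ) ^ (-(N : ℤ)) ≤ (1 / 2) ^ N := by
    rw [zpow_neg, zpow_natCast, ← inv_pow]
    exact pow_le_pow_left₀ (by norm_num) (by norm_num) N
  have hx := mem_dyadicCube_self x (-(N : ℤ))
  rw [dyadicCube_eq_hoBox] at hz hx
  obtain ⟨hz1, hz2⟩ := hz
  obtain ⟨hx1, hx2⟩ := hx
  have hN' : (n + 1) * (1 / 2 : ℝ) ^ N < ε := by
    rw [lt_div_iff₀ (by positivity)] at hN; linarith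
  have hpos : (0 : ℝ) < (1 / 2) ^ N := by positivity
  rw [Metric.mem_ball, Prod.dist_eq, max_lt_iff, dist_eq_norm, dist_eq_norm]
  constructor
  · refine (norm_le_of_forall_abs_le (h := (1 / 2) ^ N) fun k => ?_).trans_lt (by nlinarith)
    have a := hz1 k; have b := hx1 k
    simp only [Set.mem_Ico, h2] at a b
    rw [PiLp.sub_apply, abs_le]
    constructor <;> linarith
  · simp only [Set.mem_Ico] at hz2 hx2
    rw [Real.norm_eq_abs, abs_lt]
    constructor <;> nlinarith [(n.cast_nonneg : (0 : ℝ) ≤ n)]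

/-- The Calderón–Zygmund selection of parabolic dyadic cubes. -/
theorem exists_selected_cubes {f : Rn1 n → ℂ} (hf : Continuous f) (hfi : Integrable f)
    {lam : ℝ≥0∞} (h0 : lam ≠ 0) (htop : lam ≠ ∞) :
    ∃ S : Set (ℤ × (Fin n → ℤ) × ℤ), S.PairwiseDisjoint dyadicCube ∧
      (∀ i ∈ S, lam * volume (dyadicCube i) ≤ ∫⁻ x in dyadicCube i, ‖f x‖ₑ) ∧
      (∀ i ∈ S, ∫⁻ x in dyadicCube i, ‖f x‖ₑ ≤ lam * (2 ^ (n + 2) * volume (dyadicCube i))) ∧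
      ∀ x, x ∉ ⋃ i ∈ S, dyadicCube i → ‖f x‖ₑ ≤ lam := by
  set P : ℤ → Rn1 n → Prop := fun j x =>
    lam * cubeVol n j < ∫⁻ z in dyadicCube (j, cubeIdx j x), ‖f z‖ₑ with hP
  have hPidx : ∀ {j : ℤ} {x z : Rn1 n}, cubeIdx j z = cubeIdx j x → (P j z ↔ P j x) := by
    intro j x z h; simp only [hP, h]
  have hbdd : ∃ b : ℤ, ∀ x j, P j x → j ≤ b := by
    have hfin : (∫⁻ z, ‖f z‖ₑ) / lam ≠ ∞ := ENNReal.div_ne_top hfi.2.ne h0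
    obtain ⟨N, hN⟩ := ENNReal.exists_nat_gt hfin
    refine ⟨N, fun x j hj => ?_⟩
    by_contra! hlt
    obtain ⟨k, rfl⟩ : ∃ k : ℕ, j = k := ⟨j.toNat, by omega⟩
    have h1 : lam * cubeVol n k < ∫⁻ z, ‖f z‖ₑ :=
      lt_of_lt_of_le hj (setLIntegral_le_lintegral _ _)
    have h2 : (N : ℝ≥0∞) ≤ cubeVol n k := by
      have h3 : (1 : ℝ≥0∞) ≤ ENNReal.ofReal ((2 : ℝ) ^ (k : ℤ)) ^ n := by
        refine one_le_pow₀ ?_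
        rw [ENNReal.one_le_ofReal, zpow_natCast]
        exact one_le_pow₀ (by norm_num)
      have h4 : (N : ℝ≥0∞) ≤ ENNReal.ofReal ((4 : ℝ) ^ (k : ℤ)) := by
        rw [← ENNReal.ofReal_natCast, zpow_natCast]
        apply ENNReal.ofReal_le_ofReal
        have h5 : N ≤ k := by omega
        have h6 : (k : ℝ) ≤ 4 ^ k := by exact_mod_cast (Nat.lt_pow_self (by norm_num)).le
        exact (Nat.cast_le.2 h5).trans h6
      calc (N : ℝ≥0∞) = 1 * N := (one_mul _).symm
        _ ≤ _ := mul_le_mul' h3 h4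
    have h7 : (∫⁻ z, ‖f z‖ₑ) < cubeVol n k * lam :=
      (ENNReal.div_lt_iff (Or.inl h0) (Or.inl htop)).1 (hN.trans_le h2)
    rw [mul_comm] at h7
    exact absurd h1 (not_lt.2 h7.le)
  obtain ⟨b, hb⟩ := hbdd
  set S : Set (ℤ × (Fin n → ℤ) × ℤ) :=
    {i | ∃ x, P i.1 x ∧ (∀ j, P j x → j ≤ i.1) ∧ cubeIdx i.1 x = i.2} with hS
  have hmem : ∀ i ∈ S, ∀ z ∈ dyadicCube i, P i.1 z ∧ (∀ j, P j z → j ≤ i.1) := by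
    rintro i ⟨x, hx1, hx2, hx3⟩ z hz
    have hzx : cubeIdx i.1 z = cubeIdx i.1 x := hz.trans hx3.symm
    refine ⟨(hPidx hzx).2 hx1, fun j hj => ?_⟩
    by_contra! hlt
    exact absurd (hx2 j ((hPidx (cubeIdx_mono hlt.le hzx)).1 hj)) (not_le.2 hlt)
  refine ⟨S, ?_, ?_, ?_, ?_⟩
  · intro i hi i' hi' hne
    refine Set.disjoint_left.2 fun z hz hz' => hne ?_
    have a := hmem i hi z hz
    have a' := hmem i' hi' z hz'
    have hj : i.1 = i'.1 := le_antisymm (a'.2 _ a.1) (a.2 _ a'.1)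
    refine Prod.ext hj ?_
    have e1 : cubeIdx i.1 z = i.2 := hz
    have e2 : cubeIdx i'.1 z = i'.2 := hz'
    rw [← e1, ← e2, hj]
  · rintro i ⟨x, hx1, -, hx3⟩
    rw [volume_dyadicCube]
    have : i = (i.1, cubeIdx i.1 x) := Prod.ext rfl hx3.symm
    calc _ ≤ _ := hx1.le
      _ = _ := by rw [← this]
  · rintro i ⟨x, hx1, hx2, hx3⟩
    have hi : i = (i.1, cubeIdx i.1 x) := Prod.ext rfl hx3.symm
    rw [volume_dyadicCube, ← cubeVol_succ]
    have hn : ¬ P (i.1 + 1) x := fun h => by have := hx2 _ h; omega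
    refine le_trans (lintegral_mono_set ?_) (not_lt.1 hn)
    conv_lhs => rw [hi]
    exact dyadicCube_subset_succ x i.1
  · intro x hx
    have hno : ∀ j, ¬ P j x := by
      intro j hj
      obtain ⟨g, hg1, hg2⟩ := Int.exists_greatest_of_bdd ⟨b, fun z hz => hb x z hz⟩ ⟨j, hj⟩
      exact hx (Set.mem_iUnion₂.2 ⟨(g, cubeIdx g x), ⟨x, hg1, hg2, rfl⟩, rfl⟩)
    by_contra! hlt
    obtain ⟨c, hc1, hc2⟩ := exists_between hlt
    have hU : {z | c < ‖f z‖ₑ} ∈ nhds x :=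
      (isOpen_lt continuous_const hf.enorm).mem_nhds hc2
    obtain ⟨j, hj⟩ := exists_scale_subset x hU
    refine hno j ?_
    calc lam * cubeVol n j < c * cubeVol n j :=
          ENNReal.mul_lt_mul_left (cubeVol_ne_zero j) (cubeVol_ne_top j) hc1
      _ = ∫⁻ _ in dyadicCube (j, cubeIdx j x), c := by
          rw [setLIntegral_const, volume_dyadicCube]
      _ ≤ _ := setLIntegral_mono' (measurableSet_dyadicCube _) fun z hz => (hj hz).le

end DyadicCubes

section Convolution

variable {n : ℕ}

instance : (volume : Measure (Rn1 n)).IsAddHaarMeasure :=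
  Measure.prod.instIsAddHaarMeasure (volume : Measure (Rn n)) (volume : Measure ℝ)

theorem conv1_eq_convolution (K h : Rn1 n → ℂ) :
    conv1 K h = convolution K h (ContinuousLinearMap.mul ℝ ℂ) volume := by
  ext x
  exact (convolution_eq_swap (f := K) (g := h) (ContinuousLinearMap.mul ℝ ℂ)).symm

theorem integrable_conv1 {K h : Rn1 n → ℂ} (hK : Integrable K) (hh : Integrable h) :
    Integrable (conv1 K h) := by
  rw [conv1_eq_convolution]
  exact hK.integrable_convolution _ hh

theorem norm_conv1_le {K h : Rn1 n → ℂ} (hK : Integrable K) {M : ℝ} (hM : ∀ x, ‖h x‖ ≤ M)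
    (x : Rn1 n) : ‖conv1 K h x‖ ≤ M * ∫ y, ‖K y‖ := by
  rw [conv1, ← integral_sub_left_eq_self (fun y => ‖K y‖) volume x, ← integral_const_mul]
  apply norm_integral_le_of_norm_le ((hK.comp_sub_left x).norm.const_mul M)
  filter_upwards with y
  rw [norm_mul, mul_comm]
  gcongr
  exact hM y

theorem continuous_conv1 {K h : Rn1 n → ℂ} (hK : Integrable K) (hc : Continuous h) {M : ℝ}
    (hM : ∀ x, ‖h x‖ ≤ M) : Continuous (conv1 K h) := by
  rw [conv1_eq_convolution]
  exact BddAbove.continuous_convolution_right_of_integrable _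
    ⟨M, by rintro _ ⟨x, rfl⟩; exact hM x⟩ hK hc

theorem memLp_of_integrable_of_bound {α : Type*} [MeasurableSpace α] {μ : Measure α} {h : α → ℂ}
    (hh : Integrable h μ) {M : ℝ}
    (hM : ∀ x, ‖h x‖ ≤ M) {p : ℝ} (hp : 1 ≤ p) : MemLp h (ENNReal.ofReal p) μ := by
  have hp0 : 0 < p := by linarith
  refine ⟨hh.aestronglyMeasurable, ?_⟩
  rw [eLpNorm_lt_top_iff_lintegral_rpow_enorm_lt_top (by simpa using hp0) ENNReal.ofReal_ne_top,
    ENNReal.toReal_ofReal hp0.le]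
  have h1 : ∀ x, ‖h x‖ₑ ^ p ≤ ENNReal.ofReal M ^ (p - 1) * ‖h x‖ₑ := by
    intro x
    have h2 : ‖h x‖ₑ ≤ ENNReal.ofReal M := by
      rw [← ofReal_norm]; exact ENNReal.ofReal_le_ofReal (hM x)
    calc ‖h x‖ₑ ^ p = ‖h x‖ₑ ^ ((p - 1) + 1) := by congr 1; ring
      _ = ‖h x‖ₑ ^ (p - 1) * ‖h x‖ₑ := by
        rw [ENNReal.rpow_add_of_nonneg _ _ (by linarith) zero_le_one, ENNReal.rpow_one]
      _ ≤ _ := by gcongr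
  refine (lintegral_mono h1).trans_lt ?_
  rw [lintegral_const_mul' _ _ (ENNReal.rpow_ne_top_of_nonneg (by linarith) ENNReal.ofReal_ne_top)]
  exact ENNReal.mul_lt_top
    (ENNReal.rpow_lt_top_of_nonneg (by linarith) ENNReal.ofReal_ne_top) hh.hasFiniteIntegral

theorem memLp_two_of_integrable_of_bound {α : Type*} [MeasurableSpace α] {μ : Measure α} {h : α → ℂ}
    (hh : Integrable h μ) {M : ℝ} (hM : ∀ x, ‖h x‖ ≤ M) : MemLp h 2 μ := by
  have := memLp_of_integrable_of_bound hh hM (p := 2) (by norm_num)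
  rwa [ENNReal.ofReal_ofNat] at this

theorem eLpNorm_conv1_two_le {K h : Rn1 n → ℂ} (hK : Integrable K) {A : ℝ}
    (hA : ∀ q, ‖FT1 K q‖ ≤ A) (hh : Integrable h) {M : ℝ} (hM : ∀ x, ‖h x‖ ≤ M) :
    eLpNorm (conv1 K h) 2 volume ≤ ENNReal.ofReal A * eLpNorm h 2 volume := by
  rw [← eLpNorm_FT1_eq (integrable_conv1 hK hh)
    (memLp_two_of_integrable_of_bound (integrable_conv1 hK hh) (norm_conv1_le hK hM)),
    ← eLpNorm_FT1_eq hh (memLp_two_of_integrable_of_bound hh hM)]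
  apply eLpNorm_le_mul_eLpNorm_of_ae_le_mul
  filter_upwards with q
  rw [FT1_conv1 hK hh, norm_mul]
  gcongr
  exact hA q

end Convolution

/-- An integrable kernel whose Fourier transform is bounded by `A`, and which satisfies the
parabolic Hörmander condition with constant `A`. -/
structure CZKernel {n : ℕ} (K : Rn1 n → ℂ) (A : ℝ) : Prop where
  measurable : Measurable K
  integrable : Integrable K
  norm_FT1_le : ∀ q, ‖FT1 K q‖ ≤ A
  hormander : ∀ R : ℝ, 0 < R → ∀ y : Rn1 n, ‖y.1‖ ≤ R → |y.2| ≤ R ^ 2 →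
    ∫⁻ x in {x : Rn1 n | 2 * R ≤ ‖x.1‖ ∨ 2 * R ^ 2 ≤ |x.2|}, ‖K (x - y) - K x‖ₑ
      ≤ ENNReal.ofReal A

namespace CZKernel

variable {n : ℕ} {K : Rn1 n → ℂ} {A : ℝ}

theorem FT1_comp_neg (K : Rn1 n → ℂ) (q : Rn1 n) : FT1 (fun x => K (-x)) q = FT1 K (-q) := by
  rw [FT1, ← integral_neg_eq_self, FT1]
  congr 1
  ext p
  simp

theorem comp_neg (hK : CZKernel K A) : CZKernel (fun x => K (-x)) A where
  measurable := hK.measurable.comp measurable_neg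
  integrable := hK.integrable.comp_neg
  norm_FT1_le q := by rw [FT1_comp_neg]; exact hK.norm_FT1_le _
  hormander R hR y h1 h2 := by
    have h := hK.hormander R hR (-y) (by simpa using h1) (by simpa using h2)
    have hm : MeasurableSet {x : Rn1 n | 2 * R ≤ ‖x.1‖ ∨ 2 * R ^ 2 ≤ |x.2|} :=
      (measurableSet_le measurable_const measurable_fst.norm).union
        (measurableSet_le measurable_const measurable_snd.norm)
    rw [← lintegral_indicator hm] at h ⊢
    rw [← lintegral_neg_eq_self]
    refine le_of_eq_of_le (lintegral_congr fun x => ?_) h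
    by_cases hx : 2 * R ≤ ‖x.1‖ ∨ 2 * R ^ 2 ≤ |x.2|
    · rw [Set.indicator_of_mem (by simpa using hx), Set.indicator_of_mem (by simpa using hx)]
      congr 3 <;> abel
    · rw [Set.indicator_of_notMem (by simpa using hx), Set.indicator_of_notMem (by simpa using hx)]

end CZKernel

section CalderonZygmund

variable {n : ℕ}

theorem enorm_setAverage_mul_le {f : Rn1 n → ℂ} {s : Set (Rn1 n)} (hs : volume s ≠ ∞) :
    ‖⨍ x in s, f x‖ₑ * volume s ≤ ∫⁻ x in s, ‖f x‖ₑ := by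
  by_cases h0 : volume s = 0
  · simp [h0]
  have h1 : ‖⨍ x in s, f x‖ₑ * volume s = ‖∫ x in s, f x‖ₑ := by
    rw [← measure_smul_setAverage f hs, enorm_smul, mul_comm]
    congr 1
    rw [Measure.real, Real.enorm_eq_ofReal ENNReal.toReal_nonneg, ENNReal.ofReal_toReal hs]
  rw [h1]
  exact enorm_integral_le_lintegral_enorm _

theorem exists_calderonZygmund_decomposition {f : Rn1 n → ℂ} (hf : Continuous f)
    (hfi : Integrable f) {M : ℝ} (hM : ∀ x, ‖f x‖ ≤ M) {lam : ℝ≥0∞} (h0 : lam ≠ 0)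
    (htop : lam ≠ ∞) :
    ∃ (S : Set (ℤ × (Fin n → ℤ) × ℤ)) (g b : Rn1 n → ℂ),
      S.PairwiseDisjoint dyadicCube ∧ Measurable b ∧ Integrable g ∧ Integrable b ∧
      (∀ x, ‖g x‖ ≤ M) ∧ (∀ x, ‖b x‖ ≤ 2 * M) ∧ (∀ x, f x = g x + b x) ∧
      (∀ i ∈ S, ∫ x in dyadicCube i, b x = 0) ∧
      (∀ x, x ∉ ⋃ i ∈ S, dyadicCube i → b x = 0) ∧
      lam * volume (⋃ i ∈ S, dyadicCube i) ≤ 2 * ∫⁻ x in {x | lam / 2 < ‖f x‖ₑ}, ‖f x‖ₑ ∧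
      ∫⁻ x, ‖b x‖ₑ ≤ 2 * 2 ^ (n + 2) * (lam * volume (⋃ i ∈ S, dyadicCube i)) ∧
      ∫⁻ x, ‖g x‖ₑ ^ 2 ≤ (∫⁻ x in {x | ‖f x‖ₑ ≤ lam}, ‖f x‖ₑ ^ 2) +
        (2 ^ (n + 2)) ^ 2 * lam * (lam * volume (⋃ i ∈ S, dyadicCube i)) := by
  obtain ⟨S, hdisj, hlow, hup, hoff⟩ := exists_selected_cubes hf hfi h0 htop
  have hM0 : 0 ≤ M := (norm_nonneg _).trans (hM 0)
  have hvtop : ∀ i : ℤ × (Fin n → ℤ) × ℤ, volume (dyadicCube i) ≠ ∞ := fun i => by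
    rw [volume_dyadicCube]; exact cubeVol_ne_top _
  have hv0 : ∀ i : ℤ × (Fin n → ℤ) × ℤ, volume (dyadicCube i) ≠ 0 := fun i => by
    rw [volume_dyadicCube]; exact cubeVol_ne_zero _
  have hΩm : MeasurableSet (⋃ i ∈ S, dyadicCube i) :=
    MeasurableSet.biUnion S.to_countable fun i _ => measurableSet_dyadicCube i
  have hem : Measurable fun x => ‖f x‖ₑ := hf.measurable.enorm
  set Ω := ⋃ i ∈ S, dyadicCube i with hΩ
  have hΩv : volume Ω = ∑' i : S, volume (dyadicCube i.1) := by
    rw [hΩ, measure_biUnion S.to_countable hdisj fun i _ => measurableSet_dyadicCube i]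
  have hΩint : ∀ F : Rn1 n → ℝ≥0∞,
      ∫⁻ x in Ω, F x = ∑' i : S, ∫⁻ x in dyadicCube i.1, F x := fun F => by
    rw [hΩ, lintegral_biUnion S.to_countable (fun i _ => measurableSet_dyadicCube i) hdisj]
  obtain ⟨g, hgm, hg⟩ := exists_measurable_piecewise
    (fun o : Option S => o.elim Ωᶜ fun i => dyadicCube i.1)
    (by rintro (_ | i); exacts [hΩm.compl, measurableSet_dyadicCube _])
    (fun o : Option S => o.elim f fun i _ => ⨍ x in dyadicCube i.1, f x)
    (by rintro (_ | i); exacts [hf.measurable, measurable_const])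
    (by
      rintro (_ | i) (_ | j) hij x ⟨hx1, hx2⟩
      · exact absurd rfl hij
      · exact absurd (Set.mem_biUnion j.2 hx2) hx1
      · exact absurd (Set.mem_biUnion i.2 hx1) hx2
      · exact absurd hx2 (Set.disjoint_left.1
          (hdisj i.2 j.2 fun h => hij (congrArg some (Subtype.ext h))) hx1))
  have hgoff : ∀ x ∉ Ω, g x = f x := fun x hx => hg none hx
  have hgon : ∀ i ∈ S, ∀ x ∈ dyadicCube i, g x = ⨍ x in dyadicCube i, f x :=
    fun i hi x hx => hg (some ⟨i, hi⟩) hx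
  have havg : ∀ i ∈ S, ‖⨍ x in dyadicCube i, f x‖ₑ ≤ 2 ^ (n + 2) * lam := by
    intro i hi
    have h1 := (enorm_setAverage_mul_le (f := f) (hvtop i)).trans (hup i hi)
    rw [← mul_assoc, mul_comm lam] at h1
    exact (ENNReal.mul_le_mul_iff_left (hv0 i) (hvtop i)).1 h1
  have hgM : ∀ x, ‖g x‖ ≤ M := by
    intro x
    by_cases hx : x ∈ Ω
    · obtain ⟨i, hi, hxi⟩ := Set.mem_iUnion₂.1 hx
      rw [hgon i hi x hxi]
      have h1 : ‖⨍ x in dyadicCube i, f x‖ₑ * volume (dyadicCube i)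
          ≤ ENNReal.ofReal M * volume (dyadicCube i) := by
        refine (enorm_setAverage_mul_le (hvtop i)).trans ?_
        rw [← setLIntegral_const]
        refine lintegral_mono fun x => ?_
        rw [← ofReal_norm]
        exact ENNReal.ofReal_le_ofReal (hM x)
      have h2 := (ENNReal.mul_le_mul_iff_left (hv0 i) (hvtop i)).1 h1
      rw [← ofReal_norm] at h2
      exact (ENNReal.ofReal_le_ofReal_iff hM0).1 h2
    · rw [hgoff x hx]; exact hM x
  have hgΩ : ∫⁻ x in Ω, ‖g x‖ₑ ≤ ∫⁻ x in Ω, ‖f x‖ₑ := by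
    rw [hΩint, hΩint]
    refine ENNReal.tsum_le_tsum fun i => ?_
    rw [setLIntegral_congr_fun (measurableSet_dyadicCube i.1)
      (g := fun _ => ‖⨍ x in dyadicCube i.1, f x‖ₑ)
      (fun x hx => by simp only [hgon i.1 i.2 x hx]), setLIntegral_const]
    exact enorm_setAverage_mul_le (hvtop i)
  have hfΩ : ∫⁻ x in Ω, ‖f x‖ₑ ≤ 2 ^ (n + 2) * (lam * volume Ω) := by
    rw [hΩint, hΩv, ← ENNReal.tsum_mul_left, ← ENNReal.tsum_mul_left]
    refine ENNReal.tsum_le_tsum fun i => (hup i.1 i.2).trans (le_of_eq ?_)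
    ring
  have hgi : Integrable g := by
    refine ⟨hgm.aestronglyMeasurable, ?_⟩
    rw [HasFiniteIntegral, ← lintegral_add_compl _ hΩm]
    refine lt_of_le_of_lt (add_le_add hgΩ (setLIntegral_congr_fun hΩm.compl
      (g := fun x => ‖f x‖ₑ) fun x hx => by simp only [hgoff x hx]).le) ?_
    rw [lintegral_add_compl _ hΩm]
    exact hfi.hasFiniteIntegral
  refine ⟨S, g, fun x => f x - g x, hdisj, hf.measurable.sub hgm, hgi, hfi.sub hgi, hgM,
    fun x => ?_, fun x => by ring, fun i hi => ?_, fun x hx => ?_, ?_, ?_, ?_⟩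
  · calc _ ≤ ‖f x‖ + ‖g x‖ := norm_sub_le _ _
      _ ≤ 2 * M := by linarith [hM x, hgM x]
  · rw [integral_sub hfi.integrableOn hgi.integrableOn,
      setIntegral_congr_fun (measurableSet_dyadicCube i) (hgon i hi), setIntegral_const,
      measure_smul_setAverage f (hvtop i), sub_self]
  · simp only [hgoff x hx, sub_self]
  · have hEm : MeasurableSet {x | lam / 2 < ‖f x‖ₑ} := measurableSet_lt measurable_const hem
    have h1 : ∀ i ∈ S, lam * volume (dyadicCube i) ≤
        2 * ∫⁻ x in dyadicCube i, {x | lam / 2 < ‖f x‖ₑ}.indicator (fun x => ‖f x‖ₑ) x := by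
      intro i hi
      have h2 : ∫⁻ x in dyadicCube i, ‖f x‖ₑ ≤
          (∫⁻ x in dyadicCube i, {x | lam / 2 < ‖f x‖ₑ}.indicator (fun x => ‖f x‖ₑ) x) +
            lam / 2 * volume (dyadicCube i) := by
        rw [← setLIntegral_const, ← lintegral_add_right _ measurable_const]
        refine lintegral_mono fun x => ?_
        by_cases hx : lam / 2 < ‖f x‖ₑ
        · rw [Set.indicator_of_mem (by exact hx)]; exact le_self_add
        · exact (not_lt.1 hx).trans le_add_self
      have h3 := (hlow i hi).trans h2
      have h4 : lam * volume (dyadicCube i) =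
          lam / 2 * volume (dyadicCube i) + lam / 2 * volume (dyadicCube i) := by
        rw [← add_mul, ENNReal.add_halves]
      rw [h4] at h3
      have h5 := (ENNReal.add_le_add_iff_right
        (ENNReal.mul_ne_top (ENNReal.div_ne_top htop (by norm_num)) (hvtop i))).1 h3
      rw [h4, two_mul]
      exact add_le_add h5 h5
    rw [hΩv, ← ENNReal.tsum_mul_left, ← lintegral_indicator hEm]
    refine (ENNReal.tsum_le_tsum fun i : S => h1 i.1 i.2).trans ?_
    rw [ENNReal.tsum_mul_left, ← hΩint]
    gcongr
    exact Measure.restrict_le_self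
  · have h1 : ∫⁻ x, ‖f x - g x‖ₑ = ∫⁻ x in Ω, ‖f x - g x‖ₑ := by
      rw [← lintegral_add_compl _ hΩm, setLIntegral_congr_fun hΩm.compl (g := fun _ => 0)
        (fun x hx => by simp only [hgoff x hx, sub_self, enorm_zero])]
      simp
    rw [h1]
    calc ∫⁻ x in Ω, ‖f x - g x‖ₑ ≤ ∫⁻ x in Ω, (‖f x‖ₑ + ‖g x‖ₑ) :=
          lintegral_mono fun x => enorm_sub_le
      _ = (∫⁻ x in Ω, ‖f x‖ₑ) + ∫⁻ x in Ω, ‖g x‖ₑ := lintegral_add_left hem _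
      _ ≤ 2 ^ (n + 2) * (lam * volume Ω) + 2 ^ (n + 2) * (lam * volume Ω) :=
          add_le_add hfΩ (hgΩ.trans hfΩ)
      _ = _ := by ring
  · rw [← lintegral_add_compl _ hΩm, add_comm]
    refine add_le_add ?_ ?_
    · rw [setLIntegral_congr_fun hΩm.compl (g := fun x => ‖f x‖ₑ ^ 2)
        (fun x hx => by simp only [hgoff x hx])]
      exact lintegral_mono_set hoff
    · calc ∫⁻ x in Ω, ‖g x‖ₑ ^ 2 ≤ ∫⁻ _ in Ω, (2 ^ (n + 2) * lam) ^ 2 := by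
            refine setLIntegral_mono' hΩm fun x hx => ?_
            obtain ⟨i, hi, hxi⟩ := Set.mem_iUnion₂.1 hx
            rw [hgon i hi x hxi]
            gcongr
            exact havg i hi
        _ = _ := by rw [setLIntegral_const]; ring

end CalderonZygmund

section WeakType

variable {n : ℕ}

/-- A parabolic dilate of a dyadic cube. -/
def bigCube (i : ℤ × (Fin n → ℤ) × ℤ) : Set (Rn1 n) :=
  {x | ‖x.1 - (cubeCorner i).1‖ < 2 * ((n + 1) * 2 ^ i.1) ∧
    |x.2 - (cubeCorner i).2| < 2 * ((n + 1) * (2 : ℝ) ^ i.1) ^ 2}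

theorem measurableSet_bigCube (i : ℤ × (Fin n → ℤ) × ℤ) : MeasurableSet (bigCube i) :=
  (measurableSet_lt (measurable_fst.sub_const _).norm measurable_const).inter
    (measurableSet_lt (measurable_snd.sub_const _).norm measurable_const)

theorem four_zpow_eq (j : ℤ) : (4 : ℝ) ^ j = (2 ^ j) ^ 2 := by
  rw [← zpow_natCast, ← zpow_mul, mul_comm, zpow_mul]; norm_num

theorem volume_bigCube_le (i : ℤ × (Fin n → ℤ) × ℤ) :
    volume (bigCube i) ≤ ENNReal.ofReal ((4 * (n + 1)) ^ (n + 2)) * volume (dyadicCube i) := by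
  have h2 : (0 : ℝ) < 2 ^ i.1 := by positivity
  set R : ℝ := (n + 1) * 2 ^ i.1 with hR
  have hR0 : 0 < R := by positivity
  have hsub : bigCube i ⊆ hoBox ((cubeCorner i).1 - WithLp.toLp 2 (fun _ => 2 * R),
      (cubeCorner i).2 - 2 * R ^ 2) (4 * R) (4 * R ^ 2) := by
    rintro x ⟨h1, h3⟩
    rw [← hR] at h1 h3
    refine ⟨fun k => ?_, ?_⟩
    · have h4 := (PiLp.norm_apply_le (x.1 - (cubeCorner i).1) k).trans_lt h1
      rw [PiLp.sub_apply, Real.norm_eq_abs, abs_lt] at h4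
      simp only [PiLp.sub_apply, Set.mem_Ico]
      constructor <;> linarith [h4.1, h4.2]
    · rw [abs_lt] at h3
      simp only [Set.mem_Ico]
      constructor <;> linarith [h3.1, h3.2]
  refine (measure_mono hsub).trans ?_
  have h5 : (4 * R) ^ n * (4 * R ^ 2) ≤ (4 * (n + 1)) ^ (n + 2) * (((2 : ℝ) ^ i.1) ^ n * (2 ^ i.1) ^ 2) := by
    have : (4 * (n + 1) : ℝ) ^ (n + 2) * (((2 : ℝ) ^ i.1) ^ n * (2 ^ i.1) ^ 2) =
        (4 * R) ^ n * (16 * R ^ 2) := by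
      rw [hR, ← mul_assoc 4, mul_pow (4 * ((n : ℝ) + 1))]; ring
    rw [this]
    gcongr
    norm_num
  rw [volume_hoBox, volume_dyadicCube, cubeVol, four_zpow_eq, ← ENNReal.ofReal_pow (by positivity),
    ← ENNReal.ofReal_pow (by positivity), ← ENNReal.ofReal_mul (by positivity),
    ← ENNReal.ofReal_mul (by positivity), ← ENNReal.ofReal_mul (by positivity)]
  exact ENNReal.ofReal_le_ofReal h5

theorem sub_cubeCorner_le {i : ℤ × (Fin n → ℤ) × ℤ} {y : Rn1 n} (hy : y ∈ dyadicCube i) :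
    ‖(y - cubeCorner i).1‖ ≤ (n + 1) * 2 ^ i.1 ∧
      |(y - cubeCorner i).2| ≤ ((n + 1) * (2 : ℝ) ^ i.1) ^ 2 := by
  have h2 : (0 : ℝ) < 2 ^ i.1 := by positivity
  rw [dyadicCube_eq_hoBox] at hy
  obtain ⟨h1, h3⟩ := hy
  constructor
  · refine (norm_le_of_forall_abs_le (h := 2 ^ i.1) fun k => ?_).trans (by nlinarith)
    have := h1 k
    rw [Set.mem_Ico] at this
    rw [Prod.fst_sub, PiLp.sub_apply, abs_le]
    constructor <;> linarith [this.1, this.2]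
  · rw [Set.mem_Ico, four_zpow_eq] at h3
    have hn : (0 : ℝ) ≤ n := Nat.cast_nonneg n
    have h4 : ((2 : ℝ) ^ i.1) ^ 2 ≤ ((n + 1) * (2 : ℝ) ^ i.1) ^ 2 := by
      gcongr
      nlinarith
    rw [Prod.snd_sub, abs_le]
    constructor <;> nlinarith [h3.1, h3.2]

variable {K : Rn1 n → ℂ} {A : ℝ}

theorem CZKernel.lintegral_compl_bigCube_le (hK : CZKernel K A) {i : ℤ × (Fin n → ℤ) × ℤ}
    {y : Rn1 n} (hy : y ∈ dyadicCube i) :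
    ∫⁻ x in (bigCube i)ᶜ, ‖K (x - y) - K (x - cubeCorner i)‖ₑ ≤ ENNReal.ofReal A := by
  obtain ⟨h1, h2⟩ := sub_cubeCorner_le hy
  refine le_trans ?_ (hK.hormander ((n + 1) * 2 ^ i.1) (by positivity) _ h1 h2)
  have hm : MeasurableSet {x : Rn1 n | 2 * ((n + 1) * 2 ^ i.1) ≤ ‖x.1‖ ∨
      2 * ((n + 1) * (2 : ℝ) ^ i.1) ^ 2 ≤ |x.2|} :=
    (measurableSet_le measurable_const measurable_fst.norm).union
      (measurableSet_le measurable_const measurable_snd.norm)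
  rw [← lintegral_indicator (measurableSet_bigCube i).compl, ← lintegral_indicator hm,
    ← lintegral_sub_right_eq_self (Set.indicator {x : Rn1 n | _} _) (cubeCorner i)]
  refine lintegral_mono fun x => ?_
  by_cases hx : x ∈ (bigCube i)ᶜ
  · rw [Set.indicator_of_mem hx, Set.indicator_of_mem]
    · rw [sub_sub_sub_cancel_right]
    · by_contra hcon
      simp only [Set.mem_ofPred_eq, not_or, not_le] at hcon
      exact hx hcon
  · rw [Set.indicator_of_notMem hx]
    exact zero_le

theorem CZKernel.lintegral_conv1_bad_le (hK : CZKernel K A) {S : Set (ℤ × (Fin n → ℤ) × ℤ)}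
    (hS : S.PairwiseDisjoint dyadicCube) {b : Rn1 n → ℂ} (hbm : Measurable b)
    {M : ℝ} (hM : ∀ x, ‖b x‖ ≤ M)
    (hmean : ∀ i ∈ S, ∫ x in dyadicCube i, b x = 0) (hbi : Integrable b)
    (hoff : ∀ x, x ∉ ⋃ i ∈ S, dyadicCube i → b x = 0) :
    ∫⁻ x in (⋃ i ∈ S, bigCube i)ᶜ, ‖conv1 K b x‖ₑ ≤ ENNReal.ofReal A * ∫⁻ x, ‖b x‖ₑ := by
  have hΩm : MeasurableSet (⋃ i ∈ S, dyadicCube i) :=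
    MeasurableSet.biUnion S.to_countable fun i _ => measurableSet_dyadicCube i
  have hpt : ∀ x, ‖conv1 K b x‖ₑ ≤
      ∑' i : S, ∫⁻ y in dyadicCube i.1, ‖K (x - y) - K (x - cubeCorner i.1)‖ₑ * ‖b y‖ₑ := by
    intro x
    have hInt : Integrable fun y => K (x - y) * b y :=
      (hK.integrable.comp_sub_left x).mul_bdd (c := M) hbm.aestronglyMeasurable
        (Filter.Eventually.of_forall hM)
    have h1 : conv1 K b x = ∑' i : S, ∫ y in dyadicCube i.1, K (x - y) * b y := by
      rw [conv1, ← setIntegral_eq_integral_of_forall_compl_eq_zero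
        (s := ⋃ i ∈ S, dyadicCube i) (fun y hy => by rw [hoff y hy, mul_zero])]
      rw [Set.biUnion_eq_iUnion]
      exact integral_iUnion (fun i => measurableSet_dyadicCube i.1)
        (fun i j hij => hS i.2 j.2 fun h => hij (Subtype.ext h)) hInt.integrableOn
    have h2 : ∀ i : S, ∫ y in dyadicCube i.1, K (x - y) * b y =
        ∫ y in dyadicCube i.1, (K (x - y) - K (x - cubeCorner i.1)) * b y := by
      intro i
      simp only [sub_mul]
      rw [integral_sub hInt.integrableOn (hbi.integrableOn.const_mul _), integral_const_mul,
        hmean i.1 i.2, mul_zero, sub_zero]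
    rw [h1]
    refine enorm_tsum_le_tsum_enorm.trans (ENNReal.tsum_le_tsum fun i => ?_)
    rw [h2]
    refine (enorm_integral_le_lintegral_enorm _).trans (le_of_eq ?_)
    simp only [enorm_mul]
  have hm : ∀ c : Rn1 n, Measurable fun z : Rn1 n × Rn1 n =>
      ‖K (z.1 - z.2) - K (z.1 - c)‖ₑ * ‖b z.2‖ₑ := fun c =>
    ((hK.measurable.comp (measurable_fst.sub measurable_snd)).sub
      (hK.measurable.comp (measurable_fst.sub_const c))).enorm.mul
      (hbm.comp measurable_snd).enorm
  calc ∫⁻ x in (⋃ i ∈ S, bigCube i)ᶜ, ‖conv1 K b x‖ₑ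
      ≤ ∫⁻ x in (⋃ i ∈ S, bigCube i)ᶜ, ∑' i : S, ∫⁻ y in dyadicCube i.1,
          ‖K (x - y) - K (x - cubeCorner i.1)‖ₑ * ‖b y‖ₑ := lintegral_mono hpt
    _ = ∑' i : S, ∫⁻ x in (⋃ i ∈ S, bigCube i)ᶜ, ∫⁻ y in dyadicCube i.1,
          ‖K (x - y) - K (x - cubeCorner i.1)‖ₑ * ‖b y‖ₑ :=
        lintegral_tsum fun i => (hm _).lintegral_prod_right'.aemeasurable
    _ = ∑' i : S, ∫⁻ y in dyadicCube i.1, ∫⁻ x in (⋃ i ∈ S, bigCube i)ᶜ,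
          ‖K (x - y) - K (x - cubeCorner i.1)‖ₑ * ‖b y‖ₑ := by
        congr 1
        ext i
        exact lintegral_lintegral_swap (hm _).aemeasurable
    _ ≤ ∑' i : S, ∫⁻ y in dyadicCube i.1, ENNReal.ofReal A * ‖b y‖ₑ := by
        refine ENNReal.tsum_le_tsum fun i =>
          setLIntegral_mono' (measurableSet_dyadicCube i.1) fun y hy => ?_
        rw [lintegral_mul_const' _ _ enorm_ne_top]
        gcongr
        refine le_trans (lintegral_mono_set ?_) (hK.lintegral_compl_bigCube_le hy)
        exact Set.compl_subset_compl.2 (Set.subset_biUnion_of_mem (u := bigCube) i.2)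
    _ = ∫⁻ y in ⋃ i ∈ S, dyadicCube i, ENNReal.ofReal A * ‖b y‖ₑ :=
        (lintegral_biUnion S.to_countable (fun i _ => measurableSet_dyadicCube i) hS _).symm
    _ ≤ ∫⁻ y, ENNReal.ofReal A * ‖b y‖ₑ := setLIntegral_le_lintegral _ _
    _ = _ := lintegral_const_mul' _ _ ENNReal.ofReal_ne_top

/-- The constant in the weak-type estimate for a Calderón–Zygmund kernel. -/
def weakConst (n : ℕ) (A : ℝ) : ℝ≥0∞ :=
  2 * ENNReal.ofReal ((4 * (n + 1)) ^ (n + 2)) + 4 * ENNReal.ofReal A ^ 2 +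
    8 * ENNReal.ofReal A ^ 2 * (2 ^ (n + 2)) ^ 2 + 8 * ENNReal.ofReal A * 2 ^ (n + 2)

theorem weakConst_ne_top (n : ℕ) (A : ℝ) : weakConst n A ≠ ∞ := by
  unfold weakConst
  finiteness

theorem CZKernel.volume_le (hK : CZKernel K A) {f : Rn1 n → ℂ} (hf : Continuous f)
    (hfi : Integrable f) {M : ℝ} (hM : ∀ x, ‖f x‖ ≤ M) {lam : ℝ≥0∞} (h0 : lam ≠ 0)
    (htop : lam ≠ ∞) :
    volume {x | lam < ‖conv1 K f x‖ₑ} ≤ weakConst n A *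
      (lam⁻¹ ^ 2 * (∫⁻ x in {x | ‖f x‖ₑ ≤ lam}, ‖f x‖ₑ ^ 2) +
        lam⁻¹ * ∫⁻ x in {x | lam / 2 < ‖f x‖ₑ}, ‖f x‖ₑ) := by
  obtain ⟨S, g, b, hS, hbm, hgi, hbi, hgM, hbM, hfgb, hmean, hoff, hΩ, hb, hg⟩ :=
    exists_calderonZygmund_decomposition hf hfi hM h0 htop
  set Ω := ⋃ i ∈ S, dyadicCube i
  set W := ∫⁻ x in {x | lam / 2 < ‖f x‖ₑ}, ‖f x‖ₑ
  set V := ∫⁻ x in {x | ‖f x‖ₑ ≤ lam}, ‖f x‖ₑ ^ 2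
  set D := ⋃ i ∈ S, bigCube i
  have hDm : MeasurableSet D := MeasurableSet.biUnion S.to_countable
    fun i _ => measurableSet_bigCube i
  have hK' := hK.integrable
  have hsum : ∀ x, conv1 K f x = conv1 K g x + conv1 K b x := by
    intro x
    simp only [conv1, hfgb, mul_add]
    exact integral_add
      ((hK'.comp_sub_left x).mul_bdd (c := M) hgi.aestronglyMeasurable (Filter.Eventually.of_forall hgM))
      ((hK'.comp_sub_left x).mul_bdd (c := 2 * M) hbm.aestronglyMeasurable
        (Filter.Eventually.of_forall hbM))
  have hcancel : lam⁻¹ * lam = 1 := ENNReal.inv_mul_cancel h0 htop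
  have hinv : (lam / 2)⁻¹ = 2 * lam⁻¹ := by
    rw [ENNReal.inv_div (by norm_num) (by norm_num), ENNReal.div_eq_inv_mul, mul_comm]
  have hhalf0 : lam / 2 ≠ 0 := by simpa using h0
  have hhalft : lam / 2 ≠ ∞ := ENNReal.div_ne_top htop (by norm_num)
  have hsubset : {x | lam < ‖conv1 K f x‖ₑ} ⊆
      D ∪ ({x | lam / 2 ≤ ‖conv1 K g x‖ₑ} ∪ (Dᶜ ∩ {x | lam / 2 ≤ ‖conv1 K b x‖ₑ})) := by
    intro x hx
    by_contra hcon
    simp only [Set.mem_union, Set.mem_inter_iff, Set.mem_ofPred_eq, not_or, not_and, not_le,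
      Set.mem_compl_iff] at hcon
    have h1 : ‖conv1 K f x‖ₑ ≤ ‖conv1 K g x‖ₑ + ‖conv1 K b x‖ₑ := by
      rw [hsum]; exact enorm_add_le _ _
    have h2 := ENNReal.add_lt_add hcon.2.1 (hcon.2.2 hcon.1)
    rw [ENNReal.add_halves] at h2
    exact lt_irrefl _ ((show lam < _ from hx).trans_le h1 |>.trans h2)
  have hΩ' : volume Ω ≤ 2 * (lam⁻¹ * W) := by
    calc volume Ω = lam⁻¹ * (lam * volume Ω) := by rw [← mul_assoc, hcancel, one_mul]
      _ ≤ lam⁻¹ * (2 * W) := by gcongr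
      _ = _ := by ring
  have hD : volume D ≤ 2 * ENNReal.ofReal ((4 * (n + 1)) ^ (n + 2)) * (lam⁻¹ * W) := by
    calc volume D ≤ ∑' i : S, volume (bigCube i.1) := measure_biUnion_le _ S.to_countable _
      _ ≤ ∑' i : S, ENNReal.ofReal ((4 * (n + 1)) ^ (n + 2)) * volume (dyadicCube i.1) :=
        ENNReal.tsum_le_tsum fun i => volume_bigCube_le i.1
      _ = ENNReal.ofReal ((4 * (n + 1)) ^ (n + 2)) * volume Ω := by
        rw [ENNReal.tsum_mul_left,
          measure_biUnion S.to_countable hS fun i _ => measurableSet_dyadicCube i]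
      _ ≤ ENNReal.ofReal ((4 * (n + 1)) ^ (n + 2)) * (2 * (lam⁻¹ * W)) := by gcongr
      _ = _ := by ring
  have hg2 : ∫⁻ x, ‖conv1 K g x‖ₑ ^ 2 ≤ ENNReal.ofReal A ^ 2 * ∫⁻ x, ‖g x‖ₑ ^ 2 := by
    have h1 := eLpNorm_conv1_two_le hK' hK.norm_FT1_le hgi hgM
    have h2 : ∀ F : Rn1 n → ℂ, eLpNorm F 2 volume ^ 2 = ∫⁻ x, ‖F x‖ₑ ^ 2 := fun F => by
      have := eLpNorm_nnreal_pow_eq_lintegral (f := F) (p := 2) (μ := volume) (by norm_num)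
      simpa using this
    rw [← h2, ← h2, ← mul_pow]
    gcongr
  have hG : volume {x | lam / 2 ≤ ‖conv1 K g x‖ₑ} ≤ 4 * ENNReal.ofReal A ^ 2 * (lam⁻¹ ^ 2 * V) +
      8 * ENNReal.ofReal A ^ 2 * (2 ^ (n + 2)) ^ 2 * (lam⁻¹ * W) := by
    have hc : AEMeasurable (fun x => ‖conv1 K g x‖ₑ ^ 2) :=
      (integrable_conv1 hK' hgi).aestronglyMeasurable.enorm.pow_const 2
    have h1 := meas_ge_le_lintegral_div hc (ε := (lam / 2) ^ 2) (pow_ne_zero _ hhalf0)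
      (ENNReal.pow_ne_top hhalft)
    have h2 : {x | lam / 2 ≤ ‖conv1 K g x‖ₑ} ⊆ {x | (lam / 2) ^ 2 ≤ ‖conv1 K g x‖ₑ ^ 2} :=
      fun x (hx : lam / 2 ≤ ‖conv1 K g x‖ₑ) =>
        show (lam / 2) ^ 2 ≤ ‖conv1 K g x‖ₑ ^ 2 from pow_le_pow_left' hx 2
    refine (measure_mono h2).trans (h1.trans ?_)
    rw [ENNReal.div_eq_inv_mul, ENNReal.inv_pow, hinv]
    calc (2 * lam⁻¹) ^ 2 * ∫⁻ x, ‖conv1 K g x‖ₑ ^ 2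
        ≤ (2 * lam⁻¹) ^ 2 * (ENNReal.ofReal A ^ 2 * (V +
            (2 ^ (n + 2)) ^ 2 * lam * (2 * W))) := by
          gcongr
          refine hg2.trans ?_
          gcongr
          exact hg.trans (by gcongr)
      _ = 4 * ENNReal.ofReal A ^ 2 * (lam⁻¹ ^ 2 * V) +
            (lam⁻¹ * lam) * (8 * ENNReal.ofReal A ^ 2 * (2 ^ (n + 2)) ^ 2 * (lam⁻¹ * W)) := by ring
      _ = _ := by rw [hcancel, one_mul]
  have hB : volume (Dᶜ ∩ {x | lam / 2 ≤ ‖conv1 K b x‖ₑ}) ≤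
      8 * ENNReal.ofReal A * 2 ^ (n + 2) * (lam⁻¹ * W) := by
    have hc : AEMeasurable (fun x => ‖conv1 K b x‖ₑ) (volume.restrict Dᶜ) :=
      (integrable_conv1 hK' hbi).aestronglyMeasurable.enorm.restrict
    have h1 := meas_ge_le_lintegral_div hc hhalf0 hhalft
    rw [Measure.restrict_apply' hDm.compl, Set.inter_comm, div_eq_mul_inv _ (lam / 2), hinv, mul_comm _ (2 * lam⁻¹)] at h1
    refine h1.trans ?_
    calc 2 * lam⁻¹ * ∫⁻ x in Dᶜ, ‖conv1 K b x‖ₑ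
        ≤ 2 * lam⁻¹ * (ENNReal.ofReal A * (2 * 2 ^ (n + 2) * (2 * W))) := by
          gcongr
          refine (hK.lintegral_conv1_bad_le hS hbm hbM hmean hbi hoff).trans ?_
          gcongr
          exact hb.trans (by gcongr)
      _ = _ := by ring
  calc volume {x | lam < ‖conv1 K f x‖ₑ}
      ≤ volume D + (volume {x | lam / 2 ≤ ‖conv1 K g x‖ₑ} +
          volume (Dᶜ ∩ {x | lam / 2 ≤ ‖conv1 K b x‖ₑ})) :=
        (measure_mono hsubset).trans ((measure_union_le _ _).trans
          (add_le_add le_rfl (measure_union_le _ _)))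
    _ ≤ 2 * ENNReal.ofReal ((4 * (n + 1)) ^ (n + 2)) * (lam⁻¹ * W) +
        (4 * ENNReal.ofReal A ^ 2 * (lam⁻¹ ^ 2 * V) +
          8 * ENNReal.ofReal A ^ 2 * (2 ^ (n + 2)) ^ 2 * (lam⁻¹ * W) +
          8 * ENNReal.ofReal A * 2 ^ (n + 2) * (lam⁻¹ * W)) :=
        add_le_add hD (add_le_add hG hB)
    _ ≤ weakConst n A * (lam⁻¹ ^ 2 * V) + weakConst n A * (lam⁻¹ * W) := by
        rw [add_comm (_ * (lam⁻¹ * W)), add_assoc, add_assoc]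
        refine add_le_add ?_ ?_
        · gcongr
          exact le_add_right (le_add_right le_add_self)
        · rw [← add_mul, ← add_mul]
          gcongr
          unfold weakConst
          rw [show ∀ a b c d : ℝ≥0∞, a + b + c + d = c + (d + a) + b by intros; ring]
          exact le_self_add
    _ = _ := by ring

end WeakType

section Marcinkiewicz

theorem lintegral_rpow_sub_three_le {p r : ℝ} (hp2 : p < 2) (hr : 0 ≤ r) :
    ∫⁻ t in Set.Ioi 0, (if r ≤ t then ENNReal.ofReal (t ^ (p - 3)) * ENNReal.ofReal r ^ 2 else 0) ≤
      ENNReal.ofReal (1 / (2 - p)) * ENNReal.ofReal r ^ p := by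
  rcases hr.eq_or_lt with rfl | hr
  · simp
  have h1 : ∫⁻ t in Set.Ioi 0,
        (if r ≤ t then ENNReal.ofReal (t ^ (p - 3)) * ENNReal.ofReal r ^ 2 else 0)
      = ∫⁻ t in Set.Ioi r, ENNReal.ofReal (t ^ (p - 3)) * ENNReal.ofReal r ^ 2 := by
    rw [← lintegral_indicator measurableSet_Ioi, setLIntegral_congr Ioi_ae_eq_Ici,
      ← lintegral_indicator measurableSet_Ici]
    congr 1
    ext t
    by_cases ht : r ≤ t
    · rw [Set.indicator_of_mem (Set.mem_Ioi.2 (hr.trans_le ht)),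
        Set.indicator_of_mem (Set.mem_Ici.2 ht), if_pos ht]
    · rw [Set.indicator_of_notMem (s := Set.Ici r) ht]
      simp only [Set.indicator, ht, if_false, ite_self]
  rw [h1, lintegral_mul_const' _ _ (by finiteness), ← ofReal_integral_eq_lintegral_ofReal
    (integrableOn_Ioi_rpow_of_lt (by linarith) hr), integral_Ioi_rpow_of_lt (by linarith) hr,
    ← ENNReal.ofReal_pow hr.le, ENNReal.ofReal_rpow_of_pos hr, ← ENNReal.ofReal_mul',
    ← ENNReal.ofReal_mul]
  · apply le_of_eq
    congr 1
    have h2 : r ^ (p - 3 + 1) * r ^ 2 = r ^ p := by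
      rw [← Real.rpow_natCast, ← Real.rpow_add hr]; congr 1; push_cast; ring
    have h3 : p - 3 + 1 = -(2 - p) := by ring
    rw [← h2, h3, neg_div_neg_eq]
    ring
  · exact one_div_nonneg.2 (by linarith)
  · positivity
  · exact (ae_restrict_mem measurableSet_Ioi).mono fun t (ht : r < t) =>
      Real.rpow_nonneg (hr.trans ht).le _

theorem lintegral_rpow_sub_two_le {p r : ℝ} (hp : 1 < p) (hr : 0 ≤ r) :
    ∫⁻ t in Set.Ioi 0, (if t / 2 < r then ENNReal.ofReal (t ^ (p - 2)) * ENNReal.ofReal r else 0) ≤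
      ENNReal.ofReal (2 ^ (p - 1) / (p - 1)) * ENNReal.ofReal r ^ p := by
  rcases hr.eq_or_lt with rfl | hr
  · simp
  have h1 : ∫⁻ t in Set.Ioi 0,
        (if t / 2 < r then ENNReal.ofReal (t ^ (p - 2)) * ENNReal.ofReal r else 0)
      ≤ ∫⁻ t in Set.Ioc 0 (2 * r), ENNReal.ofReal (t ^ (p - 2)) * ENNReal.ofReal r := by
    rw [← lintegral_indicator measurableSet_Ioi, ← lintegral_indicator measurableSet_Ioc]
    refine lintegral_mono fun t => ?_
    by_cases ht0 : 0 < t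
    · by_cases ht : t / 2 < r
      · rw [Set.indicator_of_mem (Set.mem_Ioi.2 ht0),
          Set.indicator_of_mem (Set.mem_Ioc.2 ⟨ht0, by linarith⟩), if_pos ht]
      · simp only [Set.indicator, ht, if_false, ite_self, zero_le]
    · rw [Set.indicator_of_notMem (s := Set.Ioi 0) ht0]
      exact zero_le
  refine h1.trans ?_
  have h2 : IntegrableOn (fun t : ℝ => t ^ (p - 2)) (Set.Ioc 0 (2 * r)) :=
    (intervalIntegral.intervalIntegrable_rpow' (by linarith : -1 < p - 2)).1
  rw [lintegral_mul_const' _ _ (by finiteness), ← ofReal_integral_eq_lintegral_ofReal h2,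
    ← intervalIntegral.integral_of_le (by linarith), integral_rpow (Or.inl (by linarith)),
    ENNReal.ofReal_rpow_of_pos hr, ← ENNReal.ofReal_mul', ← ENNReal.ofReal_mul]
  · apply le_of_eq
    congr 1
    have h3 : p - 2 + 1 = p - 1 := by ring
    have h4 : r ^ (p - 1) * r = r ^ p := by
      rw [← Real.rpow_add_one hr.ne']; congr 1; ring
    rw [h3, Real.zero_rpow (by linarith), Real.mul_rpow (by norm_num) hr.le, ← h4]
    ring
  · exact div_nonneg (by positivity) (by linarith)
  · exact hr.le
  · exact (ae_restrict_mem measurableSet_Ioc).mono fun t ht => Real.rpow_nonneg ht.1.le _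

/-- The constant in the interpolation of a weak-type estimate. -/
def interpConst (p : ℝ) : ℝ≥0∞ :=
  ENNReal.ofReal p * (ENNReal.ofReal (1 / (2 - p)) + ENNReal.ofReal (2 ^ (p - 1) / (p - 1)))

theorem lintegral_rpow_le_of_weakType {α : Type*} [MeasurableSpace α] {μ : Measure α} [SFinite μ]
    {f F : α → ℂ} (hf : Measurable f) (hF : AEStronglyMeasurable F μ) {C : ℝ≥0∞} (hC : C ≠ ∞)
    (h : ∀ lam : ℝ≥0∞, lam ≠ 0 → lam ≠ ∞ → μ {x | lam < ‖F x‖ₑ} ≤ C *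
      (lam⁻¹ ^ 2 * (∫⁻ x in {x | ‖f x‖ₑ ≤ lam}, ‖f x‖ₑ ^ 2 ∂μ) +
        lam⁻¹ * ∫⁻ x in {x | lam / 2 < ‖f x‖ₑ}, ‖f x‖ₑ ∂μ))
    {p : ℝ} (hp : 1 < p) (hp2 : p < 2) :
    ∫⁻ x, ‖F x‖ₑ ^ p ∂μ ≤ C * interpConst p * ∫⁻ x, ‖f x‖ₑ ^ p ∂μ := by
  have hp0 : 0 < p := by linarith
  have hpow : ∀ z : ℂ, ‖z‖ₑ ^ p = ENNReal.ofReal (‖z‖ ^ p) := fun z => by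
    rw [← ofReal_norm, ENNReal.ofReal_rpow_of_nonneg (norm_nonneg _) hp0.le]
  simp only [hpow (F _)]
  rw [lintegral_rpow_eq_lintegral_meas_lt_mul μ (Filter.Eventually.of_forall fun x => norm_nonneg _)
    hF.norm.aemeasurable hp0]
  set a : ℝ → α → ℝ≥0∞ := fun t x => if ‖f x‖ ≤ t then
    ENNReal.ofReal (t ^ (p - 3)) * ENNReal.ofReal ‖f x‖ ^ 2 else 0 with ha
  set b : ℝ → α → ℝ≥0∞ := fun t x => if t / 2 < ‖f x‖ then
    ENNReal.ofReal (t ^ (p - 2)) * ENNReal.ofReal ‖f x‖ else 0 with hb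
  have hfm : Measurable fun z : ℝ × α => ‖f z.2‖ := (hf.comp measurable_snd).norm
  have ham : Measurable (Function.uncurry a) := by
    refine Measurable.ite (measurableSet_le hfm measurable_fst) ?_ measurable_const
    exact (measurable_fst.pow_const _).ennreal_ofReal.mul (hfm.ennreal_ofReal.pow_const 2)
  have hbm : Measurable (Function.uncurry b) := by
    refine Measurable.ite (measurableSet_lt (measurable_fst.div_const _) hfm) ?_ measurable_const
    exact (measurable_fst.pow_const _).ennreal_ofReal.mul hfm.ennreal_ofReal
  have hpt : ∀ t ∈ Set.Ioi (0 : ℝ), μ {x | t < ‖F x‖} * ENNReal.ofReal (t ^ (p - 1)) ≤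
      C * (∫⁻ x, a t x ∂μ + ∫⁻ x, b t x ∂μ) := by
    intro t (ht : 0 < t)
    have e1 : ∀ z : ℂ, ENNReal.ofReal t < ‖z‖ₑ ↔ t < ‖z‖ := fun z => by
      rw [← ofReal_norm, ENNReal.ofReal_lt_ofReal_iff_of_nonneg ht.le]
    have e2 : ∀ z : ℂ, ‖z‖ₑ ≤ ENNReal.ofReal t ↔ ‖z‖ ≤ t := fun z => by
      rw [← ofReal_norm, ENNReal.ofReal_le_ofReal_iff ht.le]
    have e3 : ∀ z : ℂ, ENNReal.ofReal t / 2 < ‖z‖ₑ ↔ t / 2 < ‖z‖ := fun z => by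
      rw [← ofReal_norm, show ENNReal.ofReal t / 2 = ENNReal.ofReal (t / 2) by
        rw [ENNReal.ofReal_div_of_pos (by norm_num), ENNReal.ofReal_ofNat],
        ENNReal.ofReal_lt_ofReal_iff_of_nonneg (by linarith)]
    have h1 := h (ENNReal.ofReal t) (by simpa using ht) ENNReal.ofReal_ne_top
    simp only [e1, e2, e3] at h1
    have m1 : MeasurableSet {x | ‖f x‖ ≤ t} := measurableSet_le hf.norm measurable_const
    have m2 : MeasurableSet {x | t / 2 < ‖f x‖} := measurableSet_lt measurable_const hf.norm
    have i1 : ∫⁻ x, a t x ∂μ =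
        ENNReal.ofReal (t ^ (p - 3)) * ∫⁻ x in {x | ‖f x‖ ≤ t}, ‖f x‖ₑ ^ 2 ∂μ := by
      rw [← lintegral_const_mul' _ _ ENNReal.ofReal_ne_top, ← lintegral_indicator m1]
      refine lintegral_congr fun x => ?_
      simp only [ha, Set.indicator, Set.mem_ofPred_eq, ofReal_norm]
    have i2 : ∫⁻ x, b t x ∂μ =
        ENNReal.ofReal (t ^ (p - 2)) * ∫⁻ x in {x | t / 2 < ‖f x‖}, ‖f x‖ₑ ∂μ := by
      rw [← lintegral_const_mul' _ _ ENNReal.ofReal_ne_top, ← lintegral_indicator m2]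
      refine lintegral_congr fun x => ?_
      simp only [hb, Set.indicator, Set.mem_ofPred_eq, ofReal_norm]
    have p1 : (ENNReal.ofReal t)⁻¹ * ENNReal.ofReal (t ^ (p - 1)) = ENNReal.ofReal (t ^ (p - 2)) := by
      rw [← ENNReal.ofReal_inv_of_pos ht, ← ENNReal.ofReal_mul (by positivity), ← Real.rpow_neg_one,
        ← Real.rpow_add ht]
      congr 2; ring
    have p2 : (ENNReal.ofReal t)⁻¹ * ENNReal.ofReal (t ^ (p - 2)) = ENNReal.ofReal (t ^ (p - 3)) := by
      rw [← ENNReal.ofReal_inv_of_pos ht, ← ENNReal.ofReal_mul (by positivity), ← Real.rpow_neg_one,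
        ← Real.rpow_add ht]
      congr 2; ring
    rw [i1, i2, ← p2, ← p1]
    refine (mul_le_mul_left h1 _).trans (le_of_eq ?_)
    ring
  have hswap : ∀ {c : ℝ → α → ℝ≥0∞}, Measurable (Function.uncurry c) →
      ∫⁻ t in Set.Ioi (0 : ℝ), ∫⁻ x, c t x ∂μ = ∫⁻ x, (∫⁻ t in Set.Ioi (0 : ℝ), c t x) ∂μ :=
    fun hc => lintegral_lintegral_swap hc.aemeasurable
  calc ENNReal.ofReal p * ∫⁻ t in Set.Ioi 0, μ {x | t < ‖F x‖} * ENNReal.ofReal (t ^ (p - 1))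
      ≤ ENNReal.ofReal p * ∫⁻ t in Set.Ioi 0, C * (∫⁻ x, a t x ∂μ + ∫⁻ x, b t x ∂μ) := by
        gcongr 1
        exact setLIntegral_mono' measurableSet_Ioi hpt
    _ = ENNReal.ofReal p * (C * (∫⁻ x, (∫⁻ t in Set.Ioi (0 : ℝ), a t x) ∂μ +
          ∫⁻ x, (∫⁻ t in Set.Ioi (0 : ℝ), b t x) ∂μ)) := by
        rw [lintegral_const_mul' _ _ hC, lintegral_add_left ham.lintegral_prod_right, hswap ham,
          hswap hbm]
    _ ≤ ENNReal.ofReal p * (C * (∫⁻ x, ENNReal.ofReal (1 / (2 - p)) * ‖f x‖ₑ ^ p ∂μ +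
          ∫⁻ x, ENNReal.ofReal (2 ^ (p - 1) / (p - 1)) * ‖f x‖ₑ ^ p ∂μ)) := by
        gcongr with x x
        · rw [← ofReal_norm]
          exact lintegral_rpow_sub_three_le hp2 (norm_nonneg _)
        · rw [← ofReal_norm]
          exact lintegral_rpow_sub_two_le hp (norm_nonneg _)
    _ = _ := by
        rw [lintegral_const_mul' _ _ ENNReal.ofReal_ne_top,
          lintegral_const_mul' _ _ ENNReal.ofReal_ne_top, interpConst]
        ring

theorem CZKernel.eLpNorm_conv1_le_of_lt_two {n : ℕ} {K : Rn1 n → ℂ} {A : ℝ} (hK : CZKernel K A)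
    {f : Rn1 n → ℂ} (hf : Continuous f) (hfi : Integrable f) {M : ℝ} (hM : ∀ x, ‖f x‖ ≤ M)
    {p : ℝ} (hp : 1 < p) (hp2 : p < 2) :
    eLpNorm (conv1 K f) (ENNReal.ofReal p) volume ≤
      (weakConst n A * interpConst p) ^ (1 / p) * eLpNorm f (ENNReal.ofReal p) volume := by
  have hp0 : 0 < p := by linarith
  have h1 := lintegral_rpow_le_of_weakType hf.measurable
    (integrable_conv1 hK.integrable hfi).aestronglyMeasurable (weakConst_ne_top n A)
    (fun lam h0 htop => hK.volume_le hf hfi hM h0 htop) hp hp2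
  rw [eLpNorm_eq_lintegral_rpow_enorm_toReal (by simpa using hp0) ENNReal.ofReal_ne_top,
    eLpNorm_eq_lintegral_rpow_enorm_toReal (by simpa using hp0) ENNReal.ofReal_ne_top,
    ENNReal.toReal_ofReal hp0.le, ← ENNReal.mul_rpow_of_nonneg _ _ (by positivity)]
  gcongr

end Marcinkiewicz

section Duality

variable {n : ℕ}

theorem integral_conv1_mul {K f g : Rn1 n → ℂ} (hK : Integrable K) (hf : Integrable f)
    (hgm : AEStronglyMeasurable g) {N : ℝ} (hN : ∀ x, ‖g x‖ ≤ N) :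
    ∫ x, conv1 K f x * g x = ∫ y, f y * conv1 (fun x => K (-x)) g y := by
  have hInt : Integrable (fun z : Rn1 n × Rn1 n => K (z.1 - z.2) * f z.2 * g z.1)
      (volume.prod volume) := by
    have h1 := hf.convolution_integrand (ContinuousLinearMap.mul ℝ ℂ) hK
    simp only [ContinuousLinearMap.mul_apply'] at h1
    have h2 := h1.mul_bdd (c := N) (g := fun z : Rn1 n × Rn1 n => g z.1)
      (hgm.comp_quasiMeasurePreserving Measure.quasiMeasurePreserving_fst)
      (Filter.Eventually.of_forall fun z => hN z.1)
    refine h2.congr (Filter.Eventually.of_forall fun z => ?_)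
    ring
  calc ∫ x, conv1 K f x * g x = ∫ x, ∫ y, K (x - y) * f y * g x := by
        simp only [conv1, integral_mul_const]
    _ = ∫ y, ∫ x, K (x - y) * f y * g x := integral_integral_swap hInt
    _ = _ := by
        congr 1
        ext y
        rw [conv1, ← integral_const_mul]
        congr 1
        ext x
        rw [neg_sub]
        ring

theorem CZKernel.eLpNorm_conv1_le_of_two_lt {K : Rn1 n → ℂ} {A : ℝ} (hK : CZKernel K A)
    {f : Rn1 n → ℂ} (hf : Continuous f) (hfi : Integrable f) {M : ℝ} (hM : ∀ x, ‖f x‖ ≤ M)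
    {p q : ℝ} (hpq : p.HolderConjugate q) (hp : 2 < p) :
    eLpNorm (conv1 K f) (ENNReal.ofReal p) volume ≤
      (weakConst n A * interpConst q) ^ (1 / q) * eLpNorm f (ENNReal.ofReal p) volume := by
  have hp0 : 0 < p := by linarith
  have hq0 : 0 < q := hpq.symm.pos
  have hq1 : 1 < q := hpq.symm.lt
  have hqp : q * (p - 1) = p := by
    have := hpq.mul_eq_add; linarith
  have hq2 : q < 2 := by nlinarith
  have hK' := hK.integrable
  set F := conv1 K f with hF
  set N : ℝ := M * ∫ y, ‖K y‖
  have hFc : Continuous F := continuous_conv1 hK' hf hM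
  have hFi : Integrable F := integrable_conv1 hK' hfi
  have hFN : ∀ x, ‖F x‖ ≤ N := norm_conv1_le hK' hM
  set G : Rn1 n → ℂ := fun x => ((‖F x‖ ^ (p - 2) : ℝ) : ℂ) * (starRingEnd ℂ) (F x) with hG
  have hGn : ∀ x, ‖G x‖ = ‖F x‖ ^ (p - 1) := fun x => by
    rw [hG]
    simp only [norm_mul, RCLike.norm_conj, Complex.norm_real, Real.norm_eq_abs]
    rw [abs_of_nonneg (by positivity), ← Real.rpow_add_one' (norm_nonneg _) (by linarith)]
    congr 1; ring
  have hGc : Continuous G := by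
    have h1 : Continuous fun x => ‖F x‖ ^ (p - 2) :=
      hFc.norm.rpow_const fun x => Or.inr (by linarith)
    exact (Complex.continuous_ofReal.comp h1).mul (Complex.continuous_conj.comp hFc)
  have hGb : ∀ x, ‖G x‖ ≤ N ^ (p - 1) := fun x => by
    rw [hGn]
    exact Real.rpow_le_rpow (norm_nonneg _) (hFN x) (by linarith)
  have hGi : Integrable G := by
    have h1 := (memLp_of_integrable_of_bound hFi hFN (p := p - 1) (by linarith)).integrable_norm_rpow
      (by simpa using by linarith) ENNReal.ofReal_ne_top
    rw [ENNReal.toReal_ofReal (by linarith)] at h1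
    refine h1.mono' hGc.aestronglyMeasurable (Filter.Eventually.of_forall fun x => (hGn x).le)
  have hFG : ∀ x, F x * G x = ((‖F x‖ ^ p : ℝ) : ℂ) := fun x => by
    rw [hG]
    have h1 : F x * (starRingEnd ℂ) (F x) = ((‖F x‖ ^ (2 : ℕ) : ℝ) : ℂ) := by
      rw [Complex.mul_conj, Complex.normSq_eq_norm_sq]
    rw [mul_left_comm, h1, ← Complex.ofReal_mul, ← Real.rpow_natCast,
      ← Real.rpow_add' (norm_nonneg _) (by push_cast; linarith)]
    congr 2; push_cast; ring
  have hFp : MemLp F (ENNReal.ofReal p) := memLp_of_integrable_of_bound hFi hFN (by linarith)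
  have hp' : ENNReal.ofReal p ≠ 0 := by simpa using hp0
  have hq' : ENNReal.ofReal q ≠ 0 := by simpa using hq0
  have hnorm : ∀ (r : ℝ) (hr : 0 < r) (H : Rn1 n → ℂ),
      eLpNorm H (ENNReal.ofReal r) volume = (∫⁻ x, ‖H x‖ₑ ^ r) ^ (1 / r) := fun r hr H => by
    rw [eLpNorm_eq_lintegral_rpow_enorm_toReal (by simpa using hr) ENNReal.ofReal_ne_top,
      ENNReal.toReal_ofReal hr.le]
  set E := ∫⁻ x, ‖F x‖ₑ ^ p with hE
  have hGq : ∫⁻ x, ‖G x‖ₑ ^ q = E := by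
    refine lintegral_congr fun x => ?_
    rw [← ofReal_norm, hGn, ← ENNReal.ofReal_rpow_of_nonneg (norm_nonneg _) (by linarith),
      ← ENNReal.rpow_mul, mul_comm, hqp, ofReal_norm]
  have hEint : E = ‖∫ x, F x * G x‖ₑ := by
    have h1 : Integrable fun x => ‖F x‖ ^ p := by
      have := hFp.integrable_norm_rpow hp' ENNReal.ofReal_ne_top
      rwa [ENNReal.toReal_ofReal hp0.le] at this
    simp only [hFG]
    rw [integral_complex_ofReal, ← ofReal_norm, Complex.norm_real, Real.norm_eq_abs,
      abs_of_nonneg (integral_nonneg fun x => by positivity),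
      ofReal_integral_eq_lintegral_ofReal h1 (Filter.Eventually.of_forall fun x => by positivity)]
    refine lintegral_congr fun x => ?_
    rw [← ENNReal.ofReal_rpow_of_nonneg (norm_nonneg _) hp0.le, ofReal_norm]
  have hEtop : E ≠ ∞ := by
    rw [hEint]; exact enorm_ne_top
  have hH := hK.comp_neg.eLpNorm_conv1_le_of_lt_two hGc hGi hGb hq1 hq2
  have hmain : E ≤ eLpNorm f (ENNReal.ofReal p) volume *
      ((weakConst n A * interpConst q) ^ (1 / q) * E ^ (1 / q)) := by
    calc E = ‖∫ y, f y * conv1 (fun x => K (-x)) G y‖ₑ := by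
          rw [hEint, integral_conv1_mul hK' hfi hGc.aestronglyMeasurable hGb]
      _ ≤ ∫⁻ y, ‖f y * conv1 (fun x => K (-x)) G y‖ₑ := enorm_integral_le_lintegral_enorm _
      _ = ∫⁻ y, ((fun y => ‖f y‖ₑ) * fun y => ‖conv1 (fun x => K (-x)) G y‖ₑ) y := by
          simp only [enorm_mul, Pi.mul_apply]
      _ ≤ (∫⁻ y, ‖f y‖ₑ ^ p) ^ (1 / p) * (∫⁻ y, ‖conv1 (fun x => K (-x)) G y‖ₑ ^ q) ^ (1 / q) :=
          ENNReal.lintegral_mul_le_Lp_mul_Lq _ hpq hf.enorm.aemeasurable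
            (integrable_conv1 hK'.comp_neg hGi).aestronglyMeasurable.enorm
      _ ≤ _ := by
          rw [← hnorm p hp0, ← hnorm q hq0]
          gcongr
          rwa [hnorm q hq0 G, hGq] at hH
  rw [hnorm p hp0 F, ← hE]
  rcases eq_or_ne E 0 with h0 | h0
  · rw [h0, ENNReal.zero_rpow_of_pos (by positivity)]
    exact zero_le
  have hE0 : E ^ (1 / q) ≠ 0 := (ENNReal.rpow_pos (pos_iff_ne_zero.2 h0) hEtop).ne'
  have hEt : E ^ (1 / q) ≠ ∞ := ENNReal.rpow_ne_top_of_nonneg (by positivity) hEtop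
  have hsplit : E = E ^ (1 / p) * E ^ (1 / q) := by
    rw [← ENNReal.rpow_add _ _ h0 hEtop, one_div, one_div, hpq.inv_add_inv_eq_one,
      ENNReal.rpow_one]
  rw [← ENNReal.mul_le_mul_iff_left hE0 hEt, ← hsplit]
  exact hmain.trans (le_of_eq (by ring))

/-- A bound for the `Lᵖ` operator norm of a Calderón–Zygmund kernel with constant `A`. -/
theorem exists_eLpNorm_conv1_le (n : ℕ) (A p : ℝ) (hp : 1 < p) :
    ∃ C : ℝ≥0∞, C ≠ ∞ ∧ ∀ K : Rn1 n → ℂ, CZKernel K A → ∀ f : Rn1 n → ℂ, Continuous f →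
      Integrable f → (∃ M : ℝ, ∀ x, ‖f x‖ ≤ M) →
      eLpNorm (conv1 K f) (ENNReal.ofReal p) volume ≤ C * eLpNorm f (ENNReal.ofReal p) volume := by
  have hfin : ∀ q : ℝ, 1 < q → (weakConst n A * interpConst q) ^ (1 / q) ≠ ∞ := fun q hq =>
    ENNReal.rpow_ne_top_of_nonneg (by positivity)
      (ENNReal.mul_ne_top (weakConst_ne_top n A) (by unfold interpConst; finiteness))
  rcases lt_trichotomy p 2 with h | rfl | h
  · exact ⟨_, hfin p hp, fun K hK f hf hfi ⟨M, hM⟩ => hK.eLpNorm_conv1_le_of_lt_two hf hfi hM hp h⟩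
  · refine ⟨ENNReal.ofReal A, ENNReal.ofReal_ne_top, fun K hK f _ hfi ⟨M, hM⟩ => ?_⟩
    rw [ENNReal.ofReal_ofNat]
    exact eLpNorm_conv1_two_le hK.integrable hK.norm_FT1_le hfi hM
  · have hpq := Real.HolderConjugate.conjExponent hp
    exact ⟨_, hfin _ hpq.symm.lt,
      fun K hK f hf hfi ⟨M, hM⟩ => hK.eLpNorm_conv1_le_of_two_lt hf hfi hM hpq h⟩

end Duality

section Limit

variable {n : ℕ}

theorem conv1_eq_MOp {K : Rn1 n → ℂ} (hK : Integrable K) {A : ℝ} (hA : ∀ q, ‖FT1 K q‖ ≤ A)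
    (f : SchwartzMap (Rn1 n) ℂ) : conv1 K ⇑f = MOp (FT1 K) ⇑f := by
  obtain ⟨M, hM⟩ : ∃ M : ℝ, ∀ x, ‖f x‖ ≤ M :=
    ⟨_, fun x => SchwartzMap.norm_le_seminorm ℝ f x⟩
  have h1 : FT1 (conv1 K ⇑f) = fun q => FT1 K q * FT1 (⇑f) q :=
    funext fun q => FT1_conv1 hK f.integrable q
  ext x
  rw [MOp, ← h1, IFT1_FT1 (continuous_conv1 hK f.continuous hM) (integrable_conv1 hK f.integrable)]
  rw [h1]
  exact (integrable_FT1_schwartz f).bdd_mul (continuous_FT1 hK).aestronglyMeasurable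
    (Filter.Eventually.of_forall hA)

theorem norm_exp_two_pi_I_mul (s : ℝ) : ‖Complex.exp ((2 * (π : ℂ) * Complex.I) * (s : ℂ))‖ = 1 := by
  rw [show (2 * (π : ℂ) * Complex.I) * (s : ℂ) = ((2 * π * s : ℝ) : ℂ) * Complex.I by
    push_cast; ring, Complex.norm_exp_ofReal_mul_I]

theorem tendsto_MOp {m : ℕ → Rn1 n → ℂ} {m' : Rn1 n → ℂ} (hc : ∀ k, Continuous (m k)) {A : ℝ}
    (hA : ∀ k q, ‖m k q‖ ≤ A)
    (hm : ∀ q, Filter.Tendsto (fun k => m k q) Filter.atTop (nhds (m' q)))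
    (f : SchwartzMap (Rn1 n) ℂ) (x : Rn1 n) :
    Filter.Tendsto (fun k => MOp (m k) ⇑f x) Filter.atTop (nhds (MOp m' ⇑f x)) := by
  simp only [MOp, IFT1]
  have hexp : Continuous fun q : Rn1 n => Complex.exp ((2 * (π : ℂ) * Complex.I) *
      (((∑ k, q.1 k * x.1 k) + q.2 * x.2 : ℝ) : ℂ)) := by fun_prop
  refine tendsto_integral_of_dominated_convergence (fun q => A * ‖FT1 (⇑f) q‖) (fun k => ?_)
    ((integrable_FT1_schwartz f).norm.const_mul A) (fun k => ?_) ?_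
  · exact (hexp.mul ((hc k).mul (continuous_FT1 f.integrable))).aestronglyMeasurable
  · filter_upwards with q
    rw [norm_mul, norm_exp_two_pi_I_mul, one_mul, norm_mul]
    gcongr
    exact hA k q
  · filter_upwards with q
    exact ((hm q).mul_const _).const_mul _

theorem exists_pNorm_MOp_le {m : ℕ → Rn1 n → ℂ} {m' : Rn1 n → ℂ} {A : ℝ}
    (hK : ∀ k, ∃ K : Rn1 n → ℂ, CZKernel K A ∧ FT1 K = m k)
    (hm : ∀ q, Filter.Tendsto (fun k => m k q) Filter.atTop (nhds (m' q))) {p : ℝ} (hp : 1 < p) :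
    ∃ M : ℝ, 0 < M ∧ ∀ f : SchwartzMap (Rn1 n) ℂ,
      pNorm p (MOp m' ⇑f) ≤ ENNReal.ofReal M * pNorm p ⇑f := by
  choose K hCZ hFT using hK
  obtain ⟨C, hC, hbound⟩ := exists_eLpNorm_conv1_le n A p hp
  refine ⟨C.toReal + 1, by positivity, fun f => ?_⟩
  have hc : ∀ k, Continuous (m k) := fun k => hFT k ▸ continuous_FT1 (hCZ k).integrable
  have hA : ∀ k q, ‖m k q‖ ≤ A := fun k => hFT k ▸ (hCZ k).norm_FT1_le
  have hfb : ∃ M : ℝ, ∀ x, ‖f x‖ ≤ M := ⟨_, fun x => SchwartzMap.norm_le_seminorm ℝ f x⟩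
  have hconv : ∀ k, MOp (m k) ⇑f = conv1 (K k) ⇑f := fun k => by
    rw [conv1_eq_MOp (hCZ k).integrable (hCZ k).norm_FT1_le, hFT]
  have h1 : ∀ k, pNorm p (MOp (m k) ⇑f) ≤ C * pNorm p ⇑f := fun k => by
    rw [hconv]
    exact hbound (K k) (hCZ k) f f.continuous f.integrable hfb
  have h2 : pNorm p (MOp m' ⇑f) ≤ Filter.liminf (fun k => pNorm p (MOp (m k) ⇑f)) Filter.atTop :=
    Lp.eLpNorm_lim_le_liminf_eLpNorm
      (fun k => by
        rw [hconv]
        exact (integrable_conv1 (hCZ k).integrable f.integrable).aestronglyMeasurable) _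
      (Filter.Eventually.of_forall fun x => tendsto_MOp hc hA hm f x)
  have h3 : Filter.liminf (fun k => pNorm p (MOp (m k) ⇑f)) Filter.atTop ≤ C * pNorm p ⇑f :=
    Filter.liminf_le_of_frequently_le' (Filter.Frequently.of_forall h1)
  refine (h2.trans h3).trans ?_
  gcongr
  rw [ENNReal.ofReal_add ENNReal.toReal_nonneg zero_le_one, ENNReal.ofReal_toReal hC]
  exact le_self_add

end Limit

section Gauss

variable {V : Type*} [NormedAddCommGroup V] [InnerProductSpace ℝ V]

/-- The Gaussian on `V` with integral `1` and Fourier transform `w ↦ exp (-a ‖w‖ ^ 2)`. -/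
def gaussKer (a : ℝ) (x : V) : ℝ :=
  (π / a) ^ ((Module.finrank ℝ V : ℝ) / 2) * Real.exp (-(π ^ 2 / a) * ‖x‖ ^ 2)

theorem gaussKer_nonneg {a : ℝ} (ha : 0 < a) (x : V) : 0 ≤ gaussKer a x := by
  unfold gaussKer; positivity

theorem gaussKer_two_mul {a : ℝ} (ha : 0 < a) (x : V) :
    ‖x‖ ^ 2 * gaussKer a x ≤
      2 * a / π ^ 2 * 2 ^ ((Module.finrank ℝ V : ℝ) / 2) * gaussKer (2 * a) x := by
  have h1 : (π / a) ^ ((Module.finrank ℝ V : ℝ) / 2) =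
      2 ^ ((Module.finrank ℝ V : ℝ) / 2) * (π / (2 * a)) ^ ((Module.finrank ℝ V : ℝ) / 2) := by
    rw [← Real.mul_rpow (by positivity) (by positivity)]
    congr 1; field_simp
  set s : ℝ := π ^ 2 / (2 * a) * ‖x‖ ^ 2 with hs
  have h2 : s * Real.exp (-s) ≤ 1 := by
    have := Real.add_one_le_exp s
    rw [Real.exp_neg, ← div_eq_mul_inv, div_le_one (Real.exp_pos _)]
    linarith
  have e1 : Real.exp (-(π ^ 2 / a) * ‖x‖ ^ 2) = Real.exp (-s) * Real.exp (-s) := by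
    rw [← Real.exp_add]; congr 1; rw [hs]; field_simp; ring
  have e2 : Real.exp (-(π ^ 2 / (2 * a)) * ‖x‖ ^ 2) = Real.exp (-s) := by
    congr 1; rw [hs]; ring
  have e3 : ‖x‖ ^ 2 = 2 * a / π ^ 2 * s := by rw [hs]; field_simp
  unfold gaussKer
  rw [e1, e2, h1, e3]
  have : 0 ≤ 2 ^ ((Module.finrank ℝ V : ℝ) / 2) * (π / (2 * a)) ^ ((Module.finrank ℝ V : ℝ) / 2)
      * (2 * a / π ^ 2) * Real.exp (-s) := by positivity
  nlinarith [mul_le_mul_of_nonneg_left h2 this]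

theorem gaussKer_sub_translate_le {a : ℝ} (ha : 0 < a) (x y : V) :
    gaussKer a x - gaussKer a (x - y) ≤
      π ^ 2 / a * (2 * ‖y‖ * (‖x‖ * gaussKer a x) + ‖y‖ ^ 2 * gaussKer a x) := by
  have h0 : ‖x - y‖ ≤ ‖x‖ + ‖y‖ := norm_sub_le x y
  have h1 : ‖x - y‖ ^ 2 - ‖x‖ ^ 2 ≤ 2 * ‖x‖ * ‖y‖ + ‖y‖ ^ 2 := by
    nlinarith [norm_nonneg (x - y), norm_nonneg x, norm_nonneg y]
  set s : ℝ := π ^ 2 / a * (‖x - y‖ ^ 2 - ‖x‖ ^ 2) with hs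
  have h2 : gaussKer a (x - y) = gaussKer a x * Real.exp (-s) := by
    unfold gaussKer
    rw [mul_assoc, ← Real.exp_add]; congr 2; rw [hs]; ring
  have h3 : s ≤ π ^ 2 / a * (2 * ‖x‖ * ‖y‖ + ‖y‖ ^ 2) := by
    rw [hs]; gcongr
  have h4 := Real.add_one_le_exp (-s)
  have h5 := gaussKer_nonneg ha x
  rw [h2]
  nlinarith [mul_le_mul_of_nonneg_left h3 h5, mul_le_mul_of_nonneg_left h4 h5]

theorem gaussKer_sub_add_le {a w : ℝ} (ha : 0 < a) (hw : 0 ≤ w) (x : V) :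
    gaussKer a x - gaussKer (a + w) x ≤ Module.finrank ℝ V * (w / a) * gaussKer a x := by
  set d := Module.finrank ℝ V
  have h1 : (π / a) ^ ((d : ℝ) / 2) * (a / (a + w)) ^ ((d : ℝ) / 2) =
      (π / (a + w)) ^ ((d : ℝ) / 2) := by
    rw [← Real.mul_rpow (by positivity) (by positivity)]
    congr 1; field_simp
  have hθ : 0 < a / (a + w) := by positivity
  have hθ1 : a / (a + w) ≤ 1 := by rw [div_le_one (by positivity)]; linarith
  have h2 : 1 - d * (w / a) ≤ (a / (a + w)) ^ ((d : ℝ) / 2) := by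
    have e : a / (a + w) = 1 + (-(w / (a + w))) := by field_simp; ring
    have e1 : w / (a + w) ≤ w / a := by gcongr; linarith
    have e2 : w / (a + w) ≤ 1 := by rw [div_le_one (by positivity)]; linarith
    calc 1 - d * (w / a) ≤ 1 + d * (-(w / (a + w))) := by nlinarith [Nat.cast_nonneg (α := ℝ) d]
      _ ≤ (a / (a + w)) ^ d := by rw [e]; exact one_add_mul_le_pow (by linarith) d
      _ = (a / (a + w)) ^ (d : ℝ) := (Real.rpow_natCast _ _).symm
      _ ≤ _ := Real.rpow_le_rpow_of_exponent_ge hθ hθ1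
          (by linarith [Nat.cast_nonneg (α := ℝ) d])
  have h3 : Real.exp (-(π ^ 2 / a) * ‖x‖ ^ 2) ≤ Real.exp (-(π ^ 2 / (a + w)) * ‖x‖ ^ 2) := by
    rw [Real.exp_le_exp, neg_mul, neg_mul, neg_le_neg_iff]
    gcongr; linarith
  have h4 : (a / (a + w)) ^ ((d : ℝ) / 2) * gaussKer a x ≤ gaussKer (a + w) x := by
    unfold gaussKer
    rw [← h1]
    have : 0 ≤ (π / a) ^ ((d : ℝ) / 2) * (a / (a + w)) ^ ((d : ℝ) / 2) := by positivity
    nlinarith [mul_le_mul_of_nonneg_left h3 this]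
  nlinarith [mul_le_mul_of_nonneg_right h2 (gaussKer_nonneg ha x)]

theorem integral_norm_sub_le_two_mul {α : Type*} [MeasurableSpace α] {μ : Measure α} {g h φ : α → ℝ}
    (hg : Integrable g μ) (hh : Integrable h μ) (hφ : Integrable φ μ) (hφ0 : ∀ x, 0 ≤ φ x)
    (heq : ∫ x, g x ∂μ = ∫ x, h x ∂μ) (hle : ∀ x, g x - h x ≤ φ x) :
    ∫ x, ‖g x - h x‖ ∂μ ≤ 2 * ∫ x, φ x ∂μ := by
  calc ∫ x, ‖g x - h x‖ ∂μ ≤ ∫ x, (2 * φ x - (g x - h x)) ∂μ := by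
        refine integral_mono (hg.sub hh).norm ((hφ.const_mul 2).sub (hg.sub hh)) fun x => ?_
        have := hφ0 x
        have := hle x
        rw [Real.norm_eq_abs]
        exact abs_le.2 ⟨by linarith, by linarith⟩ |>.trans le_rfl
    _ = 2 * ∫ x, φ x ∂μ := by
        have h1 := integral_sub (hφ.const_mul 2) (hg.sub hh)
        have h2 := integral_sub hg hh
        simp only [Pi.sub_apply] at h1
        rw [h1, h2, integral_const_mul, heq, sub_self, sub_zero]

variable [MeasurableSpace V] [BorelSpace V]

theorem measurable_gaussKer : Measurable fun z : ℝ × V => gaussKer z.1 z.2 := by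
  unfold gaussKer; fun_prop

theorem measurable_gaussKer_right (a : ℝ) : Measurable (gaussKer a : V → ℝ) := by
  unfold gaussKer; fun_prop

variable [FiniteDimensional ℝ V]

theorem integrable_gaussKer {a : ℝ} (ha : 0 < a) : Integrable (gaussKer a : V → ℝ) := by
  have hb : 0 < π ^ 2 / a := by positivity
  have := GaussianFourier.integrable_cexp_neg_mul_sq_norm_add (b := ((π ^ 2 / a : ℝ) : ℂ)) (V := V)
    (by rwa [Complex.ofReal_re]) 0 0
  have := this.norm.const_mul ((π / a) ^ ((Module.finrank ℝ V : ℝ) / 2))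
  refine this.congr (Filter.Eventually.of_forall fun x => ?_)
  simp only [gaussKer, Complex.norm_exp]
  congr 2
  simp [← Complex.ofReal_pow]

theorem integral_gaussKer {a : ℝ} (ha : 0 < a) : ∫ x : V, gaussKer a x = 1 := by
  have hb : 0 < π ^ 2 / a := by positivity
  simp only [gaussKer]
  rw [integral_const_mul, GaussianFourier.integral_rexp_neg_mul_sq_norm hb,
    ← Real.mul_rpow (by positivity) (by positivity)]
  rw [show π / a * (π / (π ^ 2 / a)) = 1 by field_simp, Real.one_rpow]

theorem fourier_gaussKer {a : ℝ} (ha : 0 < a) (w : V) :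
    ∫ x : V, Complex.exp (-(2 * (π : ℂ) * Complex.I) * ((inner ℝ x w : ℝ) : ℂ)) * (gaussKer a x : ℂ) =
      Complex.exp (-(a : ℂ) * (‖w‖ : ℂ) ^ 2) := by
  have hb : 0 < π ^ 2 / a := by positivity
  have hπ : (π : ℂ) ≠ 0 := by exact_mod_cast Real.pi_ne_zero
  have ha' : (a : ℂ) ≠ 0 := by exact_mod_cast ha.ne'
  have h := fourier_gaussian_innerProductSpace (b := ((π ^ 2 / a : ℝ) : ℂ)) (V := V)
    (by rwa [Complex.ofReal_re]) w
  rw [Real.fourier_eq'] at h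
  have e : ∀ x : V, Complex.exp (-(2 * (π : ℂ) * Complex.I) * ((inner ℝ x w : ℝ) : ℂ)) *
      (gaussKer a x : ℂ) = (((π / a) ^ ((Module.finrank ℝ V : ℝ) / 2) : ℝ) : ℂ) *
      (Complex.exp (((-2 * π * inner ℝ x w : ℝ) : ℂ) * Complex.I) •
        Complex.exp (-((π ^ 2 / a : ℝ) : ℂ) * (‖x‖ : ℂ) ^ 2)) := by
    intro x
    unfold gaussKer
    push_cast
    rw [smul_eq_mul, show -(2 * (π : ℂ) * Complex.I) * ((inner ℝ x w : ℝ) : ℂ) =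
      -2 * π * (inner ℝ x w : ℝ) * Complex.I by ring]
    ring
  simp only [e]
  rw [integral_const_mul, h, ← mul_assoc]
  have e2 : (((π / a) ^ ((Module.finrank ℝ V : ℝ) / 2) : ℝ) : ℂ) *
      ((π : ℂ) / ((π ^ 2 / a : ℝ) : ℂ)) ^ ((Module.finrank ℝ V : ℂ) / 2) = 1 := by
    have : ((π : ℂ) / ((π ^ 2 / a : ℝ) : ℂ)) ^ ((Module.finrank ℝ V : ℂ) / 2) =
        (((π / (π ^ 2 / a)) ^ ((Module.finrank ℝ V : ℝ) / 2) : ℝ) : ℂ) := by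
      rw [Complex.ofReal_cpow (by positivity)]; push_cast; rfl
    rw [this, ← Complex.ofReal_mul, ← Real.mul_rpow (by positivity) (by positivity),
      show π / a * (π / (π ^ 2 / a)) = 1 by field_simp, Real.one_rpow, Complex.ofReal_one]
  rw [e2, one_mul]
  congr 1
  push_cast
  field_simp

theorem integrable_norm_sq_mul_gaussKer {a : ℝ} (ha : 0 < a) :
    Integrable fun x : V => ‖x‖ ^ 2 * gaussKer a x := by
  refine ((integrable_gaussKer (V := V) (a := 2 * a) (by positivity)).const_mul
    (2 * a / π ^ 2 * 2 ^ ((Module.finrank ℝ V : ℝ) / 2))).mono'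
    (((continuous_norm.pow 2).measurable.mul (measurable_gaussKer_right a)).aestronglyMeasurable)
    (Filter.Eventually.of_forall fun x => ?_)
  rw [Real.norm_of_nonneg (mul_nonneg (by positivity) (gaussKer_nonneg ha x))]
  exact gaussKer_two_mul ha x

theorem integral_norm_sq_mul_gaussKer_le {a : ℝ} (ha : 0 < a) :
    ∫ x : V, ‖x‖ ^ 2 * gaussKer a x ≤ 2 ^ ((Module.finrank ℝ V : ℝ) / 2) * a := by
  calc ∫ x : V, ‖x‖ ^ 2 * gaussKer a x ≤ ∫ x : V, 2 * a / π ^ 2 * 2 ^ ((Module.finrank ℝ V : ℝ) / 2) *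
        gaussKer (2 * a) x :=
        integral_mono (integrable_norm_sq_mul_gaussKer ha)
          ((integrable_gaussKer (by positivity)).const_mul _) (fun x => gaussKer_two_mul ha x)
    _ = 2 / π ^ 2 * (2 ^ ((Module.finrank ℝ V : ℝ) / 2) * a) := by
        rw [integral_const_mul, integral_gaussKer (by positivity)]; ring
    _ ≤ 1 * (2 ^ ((Module.finrank ℝ V : ℝ) / 2) * a) := by
        gcongr
        rw [div_le_one (by positivity)]; nlinarith [Real.pi_gt_three]
    _ = _ := one_mul _

theorem norm_le_half {a r : ℝ} (ha : 0 < a) : r ≤ (√a + r ^ 2 / √a) / 2 := by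
  have h : 0 < √a := Real.sqrt_pos.2 ha
  rw [le_div_iff₀ two_pos, ← sub_nonneg]
  have : √a + r ^ 2 / √a - r * 2 = (√a - r) ^ 2 / √a := by field_simp; ring
  rw [this]; positivity

theorem integrable_norm_mul_gaussKer {a : ℝ} (ha : 0 < a) :
    Integrable fun x : V => ‖x‖ * gaussKer a x := by
  refine (((integrable_gaussKer (V := V) ha).const_mul (√a)).add
    ((integrable_norm_sq_mul_gaussKer ha).div_const (√a))).mono'
    ((continuous_norm.measurable.mul (measurable_gaussKer_right a)).aestronglyMeasurable)
    (Filter.Eventually.of_forall fun x => ?_)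
  have h0 := gaussKer_nonneg ha x
  rw [Real.norm_of_nonneg (mul_nonneg (by positivity) h0)]
  have h1 := mul_le_mul_of_nonneg_right (norm_le_half (r := ‖x‖) ha) h0
  have h2 : 0 ≤ √a * gaussKer a x := by positivity
  have h3 : 0 ≤ ‖x‖ ^ 2 * gaussKer a x / √a := by positivity
  have h4 : (√a + ‖x‖ ^ 2 / √a) / 2 * gaussKer a x =
    (√a * gaussKer a x + ‖x‖ ^ 2 * gaussKer a x / √a) / 2 := by ring
  simp only [Pi.add_apply]
  linarith

theorem integral_norm_mul_gaussKer_le {a : ℝ} (ha : 0 < a) :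
    ∫ x : V, ‖x‖ * gaussKer a x ≤ 2 ^ ((Module.finrank ℝ V : ℝ) / 2) * √a := by
  have hs : 0 < √a := Real.sqrt_pos.2 ha
  have hd : (1 : ℝ) ≤ 2 ^ ((Module.finrank ℝ V : ℝ) / 2) :=
    Real.one_le_rpow (by norm_num) (by positivity)
  calc ∫ x : V, ‖x‖ * gaussKer a x
      ≤ ∫ x : V, (√a / 2 * gaussKer a x + ‖x‖ ^ 2 * gaussKer a x / (2 * √a)) := by
        refine integral_mono (integrable_norm_mul_gaussKer ha)
          (((integrable_gaussKer ha).const_mul _).add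
            ((integrable_norm_sq_mul_gaussKer ha).div_const _)) fun x => ?_
        have h1 := mul_le_mul_of_nonneg_right (norm_le_half (r := ‖x‖) ha) (gaussKer_nonneg ha x)
        refine h1.trans (le_of_eq ?_)
        field_simp
    _ = √a / 2 + (∫ x : V, ‖x‖ ^ 2 * gaussKer a x) / (2 * √a) := by
        rw [integral_add ((integrable_gaussKer ha).const_mul _)
            ((integrable_norm_sq_mul_gaussKer ha).div_const _), integral_const_mul,
          integral_gaussKer ha, integral_div, mul_one]
    _ ≤ √a / 2 + (2 ^ ((Module.finrank ℝ V : ℝ) / 2) * a) / (2 * √a) := by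
        gcongr; exact integral_norm_sq_mul_gaussKer_le ha
    _ = √a / 2 + 2 ^ ((Module.finrank ℝ V : ℝ) / 2) * √a / 2 := by
        congr 1
        rw [div_eq_div_iff (by positivity) two_ne_zero]
        have := Real.mul_self_sqrt ha.le
        linear_combination (-2 * 2 ^ ((Module.finrank ℝ V : ℝ) / 2)) * this
    _ ≤ _ := by nlinarith

end Gauss

section GaussBounds

variable {V : Type*} [NormedAddCommGroup V] [InnerProductSpace ℝ V]
  [MeasurableSpace V] [BorelSpace V] [FiniteDimensional ℝ V]

/-- The constant in the `L¹` estimates for Gaussians in dimension `d`. -/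
def gaussConst (d : ℕ) : ℝ := 62 * 2 ^ ((d : ℝ) / 2) + 2 * d

theorem two_rpow_le_gaussConst (d : ℕ) : 62 * 2 ^ ((d : ℝ) / 2) ≤ gaussConst d := by
  unfold gaussConst; linarith [Nat.cast_nonneg (α := ℝ) d]

theorem one_le_two_rpow (d : ℕ) : (1 : ℝ) ≤ 2 ^ ((d : ℝ) / 2) :=
  Real.one_le_rpow (by norm_num) (by positivity)

theorem one_le_gaussConst (d : ℕ) : 1 ≤ gaussConst d := by
  linarith [two_rpow_le_gaussConst d, one_le_two_rpow d]

theorem lintegral_enorm_gaussKer {a : ℝ} (ha : 0 < a) : ∫⁻ x : V, ‖gaussKer a x‖ₑ = 1 := by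
  rw [← ofReal_integral_norm_eq_lintegral_enorm (integrable_gaussKer ha)]
  simp_rw [Real.norm_of_nonneg (gaussKer_nonneg ha _)]
  rw [integral_gaussKer ha, ENNReal.ofReal_one]

theorem lintegral_enorm_gaussKer_sub_translate_le {a : ℝ} (ha : 0 < a) (y : V) :
    ∫⁻ x : V, ‖gaussKer a x - gaussKer a (x - y)‖ₑ ≤
      ENNReal.ofReal (gaussConst (Module.finrank ℝ V) * (‖y‖ / √a)) := by
  have hs : 0 < √a := Real.sqrt_pos.2 ha
  have hi := integrable_gaussKer (V := V) ha
  have hi' : Integrable fun x : V => gaussKer a (x - y) := hi.comp_sub_right y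
  have he : ∫ x : V, gaussKer a (x - y) = 1 := by
    rw [integral_sub_right_eq_self (gaussKer a : V → ℝ) y, integral_gaussKer ha]
  have hInt := ofReal_integral_norm_eq_lintegral_enorm (hi.sub hi')
  simp only [Pi.sub_apply] at hInt
  rw [← hInt]
  refine ENNReal.ofReal_le_ofReal ?_
  set c : ℝ := 2 ^ ((Module.finrank ℝ V : ℝ) / 2)
  have hC : 62 * c ≤ gaussConst (Module.finrank ℝ V) := two_rpow_le_gaussConst _
  have hc : 1 ≤ c := one_le_two_rpow _
  have hy0 : 0 ≤ ‖y‖ / √a := by positivity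
  by_cases hy : ‖y‖ / √a ≤ 1
  · have h1 := (integrable_norm_mul_gaussKer (V := V) ha).const_mul (2 * ‖y‖)
    have h2 := hi.const_mul (‖y‖ ^ 2)
    have h := integral_norm_sub_le_two_mul hi hi' ((h1.add h2).const_mul (π ^ 2 / a))
      (fun x => by
        have := gaussKer_nonneg ha x
        simp only [Pi.add_apply]; positivity) (by rw [he, integral_gaussKer ha])
      (fun x => gaussKer_sub_translate_le ha x y)
    refine h.trans ?_
    simp only [Pi.add_apply]
    rw [integral_const_mul, integral_add h1 h2, integral_const_mul, integral_const_mul,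
      integral_gaussKer ha]
    have h3 : ∫ x : V, ‖x‖ * gaussKer a x ≤ c * √a := integral_norm_mul_gaussKer_le ha
    calc 2 * (π ^ 2 / a * (2 * ‖y‖ * (∫ x : V, ‖x‖ * gaussKer a x) + ‖y‖ ^ 2 * 1))
        ≤ 2 * (π ^ 2 / a * (2 * ‖y‖ * (c * √a) + ‖y‖ ^ 2 * 1)) := by gcongr
      _ = 2 * π ^ 2 * (2 * c * (‖y‖ / √a) + (‖y‖ / √a) ^ 2) := by
          rw [div_pow, Real.sq_sqrt ha.le]
          have h5 : √a / a = 1 / √a := by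
            rw [div_eq_div_iff ha.ne' hs.ne', Real.mul_self_sqrt ha.le, one_mul]
          linear_combination (4 * π ^ 2 * ‖y‖ * c) * h5
      _ ≤ 2 * 10 * (2 * c * (‖y‖ / √a) + (‖y‖ / √a) * c) := by
          have : π ^ 2 ≤ 10 := by nlinarith [Real.pi_lt_d2, Real.pi_gt_three]
          have : (‖y‖ / √a) ^ 2 ≤ (‖y‖ / √a) * c := by nlinarith
          gcongr
      _ = 60 * c * (‖y‖ / √a) := by ring
      _ ≤ _ := by gcongr; linarith
  · push Not at hy
    calc ∫ x : V, ‖gaussKer a x - gaussKer a (x - y)‖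
        ≤ ∫ x : V, (gaussKer a x + gaussKer a (x - y)) := by
          refine integral_mono (hi.sub hi').norm (hi.add hi') fun x => ?_
          have h1 := gaussKer_nonneg ha x
          have h2 := gaussKer_nonneg ha (x - y)
          rw [Real.norm_eq_abs]
          exact abs_le.2 ⟨by linarith, by linarith⟩
      _ = 2 := by rw [integral_add hi hi', he, integral_gaussKer ha]; norm_num
      _ ≤ _ := by nlinarith

theorem lintegral_enorm_gaussKer_sub_add_le {a w : ℝ} (ha : 0 < a) (hw : 0 ≤ w) :
    ∫⁻ x : V, ‖gaussKer a x - gaussKer (a + w) x‖ₑ ≤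
      ENNReal.ofReal (gaussConst (Module.finrank ℝ V) * (w / a)) := by
  have haw : 0 < a + w := by positivity
  have hi := integrable_gaussKer (V := V) ha
  have hi' := integrable_gaussKer (V := V) haw
  have hInt := ofReal_integral_norm_eq_lintegral_enorm (hi.sub hi')
  simp only [Pi.sub_apply] at hInt
  rw [← hInt]
  refine ENNReal.ofReal_le_ofReal ?_
  have h := integral_norm_sub_le_two_mul hi hi' (hi.const_mul (Module.finrank ℝ V * (w / a)))
    (fun x => by have := gaussKer_nonneg ha x; positivity)
    (by rw [integral_gaussKer ha, integral_gaussKer haw]) (fun x => gaussKer_sub_add_le ha hw x)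
  refine h.trans ?_
  rw [integral_const_mul, integral_gaussKer ha, mul_one, ← mul_assoc]
  gcongr
  unfold gaussConst
  have := one_le_two_rpow (Module.finrank ℝ V)
  linarith

theorem setLIntegral_enorm_gaussKer_le {a r : ℝ} (ha : 0 < a) (hr : 0 < r) (z : V) :
    ∫⁻ x in {x : V | r ≤ ‖x‖}, ‖gaussKer a (x - z)‖ₑ ≤
      ENNReal.ofReal (gaussConst (Module.finrank ℝ V) * ((a + ‖z‖ ^ 2) / r ^ 2)) := by
  set c : ℝ := 2 ^ ((Module.finrank ℝ V : ℝ) / 2)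
  have hC : 62 * c ≤ gaussConst (Module.finrank ℝ V) := two_rpow_le_gaussConst _
  have hc : 1 ≤ c := one_le_two_rpow _
  set F : V → ℝ := fun x => 2 / r ^ 2 * (‖x‖ ^ 2 * gaussKer a x + ‖z‖ ^ 2 * gaussKer a x)
  have hF0 : ∀ x, 0 ≤ F x := fun x => by have := gaussKer_nonneg ha x; positivity
  have h1 := integrable_norm_sq_mul_gaussKer (V := V) ha
  have h2 := (integrable_gaussKer (V := V) ha).const_mul (‖z‖ ^ 2)
  have hF : Integrable F := (h1.add h2).const_mul _
  calc ∫⁻ x in {x : V | r ≤ ‖x‖}, ‖gaussKer a (x - z)‖ₑ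
      ≤ ∫⁻ x in {x : V | r ≤ ‖x‖}, ENNReal.ofReal (F (x - z)) := by
        refine setLIntegral_mono' (measurableSet_le measurable_const measurable_norm) fun x hx => ?_
        have hx : r ≤ ‖x‖ := hx
        rw [Real.enorm_of_nonneg (gaussKer_nonneg ha _)]
        refine ENNReal.ofReal_le_ofReal ?_
        have h3 : ‖x‖ ≤ ‖x - z‖ + ‖z‖ := norm_le_norm_sub_add x z
        have h4 : r ^ 2 ≤ 2 * (‖x - z‖ ^ 2 + ‖z‖ ^ 2) := by
          nlinarith [sq_nonneg (‖x - z‖ - ‖z‖), norm_nonneg (x - z), norm_nonneg z]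
        have h5 := mul_le_mul_of_nonneg_right h4 (gaussKer_nonneg ha (x - z))
        have h6 : F (x - z) = 2 * (‖x - z‖ ^ 2 + ‖z‖ ^ 2) * gaussKer a (x - z) / r ^ 2 := by
          simp only [F]; ring
        rw [h6, le_div_iff₀ (by positivity)]
        linarith
    _ ≤ ∫⁻ x, ENNReal.ofReal (F (x - z)) := setLIntegral_le_lintegral _ _
    _ = ∫⁻ x, ENNReal.ofReal (F x) := lintegral_sub_right_eq_self (fun x => ENNReal.ofReal (F x)) z
    _ = ENNReal.ofReal (∫ x, F x) :=
        (ofReal_integral_eq_lintegral_ofReal hF (Filter.Eventually.of_forall hF0)).symm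
    _ ≤ _ := by
        refine ENNReal.ofReal_le_ofReal ?_
        simp only [F]
        rw [integral_const_mul, integral_add h1 h2, integral_const_mul, integral_gaussKer ha]
        have h3 : ∫ x : V, ‖x‖ ^ 2 * gaussKer a x ≤ c * a := integral_norm_sq_mul_gaussKer_le ha
        calc 2 / r ^ 2 * ((∫ x : V, ‖x‖ ^ 2 * gaussKer a x) + ‖z‖ ^ 2 * 1)
            ≤ 2 / r ^ 2 * (c * a + ‖z‖ ^ 2 * c) := by gcongr
          _ = 2 * c * ((a + ‖z‖ ^ 2) / r ^ 2) := by ring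
          _ ≤ _ := by gcongr; linarith

end GaussBounds

section ParabolicGauss

theorem lintegral_enorm_prod_sub_le {α β : Type*} [MeasurableSpace α] [MeasurableSpace β]
    {μ : Measure α} {ν : Measure β} [SFinite μ] [SFinite ν] {f g : α → ℝ} {h k : β → ℝ}
    (hf : Measurable f) (hg : Measurable g) (hh : Measurable h) (hk : Measurable k)
    (h1 : ∫⁻ y, ‖h y‖ₑ ∂ν ≤ 1) (g1 : ∫⁻ x, ‖g x‖ₑ ∂μ ≤ 1) :
    ∫⁻ z, ‖f z.1 * h z.2 - g z.1 * k z.2‖ₑ ∂(μ.prod ν) ≤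
      (∫⁻ x, ‖f x - g x‖ₑ ∂μ) + ∫⁻ y, ‖h y - k y‖ₑ ∂ν := by
  calc ∫⁻ z, ‖f z.1 * h z.2 - g z.1 * k z.2‖ₑ ∂(μ.prod ν)
      ≤ ∫⁻ z, (‖f z.1 - g z.1‖ₑ * ‖h z.2‖ₑ + ‖g z.1‖ₑ * ‖h z.2 - k z.2‖ₑ) ∂(μ.prod ν) := by
        refine lintegral_mono fun z => ?_
        rw [show f z.1 * h z.2 - g z.1 * k z.2 =
          (f z.1 - g z.1) * h z.2 + g z.1 * (h z.2 - k z.2) by ring]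
        refine (enorm_add_le _ _).trans_eq ?_
        rw [enorm_mul, enorm_mul]
    _ = (∫⁻ x, ‖f x - g x‖ₑ ∂μ) * (∫⁻ y, ‖h y‖ₑ ∂ν) +
        (∫⁻ x, ‖g x‖ₑ ∂μ) * ∫⁻ y, ‖h y - k y‖ₑ ∂ν := by
        rw [lintegral_add_left (by fun_prop),
          lintegral_prod_mul (f := fun x => ‖f x - g x‖ₑ) (g := fun y => ‖h y‖ₑ)
            (by fun_prop) (by fun_prop),
          lintegral_prod_mul (f := fun x => ‖g x‖ₑ) (g := fun y => ‖h y - k y‖ₑ)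
            (by fun_prop) (by fun_prop)]
    _ ≤ _ := add_le_add (mul_le_of_le_one_right' h1) (mul_le_of_le_one_left' g1)

variable {n : ℕ}

/-- The product Gaussian on `ℝⁿ × ℝ` with parameters `a`, `b`, centred at `(0, t₀)`. -/
def pKer (a b t₀ : ℝ) (x : Rn1 n) : ℝ := gaussKer a x.1 * gaussKer b (x.2 - t₀)

theorem measurable_pKer (a b t₀ : ℝ) : Measurable (pKer a b t₀ : Rn1 n → ℝ) := by
  unfold pKer
  exact ((measurable_gaussKer_right a).comp measurable_fst).mul
    ((measurable_gaussKer_right b).comp (measurable_snd.sub_const t₀))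

theorem integrable_pKer {a b : ℝ} (ha : 0 < a) (hb : 0 < b) (t₀ : ℝ) :
    Integrable (pKer a b t₀ : Rn1 n → ℝ) := by
  rw [Measure.volume_eq_prod]
  exact (integrable_gaussKer ha).mul_prod ((integrable_gaussKer hb).comp_sub_right t₀)

theorem lintegral_enorm_gaussKer_translate {b : ℝ} (hb : 0 < b) (t₀ : ℝ) :
    ∫⁻ t : ℝ, ‖gaussKer b (t - t₀)‖ₑ = 1 := by
  rw [lintegral_sub_right_eq_self (fun t : ℝ => ‖gaussKer b t‖ₑ) t₀, lintegral_enorm_gaussKer hb]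

theorem lintegral_enorm_pKer {a b : ℝ} (ha : 0 < a) (hb : 0 < b) (t₀ : ℝ) :
    ∫⁻ x : Rn1 n, ‖pKer a b t₀ x‖ₑ = 1 := by
  unfold pKer
  simp_rw [enorm_mul]
  rw [Measure.volume_eq_prod, lintegral_prod_mul
    (f := fun x : Rn n => ‖gaussKer a x‖ₑ) (g := fun t : ℝ => ‖gaussKer b (t - t₀)‖ₑ)
    (measurable_gaussKer_right a).enorm.aemeasurable
    ((measurable_gaussKer_right b).comp (measurable_id.sub_const t₀)).enorm.aemeasurable,
    lintegral_enorm_gaussKer ha, lintegral_enorm_gaussKer_translate hb, mul_one]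

theorem FT1_pKer {a b : ℝ} (ha : 0 < a) (hb : 0 < b) (t₀ : ℝ) (q : Rn1 n) :
    FT1 (fun x => (pKer a b t₀ x : ℂ)) q = Complex.exp (-(a : ℂ) * (‖q.1‖ : ℂ) ^ 2) *
      (Complex.exp (-(2 * (π : ℂ) * Complex.I) * ((t₀ * q.2 : ℝ) : ℂ)) *
        Complex.exp (-(b : ℂ) * (q.2 : ℂ) ^ 2)) := by
  have h1 := fourier_gaussKer ha q.1
  have h2 := fourier_gaussKer hb q.2
  unfold FT1
  have e : ∀ x : Rn1 n, Complex.exp (-(2 * (π : ℂ) * Complex.I) *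
      (((∑ k, x.1 k * q.1 k) + x.2 * q.2 : ℝ) : ℂ)) * (pKer a b t₀ x : ℂ) =
      (Complex.exp (-(2 * (π : ℂ) * Complex.I) * ((inner ℝ x.1 q.1 : ℝ) : ℂ)) * (gaussKer a x.1 : ℂ)) *
      (Complex.exp (-(2 * (π : ℂ) * Complex.I) * ((t₀ * q.2 : ℝ) : ℂ)) *
      (Complex.exp (-(2 * (π : ℂ) * Complex.I) * ((inner ℝ (x.2 - t₀) q.2 : ℝ) : ℂ)) *
        (gaussKer b (x.2 - t₀) : ℂ))) := by
    intro x
    have h3 : (inner ℝ x.1 q.1 : ℝ) = ∑ k, x.1 k * q.1 k := by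
      simp [PiLp.inner_apply, mul_comm]
    have h4 : (inner ℝ (x.2 - t₀) q.2 : ℝ) = (x.2 - t₀) * q.2 := by
      simp [mul_comm]
    rw [h3, h4]
    unfold pKer
    rw [show -(2 * (π : ℂ) * Complex.I) * (((∑ k, x.1 k * q.1 k) + x.2 * q.2 : ℝ) : ℂ) =
      -(2 * (π : ℂ) * Complex.I) * ((∑ k, x.1 k * q.1 k : ℝ) : ℂ) +
      (-(2 * (π : ℂ) * Complex.I) * ((t₀ * q.2 : ℝ) : ℂ) +
      -(2 * (π : ℂ) * Complex.I) * (((x.2 - t₀) * q.2 : ℝ) : ℂ)) by push_cast; ring,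
      Complex.exp_add, Complex.exp_add]
    push_cast
    ring
  simp_rw [e]
  rw [Measure.volume_eq_prod, integral_prod_mul
    (f := fun x : Rn n => Complex.exp (-(2 * (π : ℂ) * Complex.I) * ((inner ℝ x q.1 : ℝ) : ℂ)) *
      (gaussKer a x : ℂ))
    (g := fun t : ℝ => Complex.exp (-(2 * (π : ℂ) * Complex.I) * ((t₀ * q.2 : ℝ) : ℂ)) *
      (Complex.exp (-(2 * (π : ℂ) * Complex.I) * ((inner ℝ (t - t₀) q.2 : ℝ) : ℂ)) *
        (gaussKer b (t - t₀) : ℂ))), h1, integral_const_mul,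
    integral_sub_right_eq_self (fun t : ℝ => Complex.exp (-(2 * (π : ℂ) * Complex.I) *
      ((inner ℝ t q.2 : ℝ) : ℂ)) * (gaussKer b t : ℂ)) t₀, h2]
  congr 4
  rw [Real.norm_eq_abs, ← Complex.ofReal_pow, sq_abs, Complex.ofReal_pow]

/-- The constant in the `L¹` estimates for `pKer`. -/
def pConst (n : ℕ) : ℝ := 4 * (gaussConst n + gaussConst 1)

theorem pConst_pos (n : ℕ) : 0 < pConst n := by
  unfold pConst; linarith [one_le_gaussConst n, one_le_gaussConst 1]

theorem ofReal_add_le_pConst {x y : ℝ} (hx : 0 ≤ x) (hy : 0 ≤ y) :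
    ENNReal.ofReal (gaussConst (Module.finrank ℝ (Rn n)) * x) +
      ENNReal.ofReal (gaussConst (Module.finrank ℝ ℝ) * y) ≤ ENNReal.ofReal (pConst n * (x + y)) := by
  have h1 := one_le_gaussConst n
  have h2 := one_le_gaussConst 1
  rw [finrank_euclideanSpace_fin, Module.finrank_self,
    ← ENNReal.ofReal_add (by positivity) (by positivity)]
  refine ENNReal.ofReal_le_ofReal ?_
  unfold pConst
  nlinarith [mul_nonneg (zero_le_one.trans h1) hy, mul_nonneg (zero_le_one.trans h2) hx,
    mul_nonneg (zero_le_one.trans h1) hx, mul_nonneg (zero_le_one.trans h2) hy]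

theorem lintegral_enorm_pKer_sub_translate_le {a b : ℝ} (ha : 0 < a) (hb : 0 < b) (t₀ : ℝ)
    (y : Rn1 n) : ∫⁻ x : Rn1 n, ‖pKer a b t₀ (x - y) - pKer a b t₀ x‖ₑ ≤
      ENNReal.ofReal (pConst n * (‖y.1‖ / √a + |y.2| / √b)) := by
  have hm : ∀ s, Measurable fun t : ℝ => gaussKer b (t - s) := fun s =>
    (measurable_gaussKer_right b).comp (measurable_id.sub_const s)
  have h := lintegral_enorm_prod_sub_le (μ := (volume : Measure (Rn n))) (ν := (volume : Measure ℝ))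
    (f := gaussKer a) (g := fun x => gaussKer a (x - y.1)) (h := fun t => gaussKer b (t - t₀))
    (k := fun t => gaussKer b (t - t₀ - y.2)) (measurable_gaussKer_right a)
    ((measurable_gaussKer_right a).comp (measurable_id.sub_const y.1)) (hm t₀)
    (by simpa only [sub_sub] using hm (t₀ + y.2))
    (lintegral_enorm_gaussKer_translate hb t₀).le
    (by rw [lintegral_sub_right_eq_self (fun x : Rn n => ‖gaussKer a x‖ₑ) y.1,
      lintegral_enorm_gaussKer ha])
  have h1 := lintegral_enorm_gaussKer_sub_translate_le ha y.1
  have h2 : ∫⁻ t : ℝ, ‖gaussKer b (t - t₀) - gaussKer b (t - t₀ - y.2)‖ₑ ≤ _ :=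
    (lintegral_sub_right_eq_self (fun t : ℝ => ‖gaussKer b t - gaussKer b (t - y.2)‖ₑ) t₀).trans_le
      (lintegral_enorm_gaussKer_sub_translate_le hb y.2)
  refine le_trans (le_of_eq ?_) (h.trans ((add_le_add h1 h2).trans
    (ofReal_add_le_pConst (by positivity) (by positivity))))
  rw [Measure.volume_eq_prod]
  refine lintegral_congr fun x => ?_
  unfold pKer
  rw [enorm_sub_rev]
  simp [sub_right_comm]

theorem lintegral_enorm_pKer_sub_le {a b w : ℝ} (ha : 0 < a) (hb : 0 < b) (hw : 0 ≤ w) (t₀ : ℝ) :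
    ∫⁻ x : Rn1 n, ‖pKer a b 0 x - pKer (a + w) b t₀ x‖ₑ ≤
      ENNReal.ofReal (pConst n * (w / a + |t₀| / √b)) := by
  have h := lintegral_enorm_prod_sub_le (μ := (volume : Measure (Rn n))) (ν := (volume : Measure ℝ))
    (f := gaussKer a) (g := gaussKer (a + w)) (h := gaussKer b)
    (k := fun t => gaussKer b (t - t₀)) (measurable_gaussKer_right a)
    (measurable_gaussKer_right _) (measurable_gaussKer_right b)
    ((measurable_gaussKer_right b).comp (measurable_id.sub_const t₀))
    (lintegral_enorm_gaussKer hb).le (lintegral_enorm_gaussKer (by positivity)).le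
  refine le_trans (le_of_eq ?_) (h.trans ((add_le_add (lintegral_enorm_gaussKer_sub_add_le ha hw)
    (lintegral_enorm_gaussKer_sub_translate_le hb t₀)).trans
    (ofReal_add_le_pConst (by positivity) (by positivity))))
  simp only [pKer, sub_zero]
  rfl

theorem setLIntegral_enorm_pKer_le {a b R : ℝ} (ha : 0 < a) (hb : 0 < b) (hR : 0 < R) (t₀ : ℝ) :
    ∫⁻ x in {x : Rn1 n | R ≤ ‖x.1‖ ∨ R ^ 2 ≤ |x.2|}, ‖pKer a b t₀ x‖ₑ ≤
      ENNReal.ofReal (pConst n * (a / R ^ 2 + (b + t₀ ^ 2) / R ^ 4)) := by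
  have hma : Measurable fun x : Rn n => ‖gaussKer a x‖ₑ := (measurable_gaussKer_right a).enorm
  have hmb : Measurable fun t : ℝ => ‖gaussKer b (t - t₀)‖ₑ :=
    ((measurable_gaussKer_right b).comp (measurable_id.sub_const t₀)).enorm
  have hset : {x : Rn1 n | R ≤ ‖x.1‖ ∨ R ^ 2 ≤ |x.2|} =
      ({x : Rn n | R ≤ ‖x‖} ×ˢ Set.univ) ∪ (Set.univ ×ˢ {t : ℝ | R ^ 2 ≤ ‖t‖}) := by
    ext x; simp
  have h1 : ∫⁻ x in ({x : Rn n | R ≤ ‖x‖} ×ˢ (Set.univ : Set ℝ)), ‖pKer a b t₀ x‖ₑ ≤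
      ENNReal.ofReal (gaussConst (Module.finrank ℝ (Rn n)) * (a / R ^ 2)) := by
    simp only [pKer, enorm_mul]
    rw [Measure.volume_eq_prod, ← Measure.prod_restrict, Measure.restrict_univ,
      lintegral_prod_mul hma.aemeasurable hmb.aemeasurable,
      lintegral_enorm_gaussKer_translate hb, mul_one]
    simpa using setLIntegral_enorm_gaussKer_le (V := Rn n) ha hR 0
  have h2 : ∫⁻ x in ((Set.univ : Set (Rn n)) ×ˢ {t : ℝ | R ^ 2 ≤ ‖t‖}), ‖pKer a b t₀ x‖ₑ ≤
      ENNReal.ofReal (gaussConst (Module.finrank ℝ ℝ) * ((b + t₀ ^ 2) / R ^ 4)) := by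
    simp only [pKer, enorm_mul]
    rw [Measure.volume_eq_prod, ← Measure.prod_restrict, Measure.restrict_univ,
      lintegral_prod_mul hma.aemeasurable hmb.aemeasurable,
      lintegral_enorm_gaussKer ha, one_mul]
    refine (setLIntegral_enorm_gaussKer_le hb (by positivity) t₀).trans_eq ?_
    rw [Real.norm_eq_abs, sq_abs]
    ring_nf
  rw [hset]
  exact (lintegral_union_le _ _ _).trans ((add_le_add h1 h2).trans
    (ofReal_add_le_pConst (by positivity) (by positivity)))

end ParabolicGauss

section Superposition

variable {n : ℕ} {Ω : Type*} [MeasurableSpace Ω] {μ : Measure Ω}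
  {Φ : Ω → Rn1 n → ℂ}

theorem integrable_exp_mul_superposition (hΦ : Integrable (Function.uncurry Φ) (μ.prod volume))
    (q : Rn1 n) : Integrable (Function.uncurry fun (ω : Ω) (x : Rn1 n) =>
      Complex.exp (-(2 * (π : ℂ) * Complex.I) * (((∑ k, x.1 k * q.1 k) + x.2 * q.2 : ℝ) : ℂ)) *
        Φ ω x) (μ.prod volume) := by
  have hc : Continuous fun x : Rn1 n => Complex.exp (-(2 * (π : ℂ) * Complex.I) *
      (((∑ k, x.1 k * q.1 k) + x.2 * q.2 : ℝ) : ℂ)) := by fun_prop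
  refine hΦ.bdd_mul (c := 1) (hc.measurable.comp measurable_snd).aestronglyMeasurable
    (Filter.Eventually.of_forall fun z => ?_)
  rw [neg_mul, Complex.exp_neg, norm_inv, norm_exp_two_pi_I_mul, inv_one]

theorem integrable_FT1_superposition (hΦ : Integrable (Function.uncurry Φ) (μ.prod volume))
    (q : Rn1 n) : Integrable (fun ω => FT1 (Φ ω) q) μ :=
  (integrable_exp_mul_superposition hΦ q).integral_prod_left

variable [SFinite μ]

theorem measurable_superposition (hm : Measurable (Function.uncurry Φ)) :
    Measurable fun x => ∫ ω, Φ ω x ∂μ :=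
  (hm.stronglyMeasurable.integral_prod_left (f := Φ)).measurable

theorem integrable_superposition (hΦ : Integrable (Function.uncurry Φ) (μ.prod volume)) :
    Integrable fun x => ∫ ω, Φ ω x ∂μ :=
  hΦ.integral_prod_right

theorem FT1_superposition (hΦ : Integrable (Function.uncurry Φ) (μ.prod volume)) (q : Rn1 n) :
    FT1 (fun x => ∫ ω, Φ ω x ∂μ) q = ∫ ω, FT1 (Φ ω) q ∂μ := by
  unfold FT1
  simp_rw [← integral_const_mul]
  exact (integral_integral_swap (integrable_exp_mul_superposition hΦ q)).symm

theorem setLIntegral_superposition_le (hm : Measurable (Function.uncurry Φ))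
    (hΦ : Integrable (Function.uncurry Φ) (μ.prod volume)) (S : Set (Rn1 n)) (y : Rn1 n) :
    ∫⁻ x in S, ‖(∫ ω, Φ ω (x - y) ∂μ) - ∫ ω, Φ ω x ∂μ‖ₑ ≤
      ∫⁻ ω, (∫⁻ x in S, ‖Φ ω (x - y) - Φ ω x‖ₑ) ∂μ := by
  have h1 : ∀ᵐ x : Rn1 n, Integrable (fun ω => Φ ω x) μ := hΦ.prod_left_ae
  have h2 : ∀ᵐ x : Rn1 n, Integrable (fun ω => Φ ω (x - y)) μ :=
    (measurePreserving_sub_right volume y).quasiMeasurePreserving.ae h1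
  have hm' : Measurable fun z : Ω × Rn1 n => ‖Φ z.1 (z.2 - y) - Φ z.1 z.2‖ₑ :=
    ((hm.comp (measurable_fst.prodMk (measurable_snd.sub_const y))).sub hm).enorm
  rw [lintegral_lintegral_swap hm'.aemeasurable]
  refine lintegral_mono_ae (ae_restrict_of_ae ?_)
  filter_upwards [h1, h2] with x hx hx'
  rw [← integral_sub hx' hx]
  exact enorm_integral_le_lintegral_enorm _

end Superposition

section Bracket

variable {n : ℕ}

/-- The kernel with Fourier transform `exp (-a‖ξ‖² - bτ²) (1 - exp (-u (1 + 4π²‖ξ‖² + iτ)))`. -/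
def bKer (a b u : ℝ) (x : Rn1 n) : ℝ :=
  pKer a b 0 x - Real.exp (-u) * pKer (a + 4 * π ^ 2 * u) b (u / (2 * π)) x

theorem FT1_bKer {a b u : ℝ} (ha : 0 < a) (hb : 0 < b) (hu : 0 ≤ u) (q : Rn1 n) :
    FT1 (fun x => (bKer a b u x : ℂ)) q =
      Complex.exp (-(a : ℂ) * (‖q.1‖ : ℂ) ^ 2) * Complex.exp (-(b : ℂ) * (q.2 : ℂ) ^ 2) *
        (1 - Complex.exp (-(u : ℂ) *
          (1 + 4 * (π : ℂ) ^ 2 * (‖q.1‖ : ℂ) ^ 2 + Complex.I * (q.2 : ℂ)))) := by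
  have hau : 0 < a + 4 * π ^ 2 * u := by positivity
  have h1 := FT1_pKer ha hb 0 q
  have h2 := FT1_pKer hau hb (u / (2 * π)) q
  have hπ : (π : ℂ) ≠ 0 := by exact_mod_cast Real.pi_ne_zero
  have hc : Continuous fun x : Rn1 n => Complex.exp (-(2 * (π : ℂ) * Complex.I) *
      (((∑ k, x.1 k * q.1 k) + x.2 * q.2 : ℝ) : ℂ)) := by fun_prop
  have hi : ∀ {a' t : ℝ}, 0 < a' → Integrable fun x : Rn1 n => Complex.exp
      (-(2 * (π : ℂ) * Complex.I) * (((∑ k, x.1 k * q.1 k) + x.2 * q.2 : ℝ) : ℂ)) *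
        (pKer a' b t x : ℂ) := fun {a' t} ha' => by
    refine (integrable_pKer ha' hb t).ofReal.bdd_mul (c := 1) hc.aestronglyMeasurable
      (Filter.Eventually.of_forall fun z => ?_)
    rw [neg_mul, Complex.exp_neg, norm_inv, norm_exp_two_pi_I_mul, inv_one]
  have e : FT1 (fun x => (bKer a b u x : ℂ)) q = FT1 (fun x => (pKer a b 0 x : ℂ)) q -
      Complex.exp (-(u : ℂ)) * FT1 (fun x => (pKer (a + 4 * π ^ 2 * u) b (u / (2 * π)) x : ℂ)) q := by
    unfold FT1
    rw [← integral_const_mul, ← integral_sub (hi ha) ((hi hau).const_mul _)]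
    refine integral_congr_ae (Filter.Eventually.of_forall fun x => ?_)
    simp only [bKer]
    push_cast
    ring
  rw [e, h1, h2, mul_sub, mul_one]
  congr 1
  · simp
  · rw [← Complex.exp_add, ← Complex.exp_add, ← Complex.exp_add, ← Complex.exp_add,
      ← Complex.exp_add]
    congr 1
    push_cast
    field_simp
    ring

theorem bKer_eq (a b u : ℝ) (x : Rn1 n) : bKer a b u x = (1 - Real.exp (-u)) * pKer a b 0 x +
    Real.exp (-u) * (pKer a b 0 x - pKer (a + 4 * π ^ 2 * u) b (u / (2 * π)) x) := by
  unfold bKer; ring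

theorem enorm_one_sub_exp_neg_le {u : ℝ} (hu : 0 ≤ u) :
    ‖1 - Real.exp (-u)‖ₑ ≤ ENNReal.ofReal (min 1 u) := by
  have h1 : Real.exp (-u) ≤ 1 := Real.exp_le_one_iff.2 (by linarith)
  rw [Real.enorm_of_nonneg (by linarith)]
  refine ENNReal.ofReal_le_ofReal (le_min ?_ ?_)
  · linarith [Real.exp_pos (-u)]
  · linarith [Real.add_one_le_exp (-u)]

theorem enorm_exp_neg_le_one {u : ℝ} (hu : 0 ≤ u) : ‖Real.exp (-u)‖ₑ ≤ 1 := by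
  rw [Real.enorm_of_nonneg (Real.exp_pos _).le]
  exact ENNReal.ofReal_le_one.2 (Real.exp_le_one_iff.2 (by linarith))

/-- The difference of the two Gaussians in `bKer`. -/
def dKer (a b u : ℝ) (x : Rn1 n) : ℝ :=
  pKer a b 0 x - pKer (a + 4 * π ^ 2 * u) b (u / (2 * π)) x

theorem measurable_dKer (a b u : ℝ) : Measurable (dKer a b u : Rn1 n → ℝ) :=
  (measurable_pKer a b 0).sub (measurable_pKer _ _ _)

theorem lintegral_enorm_dKer_le {a b u : ℝ} (ha : 0 < a) (hb : 0 < b) (hu : 0 ≤ u) :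
    ∫⁻ x : Rn1 n, ‖dKer a b u x‖ₑ ≤
      ENNReal.ofReal (40 * pConst n * min 1 (u / a + u / √b)) := by
  have hp := pConst_pos n
  have hp1 : 1 ≤ pConst n := by
    unfold pConst; linarith [one_le_gaussConst n, one_le_gaussConst 1]
  have hau : 0 < a + 4 * π ^ 2 * u := by positivity
  rw [mul_min_of_nonneg _ _ (by positivity), ENNReal.ofReal_min]
  refine le_min ?_ ?_
  · calc ∫⁻ x : Rn1 n, ‖dKer a b u x‖ₑ
        ≤ ∫⁻ x : Rn1 n, (‖pKer a b 0 x‖ₑ + ‖pKer (a + 4 * π ^ 2 * u) b (u / (2 * π)) x‖ₑ) :=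
          lintegral_mono fun x => enorm_sub_le
      _ = 2 := by
          rw [lintegral_add_left (measurable_pKer _ _ _).enorm, lintegral_enorm_pKer ha hb,
            lintegral_enorm_pKer hau hb, one_add_one_eq_two]
      _ = ENNReal.ofReal 2 := by simp
      _ ≤ _ := ENNReal.ofReal_le_ofReal (by linarith)
  · refine (lintegral_enorm_pKer_sub_le ha hb (by positivity) _).trans
      (ENNReal.ofReal_le_ofReal ?_)
    have h1 : π ^ 2 ≤ 10 := by nlinarith [Real.pi_lt_d2, Real.pi_gt_three]
    have h2 : |u / (2 * π)| ≤ u := by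
      rw [abs_of_nonneg (by positivity), div_le_iff₀ (by positivity)]
      nlinarith [Real.pi_gt_three]
    have h3 : 0 ≤ u / √b := by positivity
    calc pConst n * (4 * π ^ 2 * u / a + |u / (2 * π)| / √b)
        ≤ pConst n * (4 * 10 * u / a + u / √b) := by gcongr
      _ = pConst n * (40 * (u / a) + u / √b) := by ring
      _ ≤ pConst n * (40 * (u / a) + 40 * (u / √b)) := by gcongr; linarith
      _ = _ := by ring

theorem lintegral_enorm_bKer_le {a b u : ℝ} (ha : 0 < a) (hb : 0 < b) (hu : 0 ≤ u) :
    ∫⁻ x : Rn1 n, ‖bKer a b u x‖ₑ ≤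
      ENNReal.ofReal (40 * pConst n * (min 1 u + min 1 (u / a + u / √b))) := by
  have hp1 : 1 ≤ pConst n := by
    unfold pConst; linarith [one_le_gaussConst n, one_le_gaussConst 1]
  have hu1 : 0 ≤ min 1 u := le_min zero_le_one hu
  calc ∫⁻ x : Rn1 n, ‖bKer a b u x‖ₑ
      ≤ ∫⁻ x : Rn1 n, (ENNReal.ofReal (min 1 u) * ‖pKer a b 0 x‖ₑ + ‖dKer a b u x‖ₑ) := by
        refine lintegral_mono fun x => ?_
        rw [bKer_eq]
        refine (enorm_add_le _ _).trans ?_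
        rw [enorm_mul, enorm_mul]
        exact add_le_add (mul_le_mul_left (enorm_one_sub_exp_neg_le hu) _)
          (mul_le_of_le_one_left' (enorm_exp_neg_le_one hu))
    _ = ENNReal.ofReal (min 1 u) + ∫⁻ x : Rn1 n, ‖dKer a b u x‖ₑ := by
        rw [lintegral_add_left ((measurable_pKer _ _ _).enorm.const_mul _),
          lintegral_const_mul _ (measurable_pKer _ _ _).enorm, lintegral_enorm_pKer ha hb, mul_one]
    _ ≤ ENNReal.ofReal (min 1 u) + ENNReal.ofReal (40 * pConst n * min 1 (u / a + u / √b)) := by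
        gcongr; exact lintegral_enorm_dKer_le ha hb hu
    _ = ENNReal.ofReal (min 1 u + 40 * pConst n * min 1 (u / a + u / √b)) := by
        rw [ENNReal.ofReal_add hu1 (by positivity)]
    _ ≤ _ := by
        refine ENNReal.ofReal_le_ofReal ?_
        nlinarith

theorem setLIntegral_sub_le_two_mul {f : Rn1 n → ℝ} (hf : Measurable f) {S S' : Set (Rn1 n)}
    (hS' : MeasurableSet S') (y : Rn1 n) (h1 : S ⊆ S') (h2 : ∀ x ∈ S, x - y ∈ S') :
    ∫⁻ x in S, ‖f (x - y) - f x‖ₑ ≤ 2 * ∫⁻ x in S', ‖f x‖ₑ := by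
  calc ∫⁻ x in S, ‖f (x - y) - f x‖ₑ
      ≤ ∫⁻ x in S, (S'.indicator (fun z => ‖f z‖ₑ) (x - y) + S'.indicator (fun z => ‖f z‖ₑ) x) := by
        refine setLIntegral_mono ?_ fun x hx => ?_
        · have := (hf.enorm.indicator hS')
          exact (this.comp (measurable_id.sub_const y)).add this
        rw [Set.indicator_of_mem (h1 hx), Set.indicator_of_mem (h2 x hx)]
        exact enorm_sub_le
    _ ≤ ∫⁻ x, (S'.indicator (fun z => ‖f z‖ₑ) (x - y) + S'.indicator (fun z => ‖f z‖ₑ) x) :=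
        setLIntegral_le_lintegral _ _
    _ = _ := by
        rw [lintegral_add_right _ (hf.enorm.indicator hS'),
          lintegral_sub_right_eq_self (S'.indicator fun z => ‖f z‖ₑ) y, lintegral_indicator hS', two_mul]

theorem setLIntegral_dKer_sub_le {a b u R : ℝ} (ha : 0 < a) (hb : 0 < b) (hu : 0 ≤ u) (hR : 0 < R)
    {y : Rn1 n} (hy1 : ‖y.1‖ ≤ R) (hy2 : |y.2| ≤ R ^ 2) :
    ∫⁻ x in {x : Rn1 n | 2 * R ≤ ‖x.1‖ ∨ 2 * R ^ 2 ≤ |x.2|}, ‖dKer a b u (x - y) - dKer a b u x‖ₑ ≤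
      ENNReal.ofReal (100 * pConst n * min (min 1 (u / a + u / √b))
        (min (R / √a + R ^ 2 / √b) ((a + u) / R ^ 2 + (b + u ^ 2) / R ^ 4))) := by
  have hp := pConst_pos n
  have hau : 0 < a + 4 * π ^ 2 * u := by positivity
  have hsa : 0 < √a := Real.sqrt_pos.2 ha
  have hsb : 0 < √b := Real.sqrt_pos.2 hb
  rw [mul_min_of_nonneg _ _ (by positivity), ENNReal.ofReal_min,
    mul_min_of_nonneg (R / √a + R ^ 2 / √b) _ (by positivity), ENNReal.ofReal_min]
  refine le_min ?_ (le_min ?_ ?_)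
  · refine (setLIntegral_sub_le_two_mul (measurable_dKer a b u) MeasurableSet.univ y
      (Set.subset_univ _) (fun x _ => Set.mem_univ _)).trans ?_
    rw [Measure.restrict_univ]
    refine (mul_le_mul_right (lintegral_enorm_dKer_le ha hb hu) 2).trans ?_
    rw [show (2 : ℝ≥0∞) = ENNReal.ofReal 2 by simp, ← ENNReal.ofReal_mul zero_le_two]
    refine ENNReal.ofReal_le_ofReal ?_
    have : 0 ≤ pConst n * min 1 (u / a + u / √b) := by positivity
    linarith
  · have h1 := lintegral_enorm_pKer_sub_translate_le ha hb 0 y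
    have h2 := lintegral_enorm_pKer_sub_translate_le hau hb (u / (2 * π)) y
    have hle : ‖y.1‖ / √(a + 4 * π ^ 2 * u) ≤ R / √a := by
      gcongr; nlinarith [mul_nonneg (sq_nonneg π) hu]
    have hm : Measurable fun x : Rn1 n => ‖pKer a b 0 (x - y) - pKer a b 0 x‖ₑ :=
      (((measurable_pKer _ _ _).comp (measurable_id.sub_const y)).sub (measurable_pKer _ _ _)).enorm
    calc _ ≤ ∫⁻ x : Rn1 n, ‖dKer a b u (x - y) - dKer a b u x‖ₑ := setLIntegral_le_lintegral _ _
      _ ≤ ∫⁻ x : Rn1 n, (‖pKer a b 0 (x - y) - pKer a b 0 x‖ₑ +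
          ‖pKer (a + 4 * π ^ 2 * u) b (u / (2 * π)) (x - y) -
            pKer (a + 4 * π ^ 2 * u) b (u / (2 * π)) x‖ₑ) := by
          refine lintegral_mono fun x => ?_
          unfold dKer
          rw [sub_sub_sub_comm]
          exact enorm_sub_le
      _ ≤ ENNReal.ofReal (pConst n * (R / √a + R ^ 2 / √b)) +
          ENNReal.ofReal (pConst n * (R / √a + R ^ 2 / √b)) := by
          rw [lintegral_add_left hm]
          refine add_le_add (h1.trans (ENNReal.ofReal_le_ofReal ?_))
            (h2.trans (ENNReal.ofReal_le_ofReal ?_))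
          · gcongr
          · gcongr
      _ ≤ _ := by
          rw [← ENNReal.ofReal_add (by positivity) (by positivity)]
          refine ENNReal.ofReal_le_ofReal ?_
          have : 0 ≤ pConst n * (R / √a + R ^ 2 / √b) := by positivity
          linarith
  · have hS : MeasurableSet {x : Rn1 n | R ≤ ‖x.1‖ ∨ R ^ 2 ≤ |x.2|} :=
      ((isClosed_le continuous_const continuous_fst.norm).union
        (isClosed_le continuous_const continuous_snd.abs)).measurableSet
    refine (setLIntegral_sub_le_two_mul (measurable_dKer a b u) hS y ?_ ?_).trans ?_
    · rintro x (hx | hx)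
      · left; linarith
      · right; nlinarith
    · rintro x (hx | hx)
      · left
        have := norm_sub_norm_le x.1 y.1
        simp only [Prod.fst_sub]
        linarith
      · right
        have := abs_sub_abs_le_abs_sub x.2 y.2
        simp only [Prod.snd_sub]
        linarith
    have h1 := setLIntegral_enorm_pKer_le (n := n) ha hb hR 0
    have h2 := setLIntegral_enorm_pKer_le (n := n) hau hb hR (u / (2 * π))
    have e1 : π ^ 2 ≤ 10 := by nlinarith [Real.pi_lt_d2, Real.pi_gt_three]
    have e2 : u / (2 * π) ≤ u := by
      rw [div_le_iff₀ (by positivity)]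
      nlinarith [Real.pi_gt_three]
    calc 2 * ∫⁻ x in {x : Rn1 n | R ≤ ‖x.1‖ ∨ R ^ 2 ≤ |x.2|}, ‖dKer a b u x‖ₑ
        ≤ 2 * ∫⁻ x in {x : Rn1 n | R ≤ ‖x.1‖ ∨ R ^ 2 ≤ |x.2|},
          (‖pKer a b 0 x‖ₑ + ‖pKer (a + 4 * π ^ 2 * u) b (u / (2 * π)) x‖ₑ) := by
          gcongr; exact enorm_sub_le
      _ ≤ 2 * (ENNReal.ofReal (pConst n * ((a + u) / R ^ 2 + (b + u ^ 2) / R ^ 4)) +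
          ENNReal.ofReal (40 * pConst n * ((a + u) / R ^ 2 + (b + u ^ 2) / R ^ 4))) := by
          rw [lintegral_add_left (measurable_pKer _ _ _).enorm]
          gcongr
          · refine h1.trans (ENNReal.ofReal_le_ofReal ?_)
            gcongr
            · linarith
          · refine h2.trans (ENNReal.ofReal_le_ofReal ?_)
            have e3 : (u / (2 * π)) ^ 2 ≤ u ^ 2 := by gcongr
            calc pConst n * ((a + 4 * π ^ 2 * u) / R ^ 2 + (b + (u / (2 * π)) ^ 2) / R ^ 4)
                ≤ pConst n * ((40 * a + 4 * 10 * u) / R ^ 2 + (40 * b + 40 * u ^ 2) / R ^ 4) := by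
                  gcongr <;> nlinarith
              _ = _ := by ring
      _ ≤ _ := by
          rw [show (2 : ℝ≥0∞) = ENNReal.ofReal 2 by simp,
            ← ENNReal.ofReal_add (by positivity) (by positivity), ← ENNReal.ofReal_mul zero_le_two]
          refine ENNReal.ofReal_le_ofReal ?_
          have : 0 ≤ pConst n * ((a + u) / R ^ 2 + (b + u ^ 2) / R ^ 4) := by positivity
          linarith

theorem setLIntegral_bKer_sub_le {a b u R : ℝ} (ha : 0 < a) (hb : 0 < b) (hu : 0 ≤ u) (hR : 0 < R)
    {y : Rn1 n} (hy1 : ‖y.1‖ ≤ R) (hy2 : |y.2| ≤ R ^ 2) :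
    ∫⁻ x in {x : Rn1 n | 2 * R ≤ ‖x.1‖ ∨ 2 * R ^ 2 ≤ |x.2|}, ‖bKer a b u (x - y) - bKer a b u x‖ₑ ≤
      ENNReal.ofReal (100 * pConst n * (min 1 u + min (min 1 (u / a + u / √b))
        (min (R / √a + R ^ 2 / √b) ((a + u) / R ^ 2 + (b + u ^ 2) / R ^ 4)))) := by
  have hp1 : 1 ≤ pConst n := by
    unfold pConst; linarith [one_le_gaussConst n, one_le_gaussConst 1]
  have hu1 : 0 ≤ min 1 u := le_min zero_le_one hu
  set S := {x : Rn1 n | 2 * R ≤ ‖x.1‖ ∨ 2 * R ^ 2 ≤ |x.2|}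
  have hG := setLIntegral_sub_le_two_mul (S := S) (measurable_pKer a b 0) MeasurableSet.univ y
    (Set.subset_univ _) (fun x _ => Set.mem_univ _)
  rw [Measure.restrict_univ, lintegral_enorm_pKer ha hb, mul_one] at hG
  have hD := setLIntegral_dKer_sub_le (n := n) ha hb hu hR hy1 hy2
  have hm : Measurable fun x : Rn1 n => ‖pKer a b 0 (x - y) - pKer a b 0 x‖ₑ :=
    (((measurable_pKer _ _ _).comp (measurable_id.sub_const y)).sub (measurable_pKer _ _ _)).enorm
  set m := min (min 1 (u / a + u / √b))
        (min (R / √a + R ^ 2 / √b) ((a + u) / R ^ 2 + (b + u ^ 2) / R ^ 4))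
  have hm0 : 0 ≤ m := by positivity
  calc ∫⁻ x in S, ‖bKer a b u (x - y) - bKer a b u x‖ₑ
      ≤ ∫⁻ x in S, (ENNReal.ofReal (min 1 u) * ‖pKer a b 0 (x - y) - pKer a b 0 x‖ₑ +
          ‖dKer a b u (x - y) - dKer a b u x‖ₑ) := by
        refine lintegral_mono fun x => ?_
        have e : bKer a b u (x - y) - bKer a b u x =
            (1 - Real.exp (-u)) * (pKer a b 0 (x - y) - pKer a b 0 x) +
            Real.exp (-u) * (dKer a b u (x - y) - dKer a b u x) := by
          simp only [bKer_eq, dKer]; ring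
        rw [e]
        refine (enorm_add_le _ _).trans ?_
        rw [enorm_mul, enorm_mul]
        exact add_le_add (mul_le_mul_left (enorm_one_sub_exp_neg_le hu) _)
          (mul_le_of_le_one_left' (enorm_exp_neg_le_one hu))
    _ = ENNReal.ofReal (min 1 u) * (∫⁻ x in S, ‖pKer a b 0 (x - y) - pKer a b 0 x‖ₑ) +
        ∫⁻ x in S, ‖dKer a b u (x - y) - dKer a b u x‖ₑ := by
        rw [lintegral_add_left (hm.const_mul _), lintegral_const_mul _ hm]
    _ ≤ ENNReal.ofReal (min 1 u) * 2 + ENNReal.ofReal (100 * pConst n * m) := by gcongr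
    _ = ENNReal.ofReal (min 1 u * 2 + 100 * pConst n * m) := by
        rw [ENNReal.ofReal_add (by positivity) (by positivity), ENNReal.ofReal_mul hu1]
        simp
    _ ≤ _ := by
        refine ENNReal.ofReal_le_ofReal ?_
        nlinarith

end Bracket

section Subordination

theorem integrableOn_exp_neg_sub_div_sq (c : ℝ) :
    IntegrableOn (fun y : ℝ => Real.exp (-(y - c / y) ^ 2)) (Set.Ioi 0) := by
  have h : Integrable fun y : ℝ => Real.exp (2 * c) * Real.exp (-1 * y ^ 2) :=
    (integrable_exp_neg_mul_sq one_pos).const_mul _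
  refine h.integrableOn.mono' (by fun_prop) ?_
  refine (ae_restrict_iff' measurableSet_Ioi).2 (Filter.Eventually.of_forall fun y hy => ?_)
  have hy : 0 < y := hy
  rw [Real.norm_of_nonneg (Real.exp_pos _).le, ← Real.exp_add, Real.exp_le_exp]
  have : (y - c / y) ^ 2 = y ^ 2 - 2 * c + (c / y) ^ 2 := by field_simp; ring
  nlinarith [sq_nonneg (c / y)]

theorem integral_exp_neg_sub_div_sq {c : ℝ} (hc : 0 < c) :
    ∫ y in Set.Ioi 0, Real.exp (-(y - c / y) ^ 2) = √π / 2 := by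
  set f : ℝ → ℝ := fun y => Real.exp (-(y - c / y) ^ 2) with hf
  have hfi : IntegrableOn f (Set.Ioi 0) := integrableOn_exp_neg_sub_div_sq c
  have hd1 : ∀ y ∈ Set.Ioi (0 : ℝ), HasDerivWithinAt (fun y => c / y) (-c / y ^ 2) (Set.Ioi 0) y := by
    intro y hy
    have hy : y ≠ 0 := ne_of_gt hy
    have := ((hasDerivAt_inv hy).const_mul c).hasDerivWithinAt (s := Set.Ioi 0)
    rw [mul_neg, ← div_eq_mul_inv, ← neg_div] at this
    simpa only [div_eq_mul_inv] using this
  have hinj1 : Set.InjOn (fun y : ℝ => c / y) (Set.Ioi 0) := by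
    intro x hx y hy hxy
    have hx : 0 < x := hx
    have hy : 0 < y := hy
    simp only at hxy
    rw [div_eq_div_iff hx.ne' hy.ne'] at hxy
    exact (mul_left_cancel₀ hc.ne' hxy).symm
  have him1 : (fun y : ℝ => c / y) '' Set.Ioi 0 = Set.Ioi 0 := by
    ext x
    constructor
    · rintro ⟨y, hy, rfl⟩
      exact div_pos hc hy
    · intro hx
      have hx : 0 < x := hx
      exact ⟨c / x, div_pos hc hx, by field_simp⟩
  have hfc : ∀ y ∈ Set.Ioi (0 : ℝ), |-c / y ^ 2| • f (c / y) = c / y ^ 2 * f y := by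
    intro y hy
    have hy : 0 < y := hy
    rw [neg_div, abs_neg, abs_of_pos (by positivity), smul_eq_mul]
    simp only [hf]
    rw [show c / y - c / (c / y) = -(y - c / y) by field_simp; ring, neg_sq]
  have h1 : ∫ y in Set.Ioi 0, f y = ∫ y in Set.Ioi 0, c / y ^ 2 * f y := by
    have := integral_image_eq_integral_abs_deriv_smul measurableSet_Ioi hd1 hinj1 f
    rw [him1, setIntegral_congr_fun measurableSet_Ioi hfc] at this
    exact this
  have h1i : IntegrableOn (fun y => c / y ^ 2 * f y) (Set.Ioi 0) := by
    have := (integrableOn_image_iff_integrableOn_abs_deriv_smul measurableSet_Ioi hd1 hinj1 f).1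
      (by rwa [him1])
    exact this.congr_fun hfc measurableSet_Ioi
  have hd2 : ∀ y ∈ Set.Ioi (0 : ℝ),
      HasDerivWithinAt (fun y => y - c / y) (1 + c / y ^ 2) (Set.Ioi 0) y := by
    intro y hy
    convert! (hasDerivWithinAt_id y _).sub (hd1 y hy) using 1
    ring
  have hinj2 : Set.InjOn (fun y : ℝ => y - c / y) (Set.Ioi 0) := by
    have : StrictMonoOn (fun y : ℝ => y - c / y) (Set.Ioi 0) := by
      intro x hx y hy hxy
      have hx : 0 < x := hx
      have : c / y < c / x := div_lt_div_of_pos_left hc hx hxy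
      simp only
      linarith
    exact this.injOn
  have him2 : (fun y : ℝ => y - c / y) '' Set.Ioi 0 = Set.univ := by
    refine Set.eq_univ_of_forall fun w => ?_
    have h4 : 0 < w ^ 2 + 4 * c := by positivity
    have hs : |w| < √(w ^ 2 + 4 * c) := by
      rw [← Real.sqrt_sq_eq_abs]
      exact Real.sqrt_lt_sqrt (sq_nonneg w) (by linarith)
    have hp : 0 < w + √(w ^ 2 + 4 * c) := by linarith [neg_abs_le w]
    refine ⟨(w + √(w ^ 2 + 4 * c)) / 2, Set.mem_Ioi.2 (by positivity), ?_⟩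
    have := Real.sq_sqrt h4.le
    simp only
    field_simp
    linear_combination this
  have h2 := integral_image_eq_integral_abs_deriv_smul measurableSet_Ioi hd2 hinj2
    (fun w => Real.exp (-1 * w ^ 2))
  rw [him2, Measure.restrict_univ, integral_gaussian, div_one] at h2
  have h3 : ∀ y ∈ Set.Ioi (0 : ℝ), |1 + c / y ^ 2| • Real.exp (-1 * (y - c / y) ^ 2) =
      f y + c / y ^ 2 * f y := by
    intro y hy
    have hy : 0 < y := hy
    rw [abs_of_pos (by positivity), smul_eq_mul, hf]
    simp only [neg_one_mul]
    ring
  rw [setIntegral_congr_fun measurableSet_Ioi h3, integral_add hfi h1i, ← h1] at h2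
  linarith

/-- The half-Gaussian density on `(0, ∞)`. -/
def halfGauss (y : ℝ) : ℝ := 2 / √π * Real.exp (-y ^ 2)

theorem halfGauss_nonneg (y : ℝ) : 0 ≤ halfGauss y := by unfold halfGauss; positivity

theorem integrableOn_halfGauss : IntegrableOn halfGauss (Set.Ioi 0) := by
  have h := (integrable_exp_neg_mul_sq one_pos).const_mul (2 / √π)
  simp only [neg_one_mul] at h
  exact h.integrableOn

theorem continuous_halfGauss : Continuous halfGauss := by unfold halfGauss; fun_prop

theorem integral_halfGauss_mul_exp {t : ℝ} (ht : 0 ≤ t) :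
    ∫ y in Set.Ioi 0, halfGauss y * Real.exp (-(t ^ 2 / (4 * y ^ 2))) = Real.exp (-t) := by
  have hπ : 0 < √π := Real.sqrt_pos.2 Real.pi_pos
  rcases ht.eq_or_lt with rfl | ht
  · have h := integral_gaussian_Ioi 1
    simp only [neg_one_mul, div_one] at h
    simp only [halfGauss, ne_eq, OfNat.ofNat_ne_zero, not_false_eq_true, zero_pow, zero_div, neg_zero,
      Real.exp_zero, mul_one]
    rw [integral_const_mul, h]
    field_simp
  · have h := integral_exp_neg_sub_div_sq (c := t / 2) (by positivity)
    have e : ∀ y ∈ Set.Ioi (0 : ℝ), halfGauss y * Real.exp (-(t ^ 2 / (4 * y ^ 2))) =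
        2 / √π * Real.exp (-t) * Real.exp (-(y - t / 2 / y) ^ 2) := by
      intro y hy
      have hy : 0 < y := hy
      unfold halfGauss
      rw [mul_assoc, mul_assoc, ← Real.exp_add, ← Real.exp_add]
      congr 2
      field_simp
      ring
    rw [setIntegral_congr_fun measurableSet_Ioi e, integral_const_mul, h]
    field_simp

end Subordination

section SquareRoot

theorem norm_one_sub_exp_neg_le {w : ℂ} (hw : 0 ≤ w.re) :
    ‖1 - Complex.exp (-w)‖ ≤ 2 * min 1 ‖w‖ := by
  have h2 : ‖1 - Complex.exp (-w)‖ ≤ 2 := by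
    refine (norm_sub_le _ _).trans ?_
    rw [norm_one, Complex.norm_exp]
    have : Real.exp ((-w).re) ≤ 1 := Real.exp_le_one_iff.2 (by simpa using hw)
    linarith
  rcases le_total 1 ‖w‖ with h | h
  · rw [min_eq_left h]; linarith
  · rw [min_eq_right h, norm_sub_rev]
    simpa using Complex.norm_exp_sub_one_le (x := -w) (by simpa using h)

theorem mul_cpow_half {z : ℂ} (hz : 0 < z.re) :
    z * ((π : ℂ) / z) ^ ((1 : ℂ) / 2) = (√π : ℂ) * z ^ ((1 : ℂ) / 2) := by
  have hz0 : z ≠ 0 := fun h => by simp [h] at hz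
  have hpi : (π : ℂ) ≠ 0 := by exact_mod_cast Real.pi_ne_zero
  have harg : z.arg ≠ π := by
    have := Complex.abs_arg_lt_pi_div_two_iff.2 (Or.inl hz)
    intro h
    rw [h, abs_of_pos Real.pi_pos] at this
    linarith [Real.pi_pos]
  have h1 : ((π : ℂ) / z) ^ ((1 : ℂ) / 2) = (√π : ℂ) * (z ^ ((1 : ℂ) / 2))⁻¹ := by
    rw [div_eq_mul_inv, ← Complex.inv_cpow _ _ harg,
      Complex.cpow_def_of_ne_zero (mul_ne_zero hpi (inv_ne_zero hz0)),
      Complex.log_ofReal_mul Real.pi_pos (inv_ne_zero hz0), add_mul, Complex.exp_add,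
      ← Complex.cpow_def_of_ne_zero (inv_ne_zero hz0), Complex.ofReal_log Real.pi_pos.le,
      ← Complex.cpow_def_of_ne_zero hpi, Real.sqrt_eq_rpow, Complex.ofReal_cpow Real.pi_pos.le]
    norm_num
  have h2 : z ^ ((1 : ℂ) / 2) * z ^ ((1 : ℂ) / 2) = z := by
    rw [← Complex.cpow_add _ _ hz0]; norm_num
  have h3 : z ^ ((1 : ℂ) / 2) ≠ 0 := by
    intro h; rw [h, zero_mul] at h2; exact hz0 h2.symm
  rw [h1]
  nth_rewrite 1 [← h2]
  field_simp

theorem integrableOn_inv_sq_mul_one_sub_exp {z : ℂ} (hz : 0 < z.re) :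
    IntegrableOn (fun v : ℝ => (((v ^ 2)⁻¹ : ℝ) : ℂ) * (1 - Complex.exp (-((v ^ 2 : ℝ) : ℂ) * z)))
      (Set.Ioi 0) := by
  have hb : ∀ v ∈ Set.Ioi (0 : ℝ),
      ‖(((v ^ 2)⁻¹ : ℝ) : ℂ) * (1 - Complex.exp (-((v ^ 2 : ℝ) : ℂ) * z))‖ ≤
        (v ^ 2)⁻¹ * (2 * min 1 (v ^ 2 * ‖z‖)) := by
    intro v hv
    have hv : 0 < v := hv
    rw [norm_mul, Complex.norm_real, Real.norm_of_nonneg (by positivity)]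
    gcongr
    rw [neg_mul]
    refine (norm_one_sub_exp_neg_le ?_).trans_eq ?_
    · rw [Complex.re_ofReal_mul]; positivity
    · rw [norm_mul, Complex.norm_real, Real.norm_of_nonneg (by positivity)]
  have hm : Measurable fun v : ℝ =>
      (((v ^ 2)⁻¹ : ℝ) : ℂ) * (1 - Complex.exp (-((v ^ 2 : ℝ) : ℂ) * z)) := by fun_prop
  rw [← Set.Ioc_union_Ioi_eq_Ioi zero_le_one]
  refine IntegrableOn.union ?_ ?_
  · refine Measure.integrableOn_of_bounded (M := 2 * ‖z‖) (by simp) hm.aestronglyMeasurable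
      ((ae_restrict_iff' measurableSet_Ioc).2 (Filter.Eventually.of_forall fun v hv => ?_))
    have hv0 : 0 < v := hv.1
    refine (hb v hv.1).trans ?_
    calc (v ^ 2)⁻¹ * (2 * min 1 (v ^ 2 * ‖z‖)) ≤ (v ^ 2)⁻¹ * (2 * (v ^ 2 * ‖z‖)) := by
          gcongr; exact min_le_right _ _
      _ = 2 * ‖z‖ := by field_simp
  · have h := (integrableOn_Ioi_rpow_of_lt (a := -2) (by norm_num) one_pos).const_mul 2
    refine Integrable.mono' h hm.aestronglyMeasurable
      ((ae_restrict_iff' measurableSet_Ioi).2 (Filter.Eventually.of_forall fun v hv => ?_))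
    have hv0 : 0 < v := zero_lt_one.trans hv
    refine (hb v hv0).trans ?_
    rw [Real.rpow_neg hv0.le, Real.rpow_ofNat]
    calc (v ^ 2)⁻¹ * (2 * min 1 (v ^ 2 * ‖z‖)) ≤ (v ^ 2)⁻¹ * (2 * 1) := by
          gcongr; exact min_le_left _ _
      _ = _ := by ring

theorem integral_inv_sq_mul_one_sub_exp {z : ℂ} (hz : 0 < z.re) :
    ∫ v in Set.Ioi (0 : ℝ), (((v ^ 2)⁻¹ : ℝ) : ℂ) * (1 - Complex.exp (-((v ^ 2 : ℝ) : ℂ) * z)) =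
      (√π : ℂ) * z ^ ((1 : ℂ) / 2) := by
  have hi := integrableOn_inv_sq_mul_one_sub_exp hz
  have hg : IntegrableOn (fun v : ℝ => 2 * z * Complex.exp (-z * (v : ℂ) ^ 2)) (Set.Ioi 0) :=
    ((integrable_cexp_neg_mul_sq hz).const_mul _).integrableOn
  have hF0 : ∀ v : ℝ, 0 < v → ‖-(((v : ℂ))⁻¹ * (1 - Complex.exp (-((v ^ 2 : ℝ) : ℂ) * z)))‖ ≤
      v⁻¹ * (2 * min 1 (v ^ 2 * ‖z‖)) := by
    intro v hv
    rw [norm_neg, norm_mul, norm_inv, Complex.norm_real, Real.norm_of_nonneg hv.le]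
    gcongr
    rw [neg_mul]
    refine (norm_one_sub_exp_neg_le ?_).trans_eq ?_
    · rw [Complex.re_ofReal_mul]; positivity
    · rw [norm_mul, Complex.norm_real, Real.norm_of_nonneg (by positivity)]
  have key := integral_Ioi_of_hasDerivAt_of_tendsto (a := 0) (m := 0)
    (f := fun v : ℝ => -(((v : ℂ))⁻¹ * (1 - Complex.exp (-((v ^ 2 : ℝ) : ℂ) * z))))
    (f' := fun v : ℝ => (((v ^ 2)⁻¹ : ℝ) : ℂ) * (1 - Complex.exp (-((v ^ 2 : ℝ) : ℂ) * z)) -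
      2 * z * Complex.exp (-z * (v : ℂ) ^ 2)) ?_ ?_ (hi.sub hg) ?_
  · rw [integral_sub hi hg, integral_const_mul, integral_gaussian_complex_Ioi hz] at key
    simp only [Complex.ofReal_zero, inv_zero, zero_mul, neg_zero, sub_zero] at key
    rw [← mul_cpow_half hz]
    linear_combination key
  · rw [← continuousWithinAt_Ioi_iff_Ici]
    unfold ContinuousWithinAt
    simp only [Complex.ofReal_zero, inv_zero, zero_mul, neg_zero]
    refine squeeze_zero_norm' (a := fun v : ℝ => 2 * ‖z‖ * v) ?_ ?_
    · filter_upwards [self_mem_nhdsWithin] with v hv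
      have hv : 0 < v := hv
      refine (hF0 v hv).trans ?_
      calc v⁻¹ * (2 * min 1 (v ^ 2 * ‖z‖)) ≤ v⁻¹ * (2 * (v ^ 2 * ‖z‖)) := by
            gcongr; exact min_le_right _ _
        _ = 2 * ‖z‖ * v := by field_simp
    · have : Filter.Tendsto (fun v : ℝ => 2 * ‖z‖ * v) (nhds 0) (nhds (2 * ‖z‖ * 0)) :=
        (continuous_const.mul continuous_id).tendsto 0
      rw [mul_zero] at this
      exact this.mono_left nhdsWithin_le_nhds
  · intro v hv
    have hv : v ≠ 0 := ne_of_gt hv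
    have hv' : (v : ℂ) ≠ 0 := by exact_mod_cast hv
    have h1 : HasDerivAt (fun v : ℝ => (v : ℂ)) 1 v := Complex.ofRealCLM.hasDerivAt
    have h2 := (h1.fun_inv hv').mul (((h1.pow 2).neg.mul_const z).cexp.const_sub 1)
    have h3 := h2.neg
    convert! h3 using 1
    · ext w; simp
    · push_cast
      simp only [Pi.pow_apply, Pi.neg_apply]
      field_simp
      ring
  · refine squeeze_zero_norm' (a := fun v : ℝ => 2 * v⁻¹) ?_ ?_
    · filter_upwards [Filter.eventually_gt_atTop 0] with v hv
      refine (hF0 v hv).trans ?_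
      calc v⁻¹ * (2 * min 1 (v ^ 2 * ‖z‖)) ≤ v⁻¹ * (2 * 1) := by
            gcongr; exact min_le_left _ _
        _ = _ := by ring
    · simpa using tendsto_inv_atTop_zero.const_mul (2 : ℝ)

theorem integral_inv_sq_mul_one_sub_exp_scale {z : ℂ} (hz : 0 < z.re) {s : ℝ} (hs : 0 < s) :
    ∫ v in Set.Ioi (0 : ℝ), (((v ^ 2)⁻¹ : ℝ) : ℂ) *
      (1 - Complex.exp (-((s ^ 2 * v ^ 2 : ℝ) : ℂ) * z)) = s * ((√π : ℂ) * z ^ ((1 : ℂ) / 2)) := by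
  have h := integral_comp_mul_left_Ioi (fun v : ℝ => (((v ^ 2)⁻¹ : ℝ) : ℂ) *
    (1 - Complex.exp (-((v ^ 2 : ℝ) : ℂ) * z))) 0 hs
  rw [mul_zero, integral_inv_sq_mul_one_sub_exp hz] at h
  have hs' : (s : ℂ) ≠ 0 := by exact_mod_cast hs.ne'
  have e : ∀ v : ℝ, (((v ^ 2)⁻¹ : ℝ) : ℂ) * (1 - Complex.exp (-((s ^ 2 * v ^ 2 : ℝ) : ℂ) * z)) =
      (s : ℂ) ^ 2 * ((((s * v) ^ 2)⁻¹ : ℝ) * (1 - Complex.exp (-(((s * v) ^ 2 : ℝ) : ℂ) * z))) := by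
    intro v
    rw [mul_pow]
    push_cast
    field_simp
  simp_rw [e]
  rw [integral_const_mul, h, Complex.real_smul]
  push_cast
  field_simp

end SquareRoot

section Weights

/-- The weight `min (v ^ (3/2)) (v ^ (1/2))`. -/
def vWeight (v : ℝ) : ℝ := min (v ^ (3 / 2 : ℝ)) (v ^ (1 / 2 : ℝ))

/-- The weight `(1 + y) ^ 2 * (1 + 1 / y) ^ (1/2)`. -/
def yWeight (y : ℝ) : ℝ := (1 + y) ^ 2 * (1 + y⁻¹) ^ (1 / 2 : ℝ)

theorem vWeight_nonneg {v : ℝ} (hv : 0 < v) : 0 ≤ vWeight v :=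
  le_min (by positivity) (by positivity)

theorem one_le_yWeight {y : ℝ} (hy : 0 < y) : 1 ≤ yWeight y := by
  have h1 : (1 : ℝ) ≤ (1 + y) ^ 2 := by nlinarith
  have h2 : (1 : ℝ) ≤ (1 + y⁻¹) ^ (1 / 2 : ℝ) :=
    Real.one_le_rpow (by have := inv_pos.2 hy; linarith) (by norm_num)
  exact one_le_mul_of_one_le_of_one_le h1 h2

theorem sq_le_yWeight {y : ℝ} (hy : 0 < y) : (1 + y) ^ 2 ≤ yWeight y := by
  have h2 : (1 : ℝ) ≤ (1 + y⁻¹) ^ (1 / 2 : ℝ) :=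
    Real.one_le_rpow (by have := inv_pos.2 hy; linarith) (by norm_num)
  exact le_mul_of_one_le_right (by positivity) h2

theorem min_one_sq_le_rpow {x : ℝ} (hx : 0 < x) {e : ℝ} (he : 0 ≤ e) (he' : e ≤ 2) :
    min 1 (x ^ 2) ≤ x ^ e := by
  rcases le_total 1 x with h | h
  · exact (min_le_left _ _).trans (Real.one_le_rpow h he)
  · refine (min_le_right _ _).trans ?_
    rw [← Real.rpow_two]
    exact Real.rpow_le_rpow_of_exponent_ge hx h he'

theorem min_one_sq_le_vWeight {v : ℝ} (hv : 0 < v) : min 1 (v ^ 2) ≤ vWeight v :=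
  le_min (min_one_sq_le_rpow hv (by norm_num) (by norm_num))
    (min_one_sq_le_rpow hv (by norm_num) (by norm_num))

theorem min_one_mul_sq_le_vWeight {s v : ℝ} (hs : 0 < s) (hv : 0 < v) :
    min 1 (s ^ 2 * v ^ 2) ≤ (s ^ (3 / 2 : ℝ) + s ^ (1 / 2 : ℝ)) * vWeight v := by
  have h1 := min_one_sq_le_rpow (mul_pos hs hv) (e := 3 / 2) (by norm_num) (by norm_num)
  have h2 := min_one_sq_le_rpow (mul_pos hs hv) (e := 1 / 2) (by norm_num) (by norm_num)
  rw [mul_pow, Real.mul_rpow hs.le hv.le] at h1 h2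
  have p1 : 0 ≤ s ^ (3 / 2 : ℝ) := by positivity
  have p2 : 0 ≤ s ^ (1 / 2 : ℝ) := by positivity
  have p3 : 0 ≤ v ^ (3 / 2 : ℝ) := by positivity
  have p4 : 0 ≤ v ^ (1 / 2 : ℝ) := by positivity
  unfold vWeight
  rcases min_cases (v ^ (3 / 2 : ℝ)) (v ^ (1 / 2 : ℝ)) with ⟨h, -⟩ | ⟨h, -⟩
  · rw [h]; nlinarith
  · rw [h]; nlinarith

theorem min_rpow_mul_rpow_le_vWeight {v : ℝ} (hv : 0 < v) :
    (min 1 (v ^ 2)) ^ (7 / 8 : ℝ) * (1 + v ^ 2) ^ (1 / 4 : ℝ) ≤ 2 * vWeight v := by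
  unfold vWeight
  rw [mul_min_of_nonneg _ _ (by norm_num)]
  rcases le_total v 1 with h | h
  · have hv2 : v ^ 2 ≤ 1 := by nlinarith
    have h1 : (1 + v ^ 2) ^ (1 / 4 : ℝ) ≤ 2 := by
      calc (1 + v ^ 2) ^ (1 / 4 : ℝ) ≤ (1 + v ^ 2) ^ (1 : ℝ) :=
            Real.rpow_le_rpow_of_exponent_le (by nlinarith) (by norm_num)
        _ ≤ 2 := by rw [Real.rpow_one]; linarith
    have h2 : (min 1 (v ^ 2)) ^ (7 / 8 : ℝ) = v ^ (7 / 4 : ℝ) := by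
      rw [min_eq_right hv2, ← Real.rpow_two, ← Real.rpow_mul hv.le]; norm_num
    have key : ∀ e : ℝ, e ≤ 7 / 4 → v ^ (7 / 4 : ℝ) * (1 + v ^ 2) ^ (1 / 4 : ℝ) ≤ 2 * v ^ e := by
      intro e he
      have := Real.rpow_le_rpow_of_exponent_ge hv h he
      have p : 0 ≤ v ^ (7 / 4 : ℝ) := by positivity
      nlinarith
    rw [h2]
    exact le_min (key _ (by norm_num)) (key _ (by norm_num))
  · have hv2 : 1 ≤ v ^ 2 := by nlinarith
    rw [min_eq_left hv2, Real.one_rpow, one_mul]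
    have h1 : (1 + v ^ 2) ^ (1 / 4 : ℝ) ≤ 2 * v ^ (1 / 2 : ℝ) := by
      calc (1 + v ^ 2) ^ (1 / 4 : ℝ) ≤ (2 * v ^ 2) ^ (1 / 4 : ℝ) := by gcongr; linarith
        _ = 2 ^ (1 / 4 : ℝ) * v ^ (1 / 2 : ℝ) := by
            rw [Real.mul_rpow (by norm_num) (by positivity), ← Real.rpow_two v,
              ← Real.rpow_mul hv.le]; norm_num
        _ ≤ 2 ^ (1 : ℝ) * v ^ (1 / 2 : ℝ) := by
            gcongr
            · norm_num
            · norm_num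
        _ = _ := by norm_num
    refine le_min (h1.trans ?_) h1
    have := Real.rpow_le_rpow_of_exponent_le h (by norm_num : (1 / 2 : ℝ) ≤ 3 / 2)
    linarith

theorem min_le_rpow_mul_rpow {A B : ℝ} (hA : 0 ≤ A) (hB : 0 ≤ B) :
    min A B ≤ A ^ (7 / 8 : ℝ) * B ^ (1 / 8 : ℝ) := by
  have hm : 0 ≤ min A B := le_min hA hB
  calc min A B = min A B ^ (7 / 8 : ℝ) * min A B ^ (1 / 8 : ℝ) := by
        rw [← Real.rpow_add_of_nonneg hm (by norm_num) (by norm_num)]; norm_num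
    _ ≤ _ := by
        gcongr
        · exact min_le_left _ _
        · exact min_le_right _ _

variable {s v x y z R : ℝ}

theorem min_one_add_le (hx : 0 < x) (hy : 0 < y) (hz : 0 < z) :
    min 1 (v ^ 2 * (4 * x ^ 2 + 8 * y ^ 2 * z)) ≤
      16 * min 1 (v ^ 2) * ((1 + x) ^ 2 * ((1 + y) ^ 2 * (1 + z) ^ 2)) := by
  have h1 : x ^ 2 ≤ (1 + x) ^ 2 := by nlinarith
  have h2 : y ^ 2 ≤ (1 + y) ^ 2 := by nlinarith
  have h3 : z ≤ (1 + z) ^ 2 := by nlinarith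
  have h1' : 1 ≤ (1 + x) ^ 2 := by nlinarith
  have h2' : 1 ≤ (1 + y) ^ 2 := by nlinarith
  have h3' : 1 ≤ (1 + z) ^ 2 := by nlinarith
  set X := (1 + x) ^ 2
  set Y := (1 + y) ^ 2
  set Z := (1 + z) ^ 2
  have hYZ : 1 ≤ Y * Z := one_le_mul_of_one_le_of_one_le h2' h3'
  have hXYZ : 1 ≤ X * (Y * Z) := one_le_mul_of_one_le_of_one_le h1' hYZ
  have e1 : y ^ 2 * z ≤ Y * Z := by gcongr
  have e2 : x ^ 2 ≤ X * (Y * Z) := h1.trans (le_mul_of_one_le_right (by linarith) hYZ)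
  have e3 : Y * Z ≤ X * (Y * Z) := le_mul_of_one_le_left (by linarith) h1'
  rcases min_cases 1 (v ^ 2) with ⟨h, -⟩ | ⟨h, -⟩
  · rw [h]
    exact (min_le_left _ _).trans (by linarith)
  · rw [h]
    refine (min_le_right _ _).trans ?_
    have : 4 * x ^ 2 + 8 * y ^ 2 * z ≤ 16 * (X * (Y * Z)) := by nlinarith
    nlinarith [sq_nonneg v]

theorem translate_sum_le (hx : 0 < x) (hy : 0 < y) (hz : 0 < z) (hs : 0 < s) (hR : 0 < R)
    (hRs : R ≤ s) : 2 * x * (R / s) + 8 * y ^ 2 * z * (R / s) ^ 2 ≤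
      10 * (R / s) * ((1 + x) ^ 2 * ((1 + y) ^ 2 * (1 + z) ^ 2)) := by
  have hr0 : 0 < R / s := by positivity
  have hr1 : R / s ≤ 1 := (div_le_one hs).2 hRs
  set r := R / s
  have h1 : x ≤ (1 + x) ^ 2 := by nlinarith
  have h2 : y ^ 2 ≤ (1 + y) ^ 2 := by nlinarith
  have h3 : z ≤ (1 + z) ^ 2 := by nlinarith
  have h1' : 1 ≤ (1 + x) ^ 2 := by nlinarith
  have h2' : 1 ≤ (1 + y) ^ 2 := by nlinarith
  have h3' : 1 ≤ (1 + z) ^ 2 := by nlinarith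
  set X := (1 + x) ^ 2
  set Y := (1 + y) ^ 2
  set Z := (1 + z) ^ 2
  have hYZ : 1 ≤ Y * Z := one_le_mul_of_one_le_of_one_le h2' h3'
  have e1 : y ^ 2 * z ≤ Y * Z := by gcongr
  have e2 : x ≤ X * (Y * Z) := h1.trans (le_mul_of_one_le_right (by linarith) hYZ)
  have e3 : Y * Z ≤ X * (Y * Z) := le_mul_of_one_le_left (by linarith) h1'
  have hr2 : r ^ 2 ≤ r := by nlinarith
  have e4 : y ^ 2 * z * r ^ 2 ≤ X * (Y * Z) * r :=
    mul_le_mul (e1.trans e3) hr2 (by positivity) (by positivity)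
  nlinarith

theorem tail_sum_le (hv : 0 < v) (hx : 0 < x) (hy : 0 < y) (hz : 0 < z) (hs : 0 < s) (hR : 0 < R)
    (hsR : s ≤ R) : (s / R) ^ 2 * (1 / (4 * x ^ 2) + v ^ 2) +
        (s / R) ^ 4 * (1 / (64 * y ^ 4 * z ^ 2) + v ^ 4) ≤
      10 * (s / R) * (1 + v ^ 2) ^ 2 *
        ((1 + x⁻¹) ^ 4 * ((1 + y⁻¹) ^ 4 * (1 + z⁻¹) ^ 4)) := by
  have hv2 : 0 ≤ v ^ 2 := sq_nonneg v
  have hV : 1 ≤ (1 + v ^ 2) ^ 2 := one_le_pow₀ (by linarith)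
  have hv2V : v ^ 2 ≤ (1 + v ^ 2) ^ 2 := by nlinarith [sq_nonneg (v ^ 2)]
  have hv4V : v ^ 4 ≤ (1 + v ^ 2) ^ 2 := by linarith [show (1 + v ^ 2) ^ 2 = 1 + 2 * v ^ 2 + v ^ 4 by ring]
  have hr0 : 0 < s / R := by positivity
  have hr1 : s / R ≤ 1 := (div_le_one hR).2 hsR
  set r := s / R
  have hr2 : r ^ 2 ≤ r := by nlinarith
  have hr4 : r ^ 4 ≤ r := by nlinarith [mul_nonneg hr0.le hr0.le, pow_le_one₀ hr0.le hr1 (n := 3)]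
  have aux : ∀ {w : ℝ}, 0 < w → 1 ≤ (1 + w⁻¹) ^ 4 := fun {w} hw =>
    one_le_pow₀ (by have := inv_pos.2 hw; linarith)
  have aux' : ∀ {w : ℝ} {k : ℕ}, 0 < w → k ≤ 4 → w⁻¹ ^ k ≤ (1 + w⁻¹) ^ 4 := fun {w k} hw hk => by
    have := inv_pos.2 hw
    calc w⁻¹ ^ k ≤ (1 + w⁻¹) ^ k := by gcongr; linarith
      _ ≤ _ := pow_le_pow_right₀ (by linarith) hk
  have h1 : x⁻¹ ^ 2 ≤ (1 + x⁻¹) ^ 4 := aux' hx (by norm_num)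
  have h2 : y⁻¹ ^ 4 ≤ (1 + y⁻¹) ^ 4 := aux' hy (by norm_num)
  have h3 : z⁻¹ ^ 2 ≤ (1 + z⁻¹) ^ 4 := aux' hz (by norm_num)
  have h1' := aux hx
  have h2' := aux hy
  have h3' := aux hz
  rw [show 1 / (4 * x ^ 2) = x⁻¹ ^ 2 / 4 by field_simp,
    show 1 / (64 * y ^ 4 * z ^ 2) = y⁻¹ ^ 4 * z⁻¹ ^ 2 / 64 by field_simp]
  have q1 := sq_nonneg x⁻¹
  have q2 : 0 ≤ y⁻¹ ^ 4 := by positivity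
  have q3 : 0 ≤ z⁻¹ ^ 2 := by positivity
  set X := (1 + x⁻¹) ^ 4
  set Y := (1 + y⁻¹) ^ 4
  set Z := (1 + z⁻¹) ^ 4
  have hYZ : 1 ≤ Y * Z := one_le_mul_of_one_le_of_one_le h2' h3'
  have hXYZ : 1 ≤ X * (Y * Z) := one_le_mul_of_one_le_of_one_le h1' hYZ
  have e1 : y⁻¹ ^ 4 * z⁻¹ ^ 2 ≤ Y * Z := by gcongr
  have e2 : x⁻¹ ^ 2 ≤ X * (Y * Z) := h1.trans (le_mul_of_one_le_right (by linarith) hYZ)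
  have e3 : Y * Z ≤ X * (Y * Z) := le_mul_of_one_le_left (by linarith) h1'
  clear_value X Y Z
  set P := X * (Y * Z)
  clear_value P r
  have hP : 1 ≤ P := hXYZ
  have hVP : (1 + v ^ 2) ^ 2 ≤ (1 + v ^ 2) ^ 2 * P := le_mul_of_one_le_right (by positivity) hP
  have hPV : P ≤ (1 + v ^ 2) ^ 2 * P := le_mul_of_one_le_left (by linarith) hV
  have f1 : x⁻¹ ^ 2 / 4 + v ^ 2 ≤ 2 * ((1 + v ^ 2) ^ 2 * P) := by linarith
  have f2 : y⁻¹ ^ 4 * z⁻¹ ^ 2 / 64 + v ^ 4 ≤ 2 * ((1 + v ^ 2) ^ 2 * P) := by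
    have : 0 ≤ y⁻¹ ^ 4 * z⁻¹ ^ 2 := by positivity
    linarith
  calc _ ≤ r * (2 * ((1 + v ^ 2) ^ 2 * P)) + r * (2 * ((1 + v ^ 2) ^ 2 * P)) := by gcongr
    _ ≤ _ := by
      have : 0 ≤ r * ((1 + v ^ 2) ^ 2 * P) := by positivity
      rw [mul_assoc (10 * r), mul_assoc 10]
      linarith

theorem hormander_weight_le (hv : 0 < v) (hx : 0 < x) (hy : 0 < y) (hz : 0 < z) (hs : 0 < s)
    (hR : 0 < R) :
    min (min 1 (v ^ 2 * (4 * x ^ 2 + 8 * y ^ 2 * z)))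
      (min (2 * x * (R / s) + 8 * y ^ 2 * z * (R / s) ^ 2)
        ((s / R) ^ 2 * (1 / (4 * x ^ 2) + v ^ 2) +
          (s / R) ^ 4 * (1 / (64 * y ^ 4 * z ^ 2) + v ^ 4))) ≤
      32 * (min (R / s) (s / R)) ^ (1 / 8 : ℝ) * (vWeight v *
        (yWeight x * (yWeight y * yWeight z))) := by
  set r := min (R / s) (s / R) with hr
  have hr0 : 0 < r := lt_min (by positivity) (by positivity)
  obtain ⟨Y, hY⟩ : ∃ Y, Y = (1 + x) ^ 2 * ((1 + y) ^ 2 * (1 + z) ^ 2) := ⟨_, rfl⟩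
  obtain ⟨W, hW⟩ : ∃ W, W = (1 + x⁻¹) ^ 4 * ((1 + y⁻¹) ^ 4 * (1 + z⁻¹) ^ 4) := ⟨_, rfl⟩
  have hx' := inv_pos.2 hx
  have hy' := inv_pos.2 hy
  have hz' := inv_pos.2 hz
  have hY1 : 1 ≤ Y := hY ▸ one_le_mul_of_one_le_of_one_le (one_le_pow₀ (by linarith))
    (one_le_mul_of_one_le_of_one_le (one_le_pow₀ (by linarith)) (one_le_pow₀ (by linarith)))
  have hW1 : 1 ≤ W := hW ▸ one_le_mul_of_one_le_of_one_le (one_le_pow₀ (by linarith))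
    (one_le_mul_of_one_le_of_one_le (one_le_pow₀ (by linarith)) (one_le_pow₀ (by linarith)))
  have hY0 : 0 ≤ Y := zero_le_one.trans hY1
  have hV1 : 1 ≤ (1 + v ^ 2) ^ 2 := one_le_pow₀ (by nlinarith)
  have hA := min_one_add_le (v := v) hx hy hz
  rw [← hY] at hA
  have hB : min (2 * x * (R / s) + 8 * y ^ 2 * z * (R / s) ^ 2)
        ((s / R) ^ 2 * (1 / (4 * x ^ 2) + v ^ 2) +
          (s / R) ^ 4 * (1 / (64 * y ^ 4 * z ^ 2) + v ^ 4)) ≤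
      10 * r * (1 + v ^ 2) ^ 2 * (Y * W) := by
    rcases le_total R s with h | h
    · have hre : r = R / s := min_eq_left <|
        ((div_le_one hs).2 h).trans ((one_le_div hR).2 h)
      refine (min_le_left _ _).trans ((translate_sum_le hx hy hz hs hR h).trans ?_)
      rw [← hY, hre, mul_assoc (10 * (R / s)) ((1 + v ^ 2) ^ 2)]
      refine mul_le_mul_of_nonneg_left ?_ (by positivity)
      calc Y = 1 * (Y * 1) := by ring
        _ ≤ (1 + v ^ 2) ^ 2 * (Y * W) := by gcongr
    · have hre : r = s / R := min_eq_right <|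
        ((div_le_one hR).2 h).trans ((one_le_div hs).2 h)
      refine (min_le_right _ _).trans ((tail_sum_le hv hx hy hz hs hR h).trans ?_)
      rw [← hW, hre]
      refine mul_le_mul_of_nonneg_left ?_ (by positivity)
      exact le_mul_of_one_le_left (zero_le_one.trans hW1) hY1
  have hm : 0 ≤ min 1 (v ^ 2) := le_min zero_le_one (sq_nonneg v)
  refine (min_le_min hA hB).trans ((min_le_rpow_mul_rpow (by positivity) (by positivity)).trans ?_)
  have sp : ∀ {w : ℝ} {k : ℕ}, 0 ≤ w → (w ^ k) ^ (1 / 8 : ℝ) = w ^ (k / 8 : ℝ) := fun {w k} hw => by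
    rw [← Real.rpow_natCast, ← Real.rpow_mul hw]; ring_nf
  have hWr : W ^ (1 / 8 : ℝ) = (1 + x⁻¹) ^ (1 / 2 : ℝ) *
      ((1 + y⁻¹) ^ (1 / 2 : ℝ) * (1 + z⁻¹) ^ (1 / 2 : ℝ)) := by
    rw [hW, Real.mul_rpow (by positivity) (by positivity),
      Real.mul_rpow (by positivity) (by positivity), sp (by positivity), sp (by positivity),
      sp (by positivity)]
    norm_num
  have hYr : Y ^ (7 / 8 : ℝ) * Y ^ (1 / 8 : ℝ) = Y := by
    rw [← Real.rpow_add (by linarith)]; norm_num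
  have h16 : (16 : ℝ) ^ (7 / 8 : ℝ) * 10 ^ (1 / 8 : ℝ) ≤ 16 := by
    calc (16 : ℝ) ^ (7 / 8 : ℝ) * 10 ^ (1 / 8 : ℝ) ≤ 16 ^ (7 / 8 : ℝ) * 16 ^ (1 / 8 : ℝ) := by
          gcongr; norm_num
      _ = 16 := by rw [← Real.rpow_add (by norm_num)]; norm_num
  have hv8 := min_rpow_mul_rpow_le_vWeight hv
  have eA : (16 * min 1 (v ^ 2) * Y) ^ (7 / 8 : ℝ) =
      16 ^ (7 / 8 : ℝ) * (min 1 (v ^ 2)) ^ (7 / 8 : ℝ) * Y ^ (7 / 8 : ℝ) := by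
    rw [Real.mul_rpow (by positivity) hY0, Real.mul_rpow (by norm_num) hm]
  have eB : (10 * r * (1 + v ^ 2) ^ 2 * (Y * W)) ^ (1 / 8 : ℝ) =
      10 ^ (1 / 8 : ℝ) * r ^ (1 / 8 : ℝ) * (1 + v ^ 2) ^ (1 / 4 : ℝ) *
        (Y ^ (1 / 8 : ℝ) * W ^ (1 / 8 : ℝ)) := by
    rw [Real.mul_rpow (by positivity) (by positivity),
      Real.mul_rpow (by positivity) (by positivity), Real.mul_rpow (by norm_num) hr0.le,
      Real.mul_rpow hY0 (zero_le_one.trans hW1), sp (by positivity)]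
    norm_num
  rw [eA, eB]
  calc _ = (16 ^ (7 / 8 : ℝ) * 10 ^ (1 / 8 : ℝ)) * r ^ (1 / 8 : ℝ) *
        ((min 1 (v ^ 2)) ^ (7 / 8 : ℝ) * (1 + v ^ 2) ^ (1 / 4 : ℝ)) *
          ((Y ^ (7 / 8 : ℝ) * Y ^ (1 / 8 : ℝ)) * W ^ (1 / 8 : ℝ)) := by
        ring
    _ ≤ 16 * r ^ (1 / 8 : ℝ) * (2 * vWeight v) * (Y * W ^ (1 / 8 : ℝ)) := by
        rw [hYr]
        gcongr
    _ = _ := by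
        rw [hWr, hY]
        unfold yWeight
        ring

end Weights

section WeightIntegrals

theorem lintegral_ofReal_lt_top {α : Type*} [MeasurableSpace α] {μ : Measure α} {f : α → ℝ}
    (hf : Integrable f μ) : ∫⁻ x, ENNReal.ofReal (f x) ∂μ < ⊤ :=
  lt_of_le_of_lt (lintegral_mono fun x => (Real.ofReal_le_enorm (f x))) hf.2

theorem measurable_vWeight : Measurable vWeight := by unfold vWeight; fun_prop

theorem measurable_yWeight : Measurable yWeight := by unfold yWeight; fun_prop

theorem lintegral_vWeight_lt_top :
    ∫⁻ v in Set.Ioi (0 : ℝ), ENNReal.ofReal ((v ^ 2)⁻¹ * vWeight v) < ⊤ := by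
  have hm : Measurable fun v : ℝ => (v ^ 2)⁻¹ * vWeight v :=
    (by fun_prop : Measurable fun v : ℝ => (v ^ 2)⁻¹).mul measurable_vWeight
  have key : ∀ v : ℝ, 0 < v → ∀ e : ℝ, (v ^ 2)⁻¹ * v ^ e = v ^ (e - 2) := fun v hv e => by
    rw [Real.rpow_sub hv, Real.rpow_two, div_eq_inv_mul]
  refine lintegral_ofReal_lt_top ?_
  change IntegrableOn _ _ _
  rw [← Set.Ioc_union_Ioi_eq_Ioi zero_le_one]
  refine IntegrableOn.union ?_ ?_
  · have h : IntegrableOn (fun v : ℝ => v ^ (3 / 2 - 2 : ℝ)) (Set.Ioc 0 1) :=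
      (intervalIntegrable_iff_integrableOn_Ioc_of_le zero_le_one).1
        (intervalIntegral.intervalIntegrable_rpow' (by norm_num))
    refine Integrable.mono' h hm.aestronglyMeasurable
      ((ae_restrict_iff' measurableSet_Ioc).2 (Filter.Eventually.of_forall fun v hv => ?_))
    have hv0 : 0 < v := hv.1
    have := vWeight_nonneg hv0
    rw [Real.norm_of_nonneg (by positivity), ← key v hv0]
    gcongr
    exact min_le_left _ _
  · have h : IntegrableOn (fun v : ℝ => v ^ (1 / 2 - 2 : ℝ)) (Set.Ioi 1) :=
      integrableOn_Ioi_rpow_of_lt (by norm_num) one_pos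
    refine Integrable.mono' h hm.aestronglyMeasurable
      ((ae_restrict_iff' measurableSet_Ioi).2 (Filter.Eventually.of_forall fun v hv => ?_))
    have hv0 : 0 < v := zero_lt_one.trans hv
    have := vWeight_nonneg hv0
    rw [Real.norm_of_nonneg (by positivity), ← key v hv0]
    gcongr
    exact min_le_right _ _

theorem lintegral_yWeight_lt_top :
    ∫⁻ y in Set.Ioi (0 : ℝ), ENNReal.ofReal (halfGauss y * yWeight y) < ⊤ := by
  have hm : Measurable fun y : ℝ => halfGauss y * yWeight y :=
    continuous_halfGauss.measurable.mul measurable_yWeight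
  have hi : ∀ e : ℝ, -1 < e → IntegrableOn (fun y : ℝ => y ^ e * Real.exp (-1 * y ^ 2)) (Set.Ioi 0) :=
    fun e he => integrableOn_rpow_mul_exp_neg_mul_sq one_pos he
  have h := ((((hi 0 (by norm_num)).add (hi 2 (by norm_num))).add (hi (-(1 / 2)) (by norm_num))).add
    (hi (3 / 2) (by norm_num))).const_mul (2 / √π * 2)
  refine lintegral_ofReal_lt_top (Integrable.mono' h hm.aestronglyMeasurable
    ((ae_restrict_iff' measurableSet_Ioi).2 (Filter.Eventually.of_forall fun y hy => ?_)))
  have hy : 0 < y := hy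
  have h1 := one_le_yWeight hy
  rw [Real.norm_of_nonneg (mul_nonneg (halfGauss_nonneg y) (by linarith))]
  simp only [Pi.add_apply, halfGauss, yWeight, neg_one_mul, ← add_mul]
  have e1 : (1 + y) ^ 2 ≤ 2 * (1 + y ^ 2) := by nlinarith [sq_nonneg (1 - y)]
  have e2 : (1 + y⁻¹) ^ (1 / 2 : ℝ) ≤ 1 + y ^ (-(1 / 2) : ℝ) := by
    have := Real.rpow_add_le_add_rpow (a := 1) (b := y⁻¹) (p := 1 / 2) (by norm_num) (by positivity)
      (by norm_num) (by norm_num)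
    rwa [Real.one_rpow, Real.inv_rpow hy.le, ← Real.rpow_neg hy.le] at this
  have e3 : y ^ 2 * y ^ (-(1 / 2) : ℝ) = y ^ (3 / 2 : ℝ) := by
    rw [← Real.rpow_two, ← Real.rpow_add hy]; norm_num
  calc _ ≤ 2 / √π * Real.exp (-y ^ 2) * (2 * (1 + y ^ 2) * (1 + y ^ (-(1 / 2) : ℝ))) := by gcongr
    _ = _ := by
      rw [Real.rpow_zero, Real.rpow_two, ← e3]
      ring

/-- The majorant in the variable `s` for the Hörmander condition at scale `R`. -/
def sWeight (R s : ℝ) : ℝ :=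
  Real.exp (-s) * (s ^ (1 / 2 : ℝ) + s ^ (-(1 / 2) : ℝ)) +
    32 * (s⁻¹ * (min (R / s) (s / R)) ^ (1 / 8 : ℝ))

theorem measurable_sWeight (R : ℝ) : Measurable (sWeight R) := by unfold sWeight; fun_prop

theorem integrableOn_exp_mul_rpow :
    IntegrableOn (fun s : ℝ => Real.exp (-s) * (s ^ (1 / 2 : ℝ) + s ^ (-(1 / 2) : ℝ)))
      (Set.Ioi 0) := by
  have h1 := Real.GammaIntegral_convergent (s := 3 / 2) (by norm_num)
  have h2 := Real.GammaIntegral_convergent (s := 1 / 2) (by norm_num)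
  refine (h1.add h2).congr (Filter.Eventually.of_forall fun s => ?_)
  simp only [Pi.add_apply]
  rw [mul_add]
  norm_num

theorem lintegral_inv_mul_min_rpow_le {R : ℝ} (hR : 0 < R) :
    ∫⁻ s in Set.Ioi (0 : ℝ), ENNReal.ofReal (s⁻¹ * (min (R / s) (s / R)) ^ (1 / 8 : ℝ)) ≤
      ENNReal.ofReal 16 := by
  rw [← Set.Ioc_union_Ioi_eq_Ioi hR.le]
  refine (lintegral_union_le _ _ _).trans ?_
  rw [show (16 : ℝ) = 8 + 8 by norm_num, ENNReal.ofReal_add (by norm_num) (by norm_num)]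
  have hR8 : R ^ (1 / 8 : ℝ) ≠ 0 := (Real.rpow_pos_of_pos hR _).ne'
  refine add_le_add ?_ ?_
  · have hi : IntegrableOn (fun s : ℝ => (R ^ (1 / 8 : ℝ))⁻¹ * s ^ (-(7 / 8) : ℝ)) (Set.Ioc 0 R) :=
      Integrable.const_mul ((intervalIntegrable_iff_integrableOn_Ioc_of_le hR.le).1
        (intervalIntegral.intervalIntegrable_rpow' (by norm_num))) _
    have hv : ∫ s in Set.Ioc 0 R, (R ^ (1 / 8 : ℝ))⁻¹ * s ^ (-(7 / 8) : ℝ) = 8 := by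
      rw [integral_const_mul, ← intervalIntegral.integral_of_le hR.le,
        integral_rpow (Or.inl (by norm_num)), Real.zero_rpow (by norm_num)]
      norm_num
      field_simp
    rw [congrArg ENNReal.ofReal hv.symm, ofReal_integral_eq_lintegral_ofReal hi]
    · refine setLIntegral_mono' measurableSet_Ioc fun s hs => ENNReal.ofReal_le_ofReal ?_
      have hs0 : 0 < s := hs.1
      calc s⁻¹ * (min (R / s) (s / R)) ^ (1 / 8 : ℝ) ≤ s⁻¹ * (s / R) ^ (1 / 8 : ℝ) := by
            gcongr
            exact min_le_right _ _
        _ = _ := by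
            rw [Real.div_rpow hs0.le hR.le, show (-(7 / 8) : ℝ) = 1 / 8 - 1 by norm_num,
              Real.rpow_sub hs0, Real.rpow_one]
            field_simp
    · refine (ae_restrict_iff' measurableSet_Ioc).2 (Filter.Eventually.of_forall fun s hs => ?_)
      have hs0 : 0 < s := hs.1
      simp only [Pi.zero_apply]
      positivity
  · have hi : IntegrableOn (fun s : ℝ => R ^ (1 / 8 : ℝ) * s ^ (-(9 / 8) : ℝ)) (Set.Ioi R) :=
      Integrable.const_mul (integrableOn_Ioi_rpow_of_lt (by norm_num) hR) _
    have hv : ∫ s in Set.Ioi R, R ^ (1 / 8 : ℝ) * s ^ (-(9 / 8) : ℝ) = 8 := by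
      rw [integral_const_mul, integral_Ioi_rpow_of_lt (by norm_num) hR,
        show (-(9 / 8) + 1 : ℝ) = -(1 / 8) by norm_num, Real.rpow_neg hR.le]
      field_simp
    rw [congrArg ENNReal.ofReal hv.symm, ofReal_integral_eq_lintegral_ofReal hi]
    · refine setLIntegral_mono' measurableSet_Ioi fun s hs => ENNReal.ofReal_le_ofReal ?_
      have hs0 : 0 < s := hR.trans hs
      calc s⁻¹ * (min (R / s) (s / R)) ^ (1 / 8 : ℝ) ≤ s⁻¹ * (R / s) ^ (1 / 8 : ℝ) := by
            gcongr
            exact min_le_left _ _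
        _ = _ := by
            rw [Real.div_rpow hR.le hs0.le, show (-(9 / 8) : ℝ) = -(1 / 8) - 1 by norm_num,
              Real.rpow_sub hs0, Real.rpow_one, Real.rpow_neg hs0.le]
            field_simp
    · refine (ae_restrict_iff' measurableSet_Ioi).2 (Filter.Eventually.of_forall fun s hs => ?_)
      have hs0 : 0 < s := hR.trans hs
      simp only [Pi.zero_apply]
      positivity

theorem exists_lintegral_sWeight_le :
    ∃ C : ℝ≥0∞, C ≠ ⊤ ∧ ∀ R : ℝ, 0 < R →
      ∫⁻ s in Set.Ioi (0 : ℝ), ENNReal.ofReal (sWeight R s) ≤ C := by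
  refine ⟨(∫⁻ s in Set.Ioi (0 : ℝ), ENNReal.ofReal
    (Real.exp (-s) * (s ^ (1 / 2 : ℝ) + s ^ (-(1 / 2) : ℝ)))) + 32 * ENNReal.ofReal 16, ?_, ?_⟩
  · exact ENNReal.add_ne_top.2 ⟨(lintegral_ofReal_lt_top integrableOn_exp_mul_rpow).ne,
      ENNReal.mul_ne_top (by norm_num) ENNReal.ofReal_ne_top⟩
  · intro R hR
    calc _ ≤ ∫⁻ s in Set.Ioi (0 : ℝ), (ENNReal.ofReal
          (Real.exp (-s) * (s ^ (1 / 2 : ℝ) + s ^ (-(1 / 2) : ℝ))) +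
            32 * ENNReal.ofReal (s⁻¹ * (min (R / s) (s / R)) ^ (1 / 8 : ℝ))) := by
          refine lintegral_mono fun s => ?_
          refine ENNReal.ofReal_add_le.trans ?_
          rw [ENNReal.ofReal_mul (by norm_num : (0 : ℝ) ≤ 32)]
          simp
      _ ≤ _ := by
          rw [lintegral_add_left (by fun_prop), lintegral_const_mul _ (by fun_prop)]
          gcongr
          exact lintegral_inv_mul_min_rpow_le hR

end WeightIntegrals

section Mixture

variable {n : ℕ}

/-- The density of the mixture, in the parameters `(s, v, y₁, y₂, y₃)`. -/
def mixWeight (ω : ℝ × ℝ × ℝ × ℝ × ℝ) : ℝ :=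
  (√π)⁻¹ * (Real.exp (-ω.1) * ω.1⁻¹ * ((ω.2.1 ^ 2)⁻¹ *
    (halfGauss ω.2.2.1 * (halfGauss ω.2.2.2.1 * halfGauss ω.2.2.2.2))))

/-- The mixture components, in the parameters `(s, v, y₁, y₂, y₃)`. -/
def mixKer (ω : ℝ × ℝ × ℝ × ℝ × ℝ) (x : Rn1 n) : ℝ :=
  mixWeight ω * bKer ((ω.1 / (2 * ω.2.2.1)) ^ 2) ((ω.1 ^ 2 / (8 * ω.2.2.2.1 ^ 2 * ω.2.2.2.2)) ^ 2)
    (ω.1 ^ 2 * ω.2.1 ^ 2) x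

/-- The mixing measure, with `s` cut off at `ε`. -/
def mixMeasure (ε : ℝ) : Measure (ℝ × ℝ × ℝ × ℝ × ℝ) :=
  (volume.restrict (Set.Ioi ε)).prod ((volume.restrict (Set.Ioi 0)).prod
    ((volume.restrict (Set.Ioi 0)).prod ((volume.restrict (Set.Ioi 0)).prod
      (volume.restrict (Set.Ioi 0)))))

instance (ε : ℝ) : SFinite (mixMeasure ε) := by unfold mixMeasure; infer_instance

theorem ae_mixMeasure (ε : ℝ) : ∀ᵐ ω ∂(mixMeasure ε),
    ε < ω.1 ∧ 0 < ω.2.1 ∧ 0 < ω.2.2.1 ∧ 0 < ω.2.2.2.1 ∧ 0 < ω.2.2.2.2 := by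
  unfold mixMeasure
  rw [Measure.prod_restrict, Measure.prod_restrict, Measure.prod_restrict, Measure.prod_restrict]
  filter_upwards [ae_restrict_mem (by measurability)] with ω hω
  simpa only [Set.mem_prod, Set.mem_Ioi] using hω

theorem lintegral_mixMeasure_mul {f g h : ℝ → ℝ≥0∞} (hf : Measurable f) (hg : Measurable g)
    (hh : Measurable h) (ε : ℝ) :
    ∫⁻ ω, f ω.1 * (g ω.2.1 * (h ω.2.2.1 * (h ω.2.2.2.1 * h ω.2.2.2.2))) ∂(mixMeasure ε) =
      (∫⁻ s in Set.Ioi ε, f s) * ((∫⁻ v in Set.Ioi 0, g v) *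
        ((∫⁻ y in Set.Ioi 0, h y) * ((∫⁻ y in Set.Ioi 0, h y) * (∫⁻ y in Set.Ioi 0, h y)))) := by
  unfold mixMeasure
  rw [lintegral_prod_mul (f := f)
      (g := fun ω : ℝ × ℝ × ℝ × ℝ => g ω.1 * (h ω.2.1 * (h ω.2.2.1 * h ω.2.2.2)))
      hf.aemeasurable (by fun_prop),
    lintegral_prod_mul (f := g) (g := fun ω : ℝ × ℝ × ℝ => h ω.1 * (h ω.2.1 * h ω.2.2))
      hg.aemeasurable (by fun_prop),
    lintegral_prod_mul (f := h) (g := fun ω : ℝ × ℝ => h ω.1 * h ω.2)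
      hh.aemeasurable (by fun_prop),
    lintegral_prod_mul (f := h) (g := h) hh.aemeasurable hh.aemeasurable]

theorem measurable_mixWeight : Measurable mixWeight := by
  have := continuous_halfGauss.measurable
  unfold mixWeight
  fun_prop

theorem measurable_uncurry_mixKer :
    Measurable (Function.uncurry fun ω (x : Rn1 n) => ((mixKer ω x : ℝ) : ℂ)) := by
  have hg : ∀ {V : Type} [NormedAddCommGroup V] [InnerProductSpace ℝ V] [MeasurableSpace V]
      [BorelSpace V] [FiniteDimensional ℝ V]
      {A : (ℝ × ℝ × ℝ × ℝ × ℝ) × Rn1 n → ℝ} {B : (ℝ × ℝ × ℝ × ℝ × ℝ) × Rn1 n → V},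
      Measurable A → Measurable B → Measurable fun z => gaussKer (A z) (B z) :=
    fun hA hB => measurable_gaussKer.comp (hA.prodMk hB)
  refine Complex.measurable_ofReal.comp ?_
  change Measurable fun z : (ℝ × ℝ × ℝ × ℝ × ℝ) × Rn1 n => mixKer z.1 z.2
  unfold mixKer bKer pKer
  refine (measurable_mixWeight.comp measurable_fst).mul (((hg ?_ ?_).mul (hg ?_ ?_)).sub
    (Measurable.mul ?_ ((hg ?_ ?_).mul (hg ?_ ?_)))) <;> fun_prop

theorem mixWeight_nonneg {ω : ℝ × ℝ × ℝ × ℝ × ℝ} (hs : 0 < ω.1) : 0 ≤ mixWeight ω := by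
  have := halfGauss_nonneg
  have h2 := mul_nonneg (this ω.2.2.1) (mul_nonneg (this ω.2.2.2.1) (this ω.2.2.2.2))
  unfold mixWeight
  positivity

/-- The product majorant of the mixture in the parameters `v, y₁, y₂, y₃`. -/
theorem ofReal_prod_majorant {c a v x y z : ℝ} (hc : 0 ≤ c) (ha : 0 ≤ a) (hv : 0 < v)
    (hx : 0 < x) (hy : 0 < y) :
    ENNReal.ofReal (c * (a * (((v ^ 2)⁻¹ * vWeight v) * ((halfGauss x * yWeight x) *
      ((halfGauss y * yWeight y) * (halfGauss z * yWeight z)))))) =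
    ENNReal.ofReal c * (ENNReal.ofReal a * (ENNReal.ofReal ((v ^ 2)⁻¹ * vWeight v) *
      (ENNReal.ofReal (halfGauss x * yWeight x) * (ENNReal.ofReal (halfGauss y * yWeight y) *
        ENNReal.ofReal (halfGauss z * yWeight z))))) := by
  have h1 := vWeight_nonneg hv
  have h2 := mul_nonneg (halfGauss_nonneg x) (zero_le_one.trans (one_le_yWeight hx))
  have h3 := mul_nonneg (halfGauss_nonneg y) (zero_le_one.trans (one_le_yWeight hy))
  rw [ENNReal.ofReal_mul hc, ENNReal.ofReal_mul ha, ENNReal.ofReal_mul (by positivity),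
    ENNReal.ofReal_mul h2, ENNReal.ofReal_mul h3]

/-- The majorant in the variable `s` for integrability. -/
def tWeight (s : ℝ) : ℝ :=
  Real.exp (-s) * (s ^ (1 / 2 : ℝ) + s ^ (-(1 / 2) : ℝ)) + 16 * (Real.exp (-s) * s⁻¹)

theorem measurable_tWeight : Measurable tWeight := by unfold tWeight; fun_prop

theorem lintegral_tWeight_lt_top {ε : ℝ} (hε : 0 < ε) :
    ∫⁻ s in Set.Ioi ε, ENNReal.ofReal (tWeight s) < ⊤ := by
  have h1 := integrableOn_exp_mul_rpow.mono_set (Set.Ioi_subset_Ioi hε.le)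
  have h2 : IntegrableOn (fun s : ℝ => 16 * (Real.exp (-s) * s⁻¹)) (Set.Ioi ε) := by
    refine Integrable.const_mul ?_ _
    refine Integrable.mono' ((integrableOn_exp_neg_Ioi ε).mul_const ε⁻¹)
      (by fun_prop) ((ae_restrict_iff' measurableSet_Ioi).2
        (Filter.Eventually.of_forall fun s hs => ?_))
    have hs : ε < s := hs
    have hs0 : 0 < s := hε.trans hs
    rw [Real.norm_of_nonneg (by positivity)]
    gcongr
  exact lintegral_ofReal_lt_top (h1.add h2)

variable {ω : ℝ × ℝ × ℝ × ℝ × ℝ}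

theorem lintegral_enorm_mixKer_le (hs : 0 < ω.1) (hv : 0 < ω.2.1) (h1 : 0 < ω.2.2.1)
    (h2 : 0 < ω.2.2.2.1) (h3 : 0 < ω.2.2.2.2) :
    ∫⁻ x : Rn1 n, ‖mixKer ω x‖ₑ ≤ ENNReal.ofReal (40 * pConst n * (√π)⁻¹) *
      (ENNReal.ofReal (tWeight ω.1) * (ENNReal.ofReal ((ω.2.1 ^ 2)⁻¹ * vWeight ω.2.1) *
      (ENNReal.ofReal (halfGauss ω.2.2.1 * yWeight ω.2.2.1) *
        (ENNReal.ofReal (halfGauss ω.2.2.2.1 * yWeight ω.2.2.2.1) *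
        ENNReal.ofReal (halfGauss ω.2.2.2.2 * yWeight ω.2.2.2.2))))) := by
  have hW := mixWeight_nonneg hs
  obtain ⟨s, v, x, y, z⟩ := ω
  simp only at *
  have hp := pConst_pos n
  have ha : 0 < (s / (2 * x)) ^ 2 := by positivity
  have hb : 0 < (s ^ 2 / (8 * y ^ 2 * z)) ^ 2 := by positivity
  have hu : 0 ≤ s ^ 2 * v ^ 2 := by positivity
  have hB := lintegral_enorm_bKer_le (n := n) ha hb hu
  have hkx := halfGauss_nonneg x
  have hky := halfGauss_nonneg y
  have hkz := halfGauss_nonneg z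
  have ht : 0 ≤ tWeight s := by unfold tWeight; positivity
  rw [← ofReal_prod_majorant (by positivity) ht hv h1 h2]
  unfold mixKer
  simp_rw [enorm_mul]
  rw [lintegral_const_mul' _ _ enorm_ne_top, Real.enorm_of_nonneg hW]
  refine (mul_le_mul_right hB _).trans ?_
  rw [← ENNReal.ofReal_mul hW]
  refine ENNReal.ofReal_le_ofReal ?_
  rw [Real.sqrt_sq (by positivity)]
  have e1 : s ^ 2 * v ^ 2 / (s / (2 * x)) ^ 2 + s ^ 2 * v ^ 2 / (s ^ 2 / (8 * y ^ 2 * z)) =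
      v ^ 2 * (4 * x ^ 2 + 8 * y ^ 2 * z) := by field_simp; ring
  rw [e1]
  have b1 := min_one_mul_sq_le_vWeight hs hv
  have b2 := min_one_add_le (v := v) h1 h2 h3
  have b3 := min_one_sq_le_vWeight hv
  have g1 := sq_le_yWeight h1
  have g2 := sq_le_yWeight h2
  have g3 := sq_le_yWeight h3
  have n1 := one_le_yWeight h1
  have n2 := one_le_yWeight h2
  have n3 := one_le_yWeight h3
  have nv := vWeight_nonneg hv
  have nN : 1 ≤ yWeight x * (yWeight y * yWeight z) :=
    one_le_mul_of_one_le_of_one_le n1 (one_le_mul_of_one_le_of_one_le n2 n3)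
  have c1 : min 1 (s ^ 2 * v ^ 2) ≤ (s ^ (3 / 2 : ℝ) + s ^ (1 / 2 : ℝ)) * vWeight v *
      (yWeight x * (yWeight y * yWeight z)) :=
    b1.trans (le_mul_of_one_le_right (by positivity) nN)
  have c2 : min 1 (v ^ 2 * (4 * x ^ 2 + 8 * y ^ 2 * z)) ≤ 16 * vWeight v *
      (yWeight x * (yWeight y * yWeight z)) := by
    refine b2.trans ?_
    gcongr
  have p1 : s⁻¹ * s ^ (3 / 2 : ℝ) = s ^ (1 / 2 : ℝ) := by
    rw [← Real.rpow_neg_one, ← Real.rpow_add hs]; norm_num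
  have p2 : s⁻¹ * s ^ (1 / 2 : ℝ) = s ^ (-(1 / 2) : ℝ) := by
    rw [← Real.rpow_neg_one, ← Real.rpow_add hs]; norm_num
  have htw : tWeight s = Real.exp (-s) * s⁻¹ * (s ^ (3 / 2 : ℝ) + s ^ (1 / 2 : ℝ) + 16) := by
    unfold tWeight
    linear_combination -Real.exp (-s) * p1 - Real.exp (-s) * p2
  calc _ ≤ mixWeight (s, v, x, y, z) * (40 * pConst n *
        ((s ^ (3 / 2 : ℝ) + s ^ (1 / 2 : ℝ)) * vWeight v * (yWeight x * (yWeight y * yWeight z)) +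
          16 * vWeight v * (yWeight x * (yWeight y * yWeight z)))) := by gcongr
    _ = _ := by
      rw [htw]
      unfold mixWeight
      ring

theorem setLIntegral_mixKer_sub_le (hs : 0 < ω.1) (hv : 0 < ω.2.1) (h1 : 0 < ω.2.2.1)
    (h2 : 0 < ω.2.2.2.1) (h3 : 0 < ω.2.2.2.2) {R : ℝ} (hR : 0 < R) {y : Rn1 n}
    (hy1 : ‖y.1‖ ≤ R) (hy2 : |y.2| ≤ R ^ 2) :
    ∫⁻ x in {x : Rn1 n | 2 * R ≤ ‖x.1‖ ∨ 2 * R ^ 2 ≤ |x.2|}, ‖mixKer ω (x - y) - mixKer ω x‖ₑ ≤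
      ENNReal.ofReal (100 * pConst n * (√π)⁻¹) *
      (ENNReal.ofReal (sWeight R ω.1) * (ENNReal.ofReal ((ω.2.1 ^ 2)⁻¹ * vWeight ω.2.1) *
      (ENNReal.ofReal (halfGauss ω.2.2.1 * yWeight ω.2.2.1) *
        (ENNReal.ofReal (halfGauss ω.2.2.2.1 * yWeight ω.2.2.2.1) *
        ENNReal.ofReal (halfGauss ω.2.2.2.2 * yWeight ω.2.2.2.2))))) := by
  have hW := mixWeight_nonneg hs
  obtain ⟨s, v, x₁, x₂, x₃⟩ := ω
  simp only at *
  have hp := pConst_pos n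
  have ha : 0 < (s / (2 * x₁)) ^ 2 := by positivity
  have hb : 0 < (s ^ 2 / (8 * x₂ ^ 2 * x₃)) ^ 2 := by positivity
  have hu : 0 ≤ s ^ 2 * v ^ 2 := by positivity
  have hB := setLIntegral_bKer_sub_le (n := n) ha hb hu hR hy1 hy2
  have hkx := halfGauss_nonneg x₁
  have hky := halfGauss_nonneg x₂
  have hkz := halfGauss_nonneg x₃
  have hr : 0 < min (R / s) (s / R) := lt_min (by positivity) (by positivity)
  have ht : 0 ≤ sWeight R s := by unfold sWeight; positivity
  rw [← ofReal_prod_majorant (by positivity) ht hv h1 h2]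
  unfold mixKer
  simp_rw [← mul_sub, enorm_mul]
  rw [lintegral_const_mul' _ _ enorm_ne_top, Real.enorm_of_nonneg hW]
  refine (mul_le_mul_right hB _).trans ?_
  rw [← ENNReal.ofReal_mul hW]
  refine ENNReal.ofReal_le_ofReal ?_
  rw [Real.sqrt_sq (by positivity), Real.sqrt_sq (by positivity)]
  have e1 : s ^ 2 * v ^ 2 / (s / (2 * x₁)) ^ 2 + s ^ 2 * v ^ 2 / (s ^ 2 / (8 * x₂ ^ 2 * x₃)) =
      v ^ 2 * (4 * x₁ ^ 2 + 8 * x₂ ^ 2 * x₃) := by field_simp; ring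
  have e2 : R / (s / (2 * x₁)) + R ^ 2 / (s ^ 2 / (8 * x₂ ^ 2 * x₃)) =
      2 * x₁ * (R / s) + 8 * x₂ ^ 2 * x₃ * (R / s) ^ 2 := by field_simp
  have e3 : ((s / (2 * x₁)) ^ 2 + s ^ 2 * v ^ 2) / R ^ 2 +
      ((s ^ 2 / (8 * x₂ ^ 2 * x₃)) ^ 2 + (s ^ 2 * v ^ 2) ^ 2) / R ^ 4 =
      (s / R) ^ 2 * (1 / (4 * x₁ ^ 2) + v ^ 2) +
        (s / R) ^ 4 * (1 / (64 * x₂ ^ 4 * x₃ ^ 2) + v ^ 4) := by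
    field_simp
    ring
  rw [e1, e2, e3]
  have b1 := min_one_mul_sq_le_vWeight hs hv
  have c2 := hormander_weight_le hv h1 h2 h3 hs hR
  have n1 := one_le_yWeight h1
  have n2 := one_le_yWeight h2
  have n3 := one_le_yWeight h3
  have nv := vWeight_nonneg hv
  have nN : 1 ≤ yWeight x₁ * (yWeight x₂ * yWeight x₃) :=
    one_le_mul_of_one_le_of_one_le n1 (one_le_mul_of_one_le_of_one_le n2 n3)
  have c1 : min 1 (s ^ 2 * v ^ 2) ≤ (s ^ (3 / 2 : ℝ) + s ^ (1 / 2 : ℝ)) * vWeight v *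
      (yWeight x₁ * (yWeight x₂ * yWeight x₃)) :=
    b1.trans (le_mul_of_one_le_right (by positivity) nN)
  have p1 : s⁻¹ * s ^ (3 / 2 : ℝ) = s ^ (1 / 2 : ℝ) := by
    rw [← Real.rpow_neg_one, ← Real.rpow_add hs]; norm_num
  have p2 : s⁻¹ * s ^ (1 / 2 : ℝ) = s ^ (-(1 / 2) : ℝ) := by
    rw [← Real.rpow_neg_one, ← Real.rpow_add hs]; norm_num
  have hexp : Real.exp (-s) ≤ 1 := Real.exp_le_one_iff.2 (by linarith)
  have hsw : Real.exp (-s) * s⁻¹ * (s ^ (3 / 2 : ℝ) + s ^ (1 / 2 : ℝ) +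
      32 * (min (R / s) (s / R)) ^ (1 / 8 : ℝ)) ≤ sWeight R s := by
    have q : 0 ≤ s⁻¹ * (min (R / s) (s / R)) ^ (1 / 8 : ℝ) := by positivity
    have e : sWeight R s = Real.exp (-s) * s⁻¹ * (s ^ (3 / 2 : ℝ) + s ^ (1 / 2 : ℝ)) +
        32 * (s⁻¹ * (min (R / s) (s / R)) ^ (1 / 8 : ℝ)) := by
      unfold sWeight
      linear_combination -Real.exp (-s) * p1 - Real.exp (-s) * p2
    rw [e, mul_add]
    nlinarith
  calc _ ≤ mixWeight (s, v, x₁, x₂, x₃) * (100 * pConst n *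
        ((s ^ (3 / 2 : ℝ) + s ^ (1 / 2 : ℝ)) * vWeight v *
          (yWeight x₁ * (yWeight x₂ * yWeight x₃)) +
          32 * (min (R / s) (s / R)) ^ (1 / 8 : ℝ) * (vWeight v *
            (yWeight x₁ * (yWeight x₂ * yWeight x₃))))) := by gcongr
    _ = (Real.exp (-s) * s⁻¹ * (s ^ (3 / 2 : ℝ) + s ^ (1 / 2 : ℝ) +
          32 * (min (R / s) (s / R)) ^ (1 / 8 : ℝ))) * (100 * pConst n * (√π)⁻¹ *
        (((v ^ 2)⁻¹ * vWeight v) * ((halfGauss x₁ * yWeight x₁) *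
          ((halfGauss x₂ * yWeight x₂) * (halfGauss x₃ * yWeight x₃))))) := by
      unfold mixWeight
      ring
    _ ≤ sWeight R s * (100 * pConst n * (√π)⁻¹ *
        (((v ^ 2)⁻¹ * vWeight v) * ((halfGauss x₁ * yWeight x₁) *
          ((halfGauss x₂ * yWeight x₂) * (halfGauss x₃ * yWeight x₃))))) := by gcongr
    _ = _ := by ring

end Mixture

section MixtureTransform

variable {n : ℕ}

theorem enorm_complex_ofReal (r : ℝ) : ‖((r : ℝ) : ℂ)‖ₑ = ‖r‖ₑ := by
  rw [← ofReal_norm, ← ofReal_norm, Complex.norm_real]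

theorem integrable_uncurry_mixKer {ε : ℝ} (hε : 0 < ε) :
    Integrable (Function.uncurry fun ω (x : Rn1 n) => ((mixKer ω x : ℝ) : ℂ))
      ((mixMeasure ε).prod volume) := by
  refine ⟨measurable_uncurry_mixKer.aestronglyMeasurable, ?_⟩
  rw [HasFiniteIntegral, lintegral_prod _ measurable_uncurry_mixKer.enorm.aemeasurable]
  refine lt_of_le_of_lt (lintegral_mono_ae (g := fun ω =>
      ENNReal.ofReal (40 * pConst n * (√π)⁻¹) *
      (ENNReal.ofReal (tWeight ω.1) * (ENNReal.ofReal ((ω.2.1 ^ 2)⁻¹ * vWeight ω.2.1) *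
      (ENNReal.ofReal (halfGauss ω.2.2.1 * yWeight ω.2.2.1) *
        (ENNReal.ofReal (halfGauss ω.2.2.2.1 * yWeight ω.2.2.2.1) *
        ENNReal.ofReal (halfGauss ω.2.2.2.2 * yWeight ω.2.2.2.2)))))) ?_) ?_
  · filter_upwards [ae_mixMeasure ε] with ω hω
    simp only [Function.uncurry, enorm_complex_ofReal]
    exact lintegral_enorm_mixKer_le (hε.trans hω.1) hω.2.1 hω.2.2.1 hω.2.2.2.1 hω.2.2.2.2
  · have m1 := measurable_tWeight
    have m2 := measurable_vWeight
    have m3 := measurable_yWeight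
    have m4 := continuous_halfGauss.measurable
    rw [lintegral_const_mul' _ _ ENNReal.ofReal_ne_top,
      lintegral_mixMeasure_mul (f := fun s => ENNReal.ofReal (tWeight s))
        (g := fun v => ENNReal.ofReal ((v ^ 2)⁻¹ * vWeight v))
        (h := fun y => ENNReal.ofReal (halfGauss y * yWeight y))
        (by fun_prop) (by fun_prop) (by fun_prop)]
    exact ENNReal.mul_lt_top ENNReal.ofReal_lt_top (ENNReal.mul_lt_top (lintegral_tWeight_lt_top hε)
      (ENNReal.mul_lt_top lintegral_vWeight_lt_top (ENNReal.mul_lt_top lintegral_yWeight_lt_top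
        (ENNReal.mul_lt_top lintegral_yWeight_lt_top lintegral_yWeight_lt_top))))

theorem exists_setLIntegral_mixture_sub_le (n : ℕ) : ∃ A : ℝ, ∀ ε : ℝ, 0 < ε → ∀ R : ℝ, 0 < R →
    ∀ y : Rn1 n, ‖y.1‖ ≤ R → |y.2| ≤ R ^ 2 →
      ∫⁻ x in {x : Rn1 n | 2 * R ≤ ‖x.1‖ ∨ 2 * R ^ 2 ≤ |x.2|},
        ‖(∫ ω, ((mixKer ω (x - y) : ℝ) : ℂ) ∂(mixMeasure ε)) -
          ∫ ω, ((mixKer ω x : ℝ) : ℂ) ∂(mixMeasure ε)‖ₑ ≤ ENNReal.ofReal A := by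
  obtain ⟨C, hC, hCR⟩ := exists_lintegral_sWeight_le
  set J := ∫⁻ v in Set.Ioi (0 : ℝ), ENNReal.ofReal ((v ^ 2)⁻¹ * vWeight v) with hJ
  set L := ∫⁻ y in Set.Ioi (0 : ℝ), ENNReal.ofReal (halfGauss y * yWeight y) with hL
  have hJ' : J ≠ ⊤ := lintegral_vWeight_lt_top.ne
  have hL' : L ≠ ⊤ := lintegral_yWeight_lt_top.ne
  have hA : ENNReal.ofReal (100 * pConst n * (√π)⁻¹) * (C * (J * (L * (L * L)))) ≠ ⊤ := by
    finiteness
  refine ⟨(ENNReal.ofReal (100 * pConst n * (√π)⁻¹) * (C * (J * (L * (L * L))))).toReal,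
    fun ε hε R hR y hy1 hy2 => ?_⟩
  rw [ENNReal.ofReal_toReal hA]
  refine (setLIntegral_superposition_le measurable_uncurry_mixKer (integrable_uncurry_mixKer hε)
    _ y).trans ?_
  have m1 := measurable_sWeight R
  have m2 := measurable_vWeight
  have m3 := measurable_yWeight
  have m4 := continuous_halfGauss.measurable
  refine (lintegral_mono_ae (g := fun ω =>
      ENNReal.ofReal (100 * pConst n * (√π)⁻¹) *
      (ENNReal.ofReal (sWeight R ω.1) * (ENNReal.ofReal ((ω.2.1 ^ 2)⁻¹ * vWeight ω.2.1) *
      (ENNReal.ofReal (halfGauss ω.2.2.1 * yWeight ω.2.2.1) *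
        (ENNReal.ofReal (halfGauss ω.2.2.2.1 * yWeight ω.2.2.2.1) *
        ENNReal.ofReal (halfGauss ω.2.2.2.2 * yWeight ω.2.2.2.2)))))) ?_).trans ?_
  · filter_upwards [ae_mixMeasure ε] with ω hω
    simp_rw [← Complex.ofReal_sub, enorm_complex_ofReal]
    exact setLIntegral_mixKer_sub_le (hε.trans hω.1) hω.2.1 hω.2.2.1 hω.2.2.2.1 hω.2.2.2.2
      hR hy1 hy2
  · rw [lintegral_const_mul' _ _ ENNReal.ofReal_ne_top,
      lintegral_mixMeasure_mul (f := fun s => ENNReal.ofReal (sWeight R s))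
        (g := fun v => ENNReal.ofReal ((v ^ 2)⁻¹ * vWeight v))
        (h := fun y => ENNReal.ofReal (halfGauss y * yWeight y))
        (by fun_prop) (by fun_prop) (by fun_prop)]
    gcongr
    exact (lintegral_mono_set (Set.Ioi_subset_Ioi hε.le)).trans (hCR R hR)

theorem FT1_const_mul (c : ℂ) (f : Rn1 n → ℂ) (q : Rn1 n) :
    FT1 (fun x => c * f x) q = c * FT1 f q := by
  unfold FT1
  rw [← integral_const_mul]
  congr 1 with x
  ring

/-- The parabolic symbol `1 + 4π²|ξ|² + iτ`. -/
def heatSym (q : Rn1 n) : ℂ :=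
  1 + 4 * (π : ℂ) ^ 2 * (‖q.1‖ : ℂ) ^ 2 + Complex.I * (q.2 : ℂ)

/-- The parabolic size `1 + |ξ| + |τ|^{1/2}`. -/
def parSize (q : Rn1 n) : ℝ := 1 + ‖q.1‖ + |q.2| ^ ((1 : ℝ) / 2)

theorem heatSym_re (q : Rn1 n) : (heatSym q).re = 1 + 4 * π ^ 2 * ‖q.1‖ ^ 2 := by
  have : heatSym q = ((1 + 4 * π ^ 2 * ‖q.1‖ ^ 2 : ℝ) : ℂ) + (q.2 : ℂ) * Complex.I := by
    unfold heatSym; push_cast; ring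
  rw [this]
  simp only [Complex.add_re, Complex.ofReal_re, Complex.re_ofReal_mul, Complex.I_re, mul_zero,
    add_zero]

theorem heatSym_re_pos (q : Rn1 n) : 0 < (heatSym q).re := by
  rw [heatSym_re]; positivity

theorem one_le_parSize (q : Rn1 n) : 1 ≤ parSize q := by
  have : 0 ≤ |q.2| ^ ((1 : ℝ) / 2) := by positivity
  unfold parSize
  linarith [norm_nonneg q.1]

theorem norm_heatSym_cpow_le (q : Rn1 n) : ‖heatSym q ^ ((1 : ℂ) / 2)‖ ≤ 7 * parSize q := by
  have h0 : heatSym q ≠ 0 := fun h => by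
    have := heatSym_re_pos q
    simp [h] at this
  have h1 : ‖heatSym q ^ ((1 : ℂ) / 2)‖ ^ 2 = ‖heatSym q‖ := by
    rw [sq, ← norm_mul, ← Complex.cpow_add _ _ h0]
    norm_num
  have h2 : ‖heatSym q‖ ≤ 1 + 4 * π ^ 2 * ‖q.1‖ ^ 2 + |q.2| := by
    unfold heatSym
    refine (norm_add_le _ _).trans (add_le_add ((norm_add_le _ _).trans ?_) ?_)
    · simp
    · simp
  have ht : |q.2| = (|q.2| ^ ((1 : ℝ) / 2)) ^ 2 := by
    rw [← Real.sqrt_eq_rpow, Real.sq_sqrt (abs_nonneg _)]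
  have hx := norm_nonneg q.1
  have hr : 0 ≤ |q.2| ^ ((1 : ℝ) / 2) := by positivity
  have hπ := Real.pi_pos
  have hπ2 : π < 3.15 := Real.pi_lt_d2
  refine le_of_sq_le_sq ?_ (by have := one_le_parSize q; linarith)
  rw [h1]
  refine h2.trans ?_
  rw [ht]
  unfold parSize
  have e : 4 * π ^ 2 ≤ 49 := by nlinarith
  nlinarith [mul_nonneg hx hr, sq_nonneg ‖q.1‖]

/-- The Fourier transform of a mixture component, split into its factors. -/
theorem FT1_mixKer {ω : ℝ × ℝ × ℝ × ℝ × ℝ} (hs : 0 < ω.1) (h1 : 0 < ω.2.2.1)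
    (h2 : 0 < ω.2.2.2.1) (h3 : 0 < ω.2.2.2.2) (q : Rn1 n) :
    FT1 (fun x => ((mixKer ω x : ℝ) : ℂ)) q =
      (((√π)⁻¹ * (Real.exp (-ω.1) * ω.1⁻¹) : ℝ) : ℂ) *
        (((((ω.2.1 ^ 2)⁻¹ : ℝ) : ℂ) *
          (1 - Complex.exp (-((ω.1 ^ 2 * ω.2.1 ^ 2 : ℝ) : ℂ) * heatSym q))) *
        (((halfGauss ω.2.2.1 * Real.exp (-((ω.1 * ‖q.1‖) ^ 2 / (4 * ω.2.2.1 ^ 2))) : ℝ) : ℂ) *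
          ((halfGauss ω.2.2.2.1 * (halfGauss ω.2.2.2.2 * Real.exp
            (-((ω.1 ^ 2 * |q.2| / (4 * ω.2.2.2.1 ^ 2)) ^ 2 / (4 * ω.2.2.2.2 ^ 2)))) : ℝ) : ℂ))) := by
  obtain ⟨s, v, x, y, z⟩ := ω
  simp only at *
  have hu : 0 ≤ s ^ 2 * v ^ 2 := by positivity
  have ha : 0 < (s / (2 * x)) ^ 2 := by positivity
  have hb : 0 < (s ^ 2 / (8 * y ^ 2 * z)) ^ 2 := by positivity
  have e1 : -(((s * ‖q.1‖) ^ 2 / (4 * x ^ 2))) = -((s / (2 * x)) ^ 2) * ‖q.1‖ ^ 2 := by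
    field_simp; ring
  have e2 : -((s ^ 2 * |q.2| / (4 * y ^ 2)) ^ 2 / (4 * z ^ 2)) =
      -((s ^ 2 / (8 * y ^ 2 * z)) ^ 2) * q.2 ^ 2 := by
    rw [← sq_abs q.2]; field_simp; ring
  unfold mixKer
  simp only [Complex.ofReal_mul]
  rw [FT1_const_mul, FT1_bKer ha hb hu q, e1, e2]
  unfold mixWeight heatSym
  push_cast
  ring

theorem integral_halfGauss_mul_halfGauss_mul_exp {s τ : ℝ} (hs : 0 ≤ s) :
    ∫ w, halfGauss w.1 * (halfGauss w.2 *
      Real.exp (-((s ^ 2 * |τ| / (4 * w.1 ^ 2)) ^ 2 / (4 * w.2 ^ 2))))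
        ∂((volume.restrict (Set.Ioi (0 : ℝ))).prod (volume.restrict (Set.Ioi (0 : ℝ)))) =
      Real.exp (-(s * |τ| ^ ((1 : ℝ) / 2))) := by
  have m4 := continuous_halfGauss.measurable
  have hi : Integrable (fun w : ℝ × ℝ => halfGauss w.1 * (halfGauss w.2 *
      Real.exp (-((s ^ 2 * |τ| / (4 * w.1 ^ 2)) ^ 2 / (4 * w.2 ^ 2)))))
        ((volume.restrict (Set.Ioi (0 : ℝ))).prod (volume.restrict (Set.Ioi (0 : ℝ)))) := by
    refine Integrable.mono' (Integrable.mul_prod integrableOn_halfGauss integrableOn_halfGauss)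
      (by fun_prop) (Filter.Eventually.of_forall fun w => ?_)
    have h1 := halfGauss_nonneg w.1
    have h2 := halfGauss_nonneg w.2
    rw [Real.norm_of_nonneg (by positivity)]
    refine mul_le_mul_of_nonneg_left (mul_le_of_le_one_right h2 ?_) h1
    exact Real.exp_le_one_iff.2 (neg_nonpos.2 (by positivity))
  rw [integral_prod _ hi]
  simp only
  simp_rw [integral_const_mul]
  rw [← integral_halfGauss_mul_exp (t := s * |τ| ^ ((1 : ℝ) / 2)) (by positivity)]
  refine integral_congr_ae (Filter.Eventually.of_forall fun y => ?_)
  simp only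
  rw [integral_halfGauss_mul_exp (by positivity), mul_pow, ← Real.sqrt_eq_rpow,
    Real.sq_sqrt (abs_nonneg _)]

theorem integral_exp_neg_mul_parSize (ε : ℝ) (q : Rn1 n) :
    ∫ s in Set.Ioi ε, Real.exp (-(s * parSize q)) = Real.exp (-(ε * parSize q)) / parSize q := by
  have h := integral_exp_mul_Ioi (a := -parSize q) (by linarith [one_le_parSize q]) ε
  rw [neg_div_neg_eq] at h
  simp only [neg_mul, mul_comm (parSize q)] at h
  exact h

theorem FT1_mixture {ε : ℝ} (hε : 0 < ε) (q : Rn1 n) :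
    FT1 (fun x => ∫ ω, ((mixKer ω x : ℝ) : ℂ) ∂(mixMeasure ε)) q =
      heatSym q ^ ((1 : ℂ) / 2) / ((parSize q : ℝ) : ℂ) *
        ((Real.exp (-(ε * parSize q)) : ℝ) : ℂ) := by
  have hΦ := integrable_uncurry_mixKer (n := n) hε
  rw [FT1_superposition hΦ]
  have hi := integrable_FT1_superposition hΦ q
  have hae : ∀ᵐ ω ∂(mixMeasure ε), _ = _ := (ae_mixMeasure ε).mono fun ω hω =>
    FT1_mixKer (hε.trans hω.1) hω.2.2.1 hω.2.2.2.1 hω.2.2.2.2 q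
  have hi' := hi.congr hae
  rw [integral_congr_ae hae]
  unfold mixMeasure at hi' ⊢
  rw [integral_prod _ hi']
  have hpi : (√π : ℂ) ≠ 0 := by exact_mod_cast (Real.sqrt_pos.2 Real.pi_pos).ne'
  have key : ∀ s ∈ Set.Ioi ε,
      ∫ w : ℝ × ℝ × ℝ × ℝ, (((√π)⁻¹ * (Real.exp (-s) * s⁻¹) : ℝ) : ℂ) *
        (((((w.1 ^ 2)⁻¹ : ℝ) : ℂ) *
          (1 - Complex.exp (-((s ^ 2 * w.1 ^ 2 : ℝ) : ℂ) * heatSym q))) *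
        (((halfGauss w.2.1 * Real.exp (-((s * ‖q.1‖) ^ 2 / (4 * w.2.1 ^ 2))) : ℝ) : ℂ) *
          ((halfGauss w.2.2.1 * (halfGauss w.2.2.2 * Real.exp
            (-((s ^ 2 * |q.2| / (4 * w.2.2.1 ^ 2)) ^ 2 / (4 * w.2.2.2 ^ 2)))) : ℝ) : ℂ)))
        ∂((volume.restrict (Set.Ioi (0 : ℝ))).prod ((volume.restrict (Set.Ioi (0 : ℝ))).prod
          ((volume.restrict (Set.Ioi (0 : ℝ))).prod (volume.restrict (Set.Ioi (0 : ℝ)))))) =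
      heatSym q ^ ((1 : ℂ) / 2) *
      ((Real.exp (-(s * parSize q)) : ℝ) : ℂ) := fun s hs => by
    have hs0 : 0 < s := hε.trans hs
    have hs' : (s : ℂ) ≠ 0 := by exact_mod_cast hs0.ne'
    refine (integral_const_mul _ _).trans ?_
    refine (congrArg _ (integral_prod_mul (f := fun v : ℝ => (((v ^ 2)⁻¹ : ℝ) : ℂ) *
      (1 - Complex.exp (-((s ^ 2 * v ^ 2 : ℝ) : ℂ) * heatSym q)))
      (g := fun w : ℝ × ℝ × ℝ =>
        ((halfGauss w.1 * Real.exp (-((s * ‖q.1‖) ^ 2 / (4 * w.1 ^ 2))) : ℝ) : ℂ) *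
          ((halfGauss w.2.1 * (halfGauss w.2.2 * Real.exp
            (-((s ^ 2 * |q.2| / (4 * w.2.1 ^ 2)) ^ 2 / (4 * w.2.2 ^ 2)))) : ℝ) : ℂ)))).trans ?_
    rw [integral_prod_mul
      (f := fun x : ℝ => ((halfGauss x * Real.exp (-((s * ‖q.1‖) ^ 2 / (4 * x ^ 2))) : ℝ) : ℂ))
      (g := fun w : ℝ × ℝ => ((halfGauss w.1 * (halfGauss w.2 * Real.exp
            (-((s ^ 2 * |q.2| / (4 * w.1 ^ 2)) ^ 2 / (4 * w.2 ^ 2)))) : ℝ) : ℂ)),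
      integral_inv_sq_mul_one_sub_exp_scale (heatSym_re_pos q) hs0, integral_complex_ofReal, integral_complex_ofReal,
      integral_halfGauss_mul_exp (by positivity), integral_halfGauss_mul_halfGauss_mul_exp hs0.le]
    have e : Real.exp (-(s * parSize q)) = Real.exp (-s) * (Real.exp (-(s * ‖q.1‖)) *
        Real.exp (-(s * |q.2| ^ ((1 : ℝ) / 2)))) := by
      rw [← Real.exp_add, ← Real.exp_add]
      unfold parSize
      ring_nf
    rw [e]
    push_cast
    field_simp
  rw [setIntegral_congr_fun measurableSet_Ioi key, integral_const_mul, integral_complex_ofReal,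
    integral_exp_neg_mul_parSize]
  push_cast
  ring

theorem exists_czKernel_mixture (n : ℕ) : ∃ A : ℝ, ∀ ε : ℝ, 0 < ε →
    CZKernel (fun x : Rn1 n => ∫ ω, ((mixKer ω x : ℝ) : ℂ) ∂(mixMeasure ε)) A := by
  obtain ⟨A, hA⟩ := exists_setLIntegral_mixture_sub_le n
  refine ⟨max 7 A, fun ε hε => ⟨measurable_superposition measurable_uncurry_mixKer,
    integrable_superposition (integrable_uncurry_mixKer hε), fun q => ?_,
    fun R hR y hy1 hy2 => (hA ε hε R hR y hy1 hy2).trans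
      (ENNReal.ofReal_le_ofReal (le_max_right _ _))⟩⟩
  refine le_max_of_le_left ?_
  have hp : 0 < parSize q := zero_lt_one.trans_le (one_le_parSize q)
  rw [FT1_mixture hε, norm_mul, norm_div, Complex.norm_real, Complex.norm_real,
    Real.norm_of_nonneg hp.le, Real.norm_of_nonneg (Real.exp_pos _).le]
  have h1 : ‖heatSym q ^ ((1 : ℂ) / 2)‖ / parSize q ≤ 7 :=
    (div_le_iff₀ hp).2 (norm_heatSym_cpow_le q)
  have h2 : Real.exp (-(ε * parSize q)) ≤ 1 :=
    Real.exp_le_one_iff.2 (neg_nonpos.2 (by positivity))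
  calc _ ≤ 7 * 1 := mul_le_mul h1 h2 (Real.exp_pos _).le (by norm_num)
    _ = 7 := by norm_num

theorem tendsto_mul_exp_neg_parSize (q : Rn1 n) (c : ℂ) :
    Filter.Tendsto (fun k : ℕ => c * ((Real.exp (-((1 / ((k : ℝ) + 1)) * parSize q)) : ℝ) : ℂ))
      Filter.atTop (nhds c) := by
  have h : Filter.Tendsto (fun k : ℕ => -((1 / ((k : ℝ) + 1)) * parSize q)) Filter.atTop
      (nhds (-(0 * parSize q))) :=
    (tendsto_one_div_add_atTop_nhds_zero_nat.mul_const _).neg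
  have h2 := (Complex.continuous_ofReal.tendsto _).comp ((Real.continuous_exp.tendsto _).comp h)
  have h3 := h2.const_mul c
  simpa using h3

end MixtureTransform

/-- The symbol `K̂(ξ,τ) = (1 + 4π²|ξ|² + iτ)^{1/2} / (1 + |ξ| + |τ|^{1/2})` is
an `Lᵖ(ℝ^{n+1})`-multiplier, `1 < p < ∞`. -/
theorem stmt4 (n : ℕ) (hn : 1 ≤ n) (p : ℝ) (hp : 1 < p) :
    ∃ M : ℝ, 0 < M ∧
      ∀ f : SchwartzMap (Rn1 n) ℂ,
        pNorm p (MOp (fun q =>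
            (1 + 4 * (π : ℂ) ^ 2 * (‖q.1‖ : ℂ) ^ 2 + Complex.I * (q.2 : ℂ)) ^ ((1 : ℂ) / 2) /
              ((1 + ‖q.1‖ + |q.2| ^ ((1 : ℝ) / 2) : ℝ) : ℂ)) ⇑f)
          ≤ ENNReal.ofReal M * pNorm p ⇑f := by
  obtain ⟨A, hA⟩ := exists_czKernel_mixture n
  exact exists_pNorm_MOp_le (A := A)
    (m := fun k q => heatSym q ^ ((1 : ℂ) / 2) / ((parSize q : ℝ) : ℂ) *
      ((Real.exp (-((1 / ((k : ℝ) + 1)) * parSize q)) : ℝ) : ℂ))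
    (fun k => ⟨_, hA (1 / ((k : ℝ) + 1)) (by positivity), funext (FT1_mixture (by positivity))⟩)
    (fun q => tendsto_mul_exp_neg_parSize q _) hp
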